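/- Let D⊂ℝ^d be a bounded connected open domain with C³ boundary, γ∈(0,1), ν>0, and let A∈C²(ℝ,ℝ^d) with A(0)=0 satisfy condition (S): there exist c,C>0 with (Σ_{j=1}^d A_j'(u))·sgn(u) ≥ c|u| − C for all u∈ℝ. Let h∈C^{γ/2,γ}(ℝ₊×D) and u₀∈C^{2+γ}(D) satisfy the compatibility conditions u₀=0 and div_x A(u₀) − νΔu₀ − h(0,·)=0 on ∂D, and let u∈X^γ be the solution of ∂_t u + div_x A(u) − νΔu = h, u|_{∂D}=0, u(0,·)=u₀ on ℝ₊×D. Then: (i) there is K>0 depending continuously on |||h|||_γ and ‖u₀‖_{C^{2+γ}} such that ‖u‖_{X^γ} ≤ K; (ii) for any τ>0 there is K_τ>0 depending only on τ and |||h|||_γ (and not on u₀) such that ‖u(τ+·)‖_{X^γ} ≤ K_τ. -/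

import Mathlib

open Set MeasureTheory Filter Topology

noncomputable section

/-- `d`-dimensional Euclidean space. -/
abbrev Euc (d : ℕ) : Type := EuclideanSpace ℝ (Fin d)

/-- The `j`-th vector of the standard basis. -/
def ebasis (d : ℕ) (j : Fin d) : Euc d := EuclideanSpace.single j 1

/-- Time derivative `∂ₜ u (t,x)`. -/
def dtt {d : ℕ} (u : ℝ → Euc d → ℝ) (t : ℝ) (x : Euc d) : ℝ := deriv (fun s => u s x) t

/-- First spatial differential. -/
def dx1 {d : ℕ} (f : Euc d → ℝ) (x : Euc d) : Euc d →L[ℝ] ℝ := fderiv ℝ f x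

/-- Second spatial differential. -/
def dx2 {d : ℕ} (f : Euc d → ℝ) (x : Euc d) : Euc d →L[ℝ] Euc d →L[ℝ] ℝ :=
  fderiv ℝ (fun y => fderiv ℝ f y) x

/-- Laplacian `Δf(x)`. -/
def lapl {d : ℕ} (f : Euc d → ℝ) (x : Euc d) : ℝ :=
  ∑ j : Fin d, dx2 f x (ebasis d j) (ebasis d j)

/-- `div_x A(f) (x) = Σⱼ ∂_{xⱼ} (Aⱼ(f x))`. -/
def divA {d : ℕ} (A : ℝ → Fin d → ℝ) (f : Euc d → ℝ) (x : Euc d) : ℝ :=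
  ∑ j : Fin d, fderiv ℝ (fun y => A (f y) j) x (ebasis d j)

/-- `div (a(t,·) w(t,·)) (x) = Σⱼ ∂_{xⱼ} (aⱼ(t,x) w(t,x))`. -/
def divAW {d : ℕ} (a : ℝ → Euc d → Euc d) (w : ℝ → Euc d → ℝ) (t : ℝ) (x : Euc d) : ℝ :=
  ∑ j : Fin d, fderiv ℝ (fun y => a t y j * w t y) x (ebasis d j)

/-- The boundary of `D` is of class `C³`: near each boundary point, `D` is the sublevel
set of a `C³` function with non-vanishing differential. -/
def HasC3Boundary {d : ℕ} (D : Set (Euc d)) : Prop :=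
  ∀ x ∈ frontier D, ∃ (U : Set (Euc d)) (ψ : Euc d → ℝ),
    IsOpen U ∧ x ∈ U ∧ ContDiff ℝ 3 ψ ∧ (∀ y ∈ U, fderiv ℝ ψ y ≠ 0) ∧
    D ∩ U = {y ∈ U | ψ y < 0}

/-- A bounded connected open domain with `C³` boundary. -/
def GoodDomain {d : ℕ} (D : Set (Euc d)) : Prop :=
  IsOpen D ∧ IsConnected D ∧ Bornology.IsBounded D ∧ HasC3Boundary D

/-- `u ∈ C^{1,2}(J × D̄)`: continuous on the closed cylinder, once continuously
differentiable in `t` and twice in `x`. -/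
def IsC12On {d : ℕ} (J : Set ℝ) (D : Set (Euc d)) (u : ℝ → Euc d → ℝ) : Prop :=
  ContinuousOn (fun p : ℝ × Euc d => u p.1 p.2) (J ×ˢ closure D) ∧
  (∀ x ∈ closure D, ∀ t ∈ J, DifferentiableAt ℝ (fun s => u s x) t) ∧
  (∀ t ∈ J, ∀ x ∈ closure D, DifferentiableAt ℝ (u t) x) ∧
  (∀ t ∈ J, ∀ x ∈ closure D, DifferentiableAt ℝ (fun y => fderiv ℝ (u t) y) x) ∧
  ContinuousOn (fun p : ℝ × Euc d => dtt u p.1 p.2) (J ×ˢ closure D) ∧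
  ContinuousOn (fun p : ℝ × Euc d => dx1 (u p.1) p.2) (J ×ˢ closure D) ∧
  ContinuousOn (fun p : ℝ × Euc d => dx2 (u p.1) p.2) (J ×ˢ closure D)

/-- `N` bounds both the sup-norm and the parabolic Hölder seminorm of exponent `γ`
of `f` on `J × D̄`. -/
def parHolderBound {d : ℕ} {Y : Type*} [NormedAddCommGroup Y] (γ : ℝ) (J : Set ℝ)
    (D : Set (Euc d)) (f : ℝ → Euc d → Y) (N : ℝ) : Prop :=
  (∀ t ∈ J, ∀ x ∈ closure D, ‖f t x‖ ≤ N) ∧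
  ∀ t₁ ∈ J, ∀ t₂ ∈ J, ∀ x₁ ∈ closure D, ∀ x₂ ∈ closure D,
    ‖f t₁ x₁ - f t₂ x₂‖ ≤ N * (|t₁ - t₂| ^ (γ / 2) + ‖x₁ - x₂‖ ^ γ)

/-- The parabolic Hölder norm `|||f|||_γ` on `J × D̄` (up to equivalence). -/
def parHolderNorm {d : ℕ} {Y : Type*} [NormedAddCommGroup Y] (γ : ℝ) (J : Set ℝ)
    (D : Set (Euc d)) (f : ℝ → Euc d → Y) : ℝ :=
  sInf {N : ℝ | 0 ≤ N ∧ parHolderBound γ J D f N}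

/-- `h ∈ C^{γ/2,γ}(J × D̄)`. -/
def MemParHolder {d : ℕ} (γ : ℝ) (J : Set ℝ) (D : Set (Euc d)) (h : ℝ → Euc d → ℝ) : Prop :=
  ContinuousOn (fun p : ℝ × Euc d => h p.1 p.2) (J ×ˢ closure D) ∧
  ∃ N, parHolderBound γ J D h N

/-- `N` bounds the `X^γ(J × D̄)` norm of `u`. -/
def XgammaBound {d : ℕ} (γ : ℝ) (J : Set ℝ) (D : Set (Euc d)) (u : ℝ → Euc d → ℝ)
    (N : ℝ) : Prop :=
  (∀ t ∈ J, ∀ x ∈ closure D, |u t x| ≤ N) ∧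
  parHolderBound γ J D (fun t x => dtt u t x) N ∧
  parHolderBound γ J D (fun t x => dx1 (u t) x) N ∧
  parHolderBound γ J D (fun t x => dx2 (u t) x) N

/-- The `X^γ(J × D̄)` norm (up to equivalence). -/
def XgammaNorm {d : ℕ} (γ : ℝ) (J : Set ℝ) (D : Set (Euc d)) (u : ℝ → Euc d → ℝ) : ℝ :=
  sInf {N : ℝ | 0 ≤ N ∧ XgammaBound γ J D u N}

/-- `u ∈ X^γ(J × D̄)`. -/
def MemXgamma {d : ℕ} (γ : ℝ) (J : Set ℝ) (D : Set (Euc d)) (u : ℝ → Euc d → ℝ) : Prop :=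
  IsC12On J D u ∧ ∃ N, XgammaBound γ J D u N

/-- `N` bounds the sup and the `γ`-Hölder seminorm of `f` on `S`. -/
def holderBoundOn {X Y : Type*} [NormedAddCommGroup X] [NormedAddCommGroup Y]
    (γ : ℝ) (S : Set X) (f : X → Y) (N : ℝ) : Prop :=
  (∀ x ∈ S, ‖f x‖ ≤ N) ∧ ∀ x ∈ S, ∀ y ∈ S, ‖f x - f y‖ ≤ N * ‖x - y‖ ^ γ

/-- `N` bounds the `C^{2+γ}(D̄)` norm of `g`. -/
def C2gammaBound {d : ℕ} (γ : ℝ) (D : Set (Euc d)) (g : Euc d → ℝ) (N : ℝ) : Prop :=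
  holderBoundOn γ (closure D) g N ∧
  holderBoundOn γ (closure D) (fun x => dx1 g x) N ∧
  holderBoundOn γ (closure D) (fun x => dx2 g x) N

/-- The `C^{2+γ}(D̄)` norm (up to equivalence). -/
def C2gammaNorm {d : ℕ} (γ : ℝ) (D : Set (Euc d)) (g : Euc d → ℝ) : ℝ :=
  sInf {N : ℝ | 0 ≤ N ∧ C2gammaBound γ D g N}

/-- `g ∈ C^{2+γ}(D̄)`. -/
def MemC2gamma {d : ℕ} (γ : ℝ) (D : Set (Euc d)) (g : Euc d → ℝ) : Prop :=
  (∀ x ∈ closure D, DifferentiableAt ℝ g x ∧ DifferentiableAt ℝ (fun y => fderiv ℝ g y) x) ∧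
  ∃ N, C2gammaBound γ D g N

/-- `u` satisfies `∂ₜu + div_x A(u) - ν Δu = h` for `t ∈ Jpde`, `x ∈ D`. -/
def SolvesPDE {d : ℕ} (ν : ℝ) (A : ℝ → Fin d → ℝ) (Jpde : Set ℝ) (D : Set (Euc d))
    (h u : ℝ → Euc d → ℝ) : Prop :=
  ∀ t ∈ Jpde, ∀ x ∈ D, dtt u t x + divA A (u t) x - ν * lapl (u t) x = h t x

/-- Homogeneous Dirichlet boundary condition on `J × ∂D`. -/
def DirichletBC {d : ℕ} (J : Set ℝ) (D : Set (Euc d)) (u : ℝ → Euc d → ℝ) : Prop :=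
  ∀ t ∈ J, ∀ x ∈ frontier D, u t x = 0

/-- The compatibility conditions on `∂D`. -/
def CompatCond {d : ℕ} (ν : ℝ) (A : ℝ → Fin d → ℝ) (D : Set (Euc d))
    (h : ℝ → Euc d → ℝ) (u₀ : Euc d → ℝ) : Prop :=
  ∀ x ∈ frontier D, u₀ x = 0 ∧ divA A u₀ x - ν * lapl u₀ x - h 0 x = 0

/-- The sign condition (S): `(Σⱼ Aⱼ'(u)) sgn u ≥ c|u| - C`. -/
def SignCondition {d : ℕ} (A : ℝ → Fin d → ℝ) (c C : ℝ) : Prop :=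
  ∀ u : ℝ, c * |u| - C ≤ (∑ j : Fin d, deriv (fun v => A v j) u) * Real.sign u

/-- The `L¹(D)` norm. -/
def L1norm {d : ℕ} (D : Set (Euc d)) (f : Euc d → ℝ) : ℝ := ∫ x in D, |f x|

/-- The `L^∞(D)` norm (of a bounded continuous function). -/
def supNorm {d : ℕ} (D : Set (Euc d)) (f : Euc d → ℝ) : ℝ :=
  sSup ((fun x => |f x|) '' closure D)

/-- The piecewise constant control from Theorem 2.2: `ξ(t) = ξₖ` for
`t ∈ [k - 1/2, k - 1/2 + τₖ)` (where `k - 1 ≤ t < k`, `k ≥ 1`) and `ξ(t) = 0` otherwise. -/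
def ctrl (ξs τs : ℕ → ℝ) (t : ℝ) : ℝ :=
  Set.indicator
    (Set.Ico (((⌊t⌋₊ + 1 : ℕ) : ℝ) - 1/2) ((((⌊t⌋₊ + 1 : ℕ) : ℝ) - 1/2) + τs (⌊t⌋₊ + 1)))
    (fun _ => ξs (⌊t⌋₊ + 1)) t

/-- `ξ` is piecewise constant on `[0, T]`. -/
def PiecewiseConstOn (ξ : ℝ → ℝ) (T : ℝ) : Prop :=
  ∃ n : ℕ, ∃ τ : ℕ → ℝ, τ 0 = 0 ∧ τ n = T ∧ (∀ k < n, τ k < τ (k + 1)) ∧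
    ∀ k < n, ∀ t ∈ Ico (τ k) (τ (k + 1)), ξ t = ξ (τ k)

/-- `u` is the solution of the controlled problem with control `ξ(t) φ(x)`: a continuous curve
in `C^{2+γ}(D̄)` satisfying the initial and boundary conditions and solving the PDE on every
interval of constancy of `ξ` (i.e. at every time at which `ξ` is locally constant). -/
def IsCtrlSolOn {d : ℕ} (γ ν : ℝ) (A : ℝ → Fin d → ℝ) (D : Set (Euc d))
    (h : ℝ → Euc d → ℝ) (φ : Euc d → ℝ) (ξ : ℝ → ℝ) (u₀ : Euc d → ℝ)
    (J Jo : Set ℝ) (u : ℝ → Euc d → ℝ) : Prop :=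
  ContinuousOn (fun p : ℝ × Euc d => u p.1 p.2) (J ×ˢ closure D) ∧
  (∀ t ∈ J, MemC2gamma γ D (u t)) ∧
  DirichletBC J D u ∧
  (∀ x ∈ closure D, u 0 x = u₀ x) ∧
  ∀ t ∈ Jo, (∀ᶠ s in nhds t, ξ s = ξ t) →
    (∀ x ∈ closure D, DifferentiableAt ℝ (fun s => u s x) t) ∧
    ∀ x ∈ D, dtt u t x + divA A (u t) x - ν * lapl (u t) x = h t x + ξ t * φ x

/-- `z` has, at `(t, x)`, a time derivative and pure second spatial differences governed by a
bilinear form, and its heat operator `∂ₜ z - ν Δ z` there equals `g`. -/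
def HeatAt {d : ℕ} (ν : ℝ) (z : ℝ → Euc d → ℝ) (t : ℝ) (x : Euc d) (g : ℝ) : Prop :=
  ∃ (a : ℝ) (B : Euc d →L[ℝ] Euc d →L[ℝ] ℝ), HasDerivAt (fun s => z s x) a t ∧
    (∀ v, Tendsto (fun s : ℝ => (z t (x + s • v) + z t (x - s • v) - 2 * z t x) / s ^ 2) (𝓝[≠] 0)
      (𝓝 (B v v))) ∧
    a - ν * ∑ j, B (ebasis d j) (ebasis d j) = g

/-- The inner product as a bilinear form. -/
def innerBilin (d : ℕ) : Euc d →L[ℝ] Euc d →L[ℝ] ℝ := innerSL ℝ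

lemma innerBilin_apply {d : ℕ} (v w : Euc d) : innerBilin d v w = inner ℝ v w := rfl

namespace HeatAt

variable {d : ℕ} {ν : ℝ} {z w : ℝ → Euc d → ℝ} {t : ℝ} {x : Euc d} {g g' : ℝ}

lemma add (hz : HeatAt ν z t x g) (hw : HeatAt ν w t x g') :
    HeatAt ν (fun t x => z t x + w t x) t x (g + g') := by
  obtain ⟨a, B, h1, h2, h3⟩ := hz
  obtain ⟨a', B', h1', h2', h3'⟩ := hw
  refine ⟨a + a', B + B', h1.add h1', fun v => ?_, ?_⟩
  · refine ((h2 v).add (h2' v)).congr fun s => ?_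
    ring
  · rw [← h3, ← h3']
    simp only [add_apply, Finset.sum_add_distrib]
    ring

lemma const_mul (c : ℝ) (hz : HeatAt ν z t x g) :
    HeatAt ν (fun t x => c * z t x) t x (c * g) := by
  obtain ⟨a, B, h1, h2, h3⟩ := hz
  refine ⟨c * a, c • B, h1.const_mul c, fun v => ?_, ?_⟩
  · refine ((h2 v).const_mul c).congr fun s => ?_
    ring
  · rw [← h3]
    simp only [smul_apply, smul_eq_mul, ← Finset.mul_sum]
    ring

lemma sub (hz : HeatAt ν z t x g) (hw : HeatAt ν w t x g') :
    HeatAt ν (fun t x => z t x - w t x) t x (g - g') := by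
  have := hz.add (hw.const_mul (-1))
  simpa [sub_eq_add_neg] using this

lemma translate {s : ℝ} {h : Euc d} (hz : HeatAt ν z (t + s) (x + h) g) :
    HeatAt ν (fun t x => z (t + s) (x + h)) t x g := by
  obtain ⟨a, B, h1, h2, h3⟩ := hz
  refine ⟨a, B, ?_, fun v => ?_, h3⟩
  · exact HasDerivAt.comp_add_const t s h1
  · refine (h2 v).congr fun s => ?_
    congr 4
    · abel
    · abel_nf

lemma trace_isometry (R : Euc d ≃ₗᵢ[ℝ] Euc d) (B : Euc d →L[ℝ] Euc d →L[ℝ] ℝ) :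
    ∑ j, B (R (ebasis d j)) (R (ebasis d j)) = ∑ j, B (ebasis d j) (ebasis d j) := by
  let T : Euc d →ₗ[ℝ] Euc d :=
    ((InnerProductSpace.toDual ℝ (Euc d)).symm.toLinearEquiv.toLinearMap : _ →ₗ[ℝ] _) ∘ₗ
      B.toLinearMap
  have hT : ∀ v w, inner ℝ v (T w) = B w v := fun v w => by
    rw [real_inner_comm]
    exact InnerProductSpace.toDual_symm_apply
  have e := EuclideanSpace.basisFun (Fin d) ℝ
  have h1 := LinearMap.trace_eq_sum_inner T (EuclideanSpace.basisFun (Fin d) ℝ)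
  have h2 := LinearMap.trace_eq_sum_inner T ((EuclideanSpace.basisFun (Fin d) ℝ).map R)
  rw [h1] at h2
  simp only [hT, OrthonormalBasis.map_apply, EuclideanSpace.basisFun_apply] at h2
  exact h2.symm

lemma comp_isometry (R : Euc d ≃ₗᵢ[ℝ] Euc d) {h : Euc d} (hz : HeatAt ν z t (R x + h) g) :
    HeatAt ν (fun t x => z t (R x + h)) t x g := by
  obtain ⟨a, B, h1, h2, h3⟩ := hz
  refine ⟨a, B.bilinearComp (R : Euc d →L[ℝ] Euc d) (R : Euc d →L[ℝ] Euc d), h1,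
    fun v => ?_, ?_⟩
  · refine (h2 (R v)).congr fun s => ?_
    simp only [map_add, map_sub, map_smul]
    congr 4
    · abel
    · abel_nf
  · rw [← h3]
    congr 2
    exact trace_isometry R B

lemma congr_value (hz : HeatAt ν z t x g) (h : g = g') : HeatAt ν z t x g' := h ▸ hz

/-- The weak parabolic maximum principle at one point. -/
lemma nonneg_of_max (hν : 0 ≤ ν) (hz : HeatAt ν z t x g) {t₀ : ℝ} (ht : t₀ < t)
    (htime : ∀ s ∈ Icc t₀ t, z s x ≤ z t x) (hspace : ∀ᶠ y in 𝓝 x, z t y ≤ z t x) : 0 ≤ g := by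
  obtain ⟨a, B, h1, h2, h3⟩ := hz
  have ha : 0 ≤ a := by
    have h4 := h1.hasDerivWithinAt (s := Iio t)
    rw [hasDerivWithinAt_iff_tendsto_slope' (by simp)] at h4
    refine ge_of_tendsto h4 ?_
    filter_upwards [Ioo_mem_nhdsLT ht] with s hs
    rw [slope_def_field]
    exact div_nonneg_of_nonpos (by linarith [htime s ⟨hs.1.le, hs.2.le⟩]) (by linarith [hs.2])
  have hB : ∀ v, B v v ≤ 0 := by
    intro v
    refine le_of_tendsto (h2 v) ?_
    have c1 : Tendsto (fun s : ℝ => x + s • v) (𝓝[≠] 0) (𝓝 x) := by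
      have : Continuous (fun s : ℝ => x + s • v) := by fun_prop
      have := (this.tendsto 0).mono_left (nhdsWithin_le_nhds (s := {0}ᶜ))
      simpa using this
    have c2 : Tendsto (fun s : ℝ => x - s • v) (𝓝[≠] 0) (𝓝 x) := by
      have : Continuous (fun s : ℝ => x - s • v) := by fun_prop
      have := (this.tendsto 0).mono_left (nhdsWithin_le_nhds (s := {0}ᶜ))
      simpa using this
    filter_upwards [c1.eventually hspace, c2.eventually hspace] with s hs1 hs2
    exact div_nonpos_of_nonpos_of_nonneg (by linarith) (by positivity)
  have := Finset.sum_nonpos fun j (_ : j ∈ Finset.univ) => hB (ebasis d j)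
  rw [← h3]
  nlinarith

/-- The heat operator of a quadratic polynomial. -/
lemma quadratic (ν : ℝ) (t : ℝ) (x : Euc d) (c₀ c₁ α β γ : ℝ) (n xc : Euc d) :
    HeatAt ν (fun t x => c₀ + c₁ * t + α * inner ℝ n (x - xc) + β * ‖x - xc‖ ^ 2
      - γ * (inner ℝ n (x - xc)) ^ 2) t x (c₁ - ν * (2 * β * d - 2 * γ * ‖n‖ ^ 2)) := by
  refine ⟨c₁, (2 * β) • innerBilin d - (2 * γ) • (innerSL ℝ n).smulRight (innerSL ℝ n), ?_, ?_, ?_⟩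
  · have : HasDerivAt (fun s : ℝ => c₁ * s) c₁ t := by
      simpa using (hasDerivAt_id t).const_mul c₁
    have := ((((this.const_add c₀).add_const (α * inner ℝ n (x - xc))).add_const
      (β * ‖x - xc‖ ^ 2)).sub_const (γ * (inner ℝ n (x - xc)) ^ 2))
    exact this
  · intro v
    refine tendsto_const_nhds.congr' ?_
    filter_upwards [self_mem_nhdsWithin] with s hs
    have hs : s ≠ 0 := hs
    rw [eq_div_iff (by positivity)]
    have e1 : x + s • v - xc = (x - xc) + s • v := by abel
    have e2 : x - s • v - xc = (x - xc) - s • v := by abel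
    rw [e1, e2, norm_add_sq_real (x - xc), norm_sub_sq_real (x - xc), inner_add_right n (x - xc),
      inner_sub_right n (x - xc) (s • v)]
    simp only [inner_smul_right, norm_smul, sub_apply,
      smul_apply, ContinuousLinearMap.smulRight_apply, smul_eq_mul,
      innerSL_apply_apply, innerBilin_apply, real_inner_self_eq_norm_sq, mul_pow, Real.norm_eq_abs, sq_abs]
    ring
  · simp only [sub_apply, smul_apply,
      ContinuousLinearMap.smulRight_apply, smul_eq_mul, innerSL_apply_apply, innerBilin_apply, Finset.sum_sub_distrib,
      ← Finset.mul_sum, real_inner_self_eq_norm_sq]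
    have h1 : ∑ j, ‖ebasis d j‖ ^ 2 = d := by simp [ebasis]
    have h2 : ∑ j, inner ℝ n (ebasis d j) * inner ℝ n (ebasis d j) = ‖n‖ ^ 2 := by
      rw [← (EuclideanSpace.basisFun (Fin d) ℝ).sum_sq_norm_inner_left n]
      simp [ebasis, sq]
    rw [h1, h2]

end HeatAt

/-- A parabolic maximum principle: if wherever `w` is positive it is a strict subsolution in the
parabolic interior, then `w ≤ 0`. -/
lemma nonpos_of_strict_subsolution {d : ℕ} {ν t₀ t₁ : ℝ} (hν : 0 ≤ ν)
    {H : Set (Euc d)} (hH : IsCompact H) {w : ℝ → Euc d → ℝ}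
    (hcont : ContinuousOn (fun p : ℝ × Euc d => w p.1 p.2) (Icc t₀ t₁ ×ˢ H))
    (hpos : ∀ t ∈ Icc t₀ t₁, ∀ x ∈ H, 0 < w t x →
      (∀ s ∈ Icc t₀ t₁, ∀ y ∈ H, w s y ≤ w t x) →
      t₀ < t ∧ (∀ᶠ y in 𝓝 x, y ∈ H) ∧ ∃ g < 0, HeatAt ν w t x g) :
    ∀ t ∈ Icc t₀ t₁, ∀ x ∈ H, w t x ≤ 0 := by
  intro t' ht' x' hx'
  obtain ⟨p, hp, hmax⟩ := (isCompact_Icc.prod hH).exists_isMaxOn ⟨(t', x'), ⟨ht', hx'⟩⟩ hcont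
  have hm : ∀ s ∈ Icc t₀ t₁, ∀ y ∈ H, w s y ≤ w p.1 p.2 := fun s hs y hy =>
    hmax (show (s, y) ∈ Icc t₀ t₁ ×ˢ H from ⟨hs, hy⟩)
  refine (hm t' ht' x' hx').trans ?_
  by_contra! h
  obtain ⟨h1, h2, g, hg, hw⟩ := hpos p.1 hp.1 p.2 hp.2 h hm
  have := hw.nonneg_of_max hν h1 (fun s hs => hm s ⟨hs.1, hs.2.trans hp.1.2⟩ p.2 hp.2)
    (h2.mono fun y hy => hm p.1 hp.1 y hy)
  linarith

set_option maxHeartbeats 400000 in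
/-- Barrier estimate on a flat half ball: a subsolution of the heat equation which is at most `κ`
on the flat part is small close to the flat part. -/
lemma halfBall_estimate {d : ℕ} {ν ℓ t₀ t₁ κ B₀ Z G : ℝ} (hν : 0 < ν) (hℓ : 0 < ℓ) (ht : t₀ ≤ t₁)
    (hκ : 0 ≤ κ) (hB₀ : 0 ≤ B₀) (hZ : 0 < Z) (hG : 0 ≤ G) {n xc : Euc d} (hn : ‖n‖ = 1)
    {z : ℝ → Euc d → ℝ}
    (hcont : ContinuousOn (fun p : ℝ × Euc d => z p.1 p.2)
      (Icc t₀ t₁ ×ˢ {x : Euc d | ‖x - xc‖ ≤ ℓ ∧ 0 ≤ inner ℝ n (x - xc)}))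
    (hheat : ∀ t ∈ Ioc t₀ t₁, ∀ x, ‖x - xc‖ < ℓ → 0 < inner ℝ n (x - xc) →
      ∃ g ≤ G, HeatAt ν z t x g)
    (hbound : ∀ t ∈ Icc t₀ t₁, ∀ x, ‖x - xc‖ ≤ ℓ → 0 ≤ inner ℝ n (x - xc) → z t x ≤ Z)
    (hflat : ∀ t ∈ Icc t₀ t₁, ∀ x, ‖x - xc‖ ≤ ℓ → inner ℝ n (x - xc) = 0 → z t x ≤ κ)
    (hbot : ∀ x, ‖x - xc‖ ≤ ℓ → 0 ≤ inner ℝ n (x - xc) →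
      z t₀ x ≤ B₀ + Z * (ν * (t₁ - t₀) / ℓ ^ 2))
    {a : ℝ} (ha : 0 ≤ a) (haℓ : a ≤ ℓ) :
    z t₁ (xc + a • n) ≤ κ + B₀ + (d + 1) * (Z + G * ℓ ^ 2 / ν) * (a / ℓ) := by
  set Z' := Z + G * ℓ ^ 2 / ν with hZ'
  have hZZ' : Z ≤ Z' := by rw [hZ']; have : 0 ≤ G * ℓ ^ 2 / ν := by positivity
                           linarith
  have hZ'0 : 0 < Z' := by linarith
  set b : Euc d → ℝ := fun x => (d + 1) * (inner ℝ n (x - xc) / ℓ) +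
    (‖x - xc‖ ^ 2 - (d + 1) * (inner ℝ n (x - xc)) ^ 2) / ℓ ^ 2 with hb
  have habs : ∀ x : Euc d, inner ℝ n (x - xc) ≤ ‖x - xc‖ := fun x => by
    have := real_inner_le_norm n (x - xc)
    rwa [hn, one_mul] at this
  have hbnonneg : ∀ x, ‖x - xc‖ ≤ ℓ → 0 ≤ inner ℝ n (x - xc) →
      ‖x - xc‖ ^ 2 / ℓ ^ 2 ≤ b x := by
    intro x h1 h2
    have h3 : inner ℝ n (x - xc) ≤ ℓ := (habs x).trans h1
    have : b x = ‖x - xc‖ ^ 2 / ℓ ^ 2 +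
        (d + 1) * ((inner ℝ n (x - xc) / ℓ) * (1 - inner ℝ n (x - xc) / ℓ)) := by
      simp only [hb]; field_simp; ring
    rw [this]
    have h4 : 0 ≤ 1 - inner ℝ n (x - xc) / ℓ := by
      rw [sub_nonneg, div_le_one hℓ]; exact h3
    have : 0 ≤ (d + 1 : ℝ) * ((inner ℝ n (x - xc) / ℓ) * (1 - inner ℝ n (x - xc) / ℓ)) := by
      positivity
    linarith
  set w : ℝ → Euc d → ℝ := fun t x => z t x - (κ + B₀ + Z' * b x + Z' * (ν * (t₁ - t) / ℓ ^ 2))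
    with hw
  set H : Set (Euc d) := {x : Euc d | ‖x - xc‖ ≤ ℓ ∧ 0 ≤ inner ℝ n (x - xc)} with hH
  have hHc : IsCompact H := by
    refine Metric.isCompact_of_isClosed_isBounded ?_ ?_
    · exact (isClosed_le (f := fun x : Euc d => ‖x - xc‖) (by fun_prop) continuous_const).inter
        (isClosed_le (g := fun x : Euc d => inner ℝ n (x - xc)) continuous_const (by fun_prop))
    · refine (Metric.isBounded_closedBall (x := xc) (r := ℓ)).subset fun x hx => ?_
      simpa [dist_eq_norm] using hx.1
  have hpt : xc + a • n ∈ H := by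
    refine ⟨?_, ?_⟩
    · simp [norm_smul, hn, abs_of_nonneg ha, haℓ]
    · simp [inner_smul_right, hn, ha]
  have hwcont : ContinuousOn (fun p : ℝ × Euc d => w p.1 p.2) (Icc t₀ t₁ ×ˢ H) := by
    refine hcont.sub (Continuous.continuousOn ?_)
    fun_prop
  have hle : ∀ t ∈ Icc t₀ t₁, ∀ x ∈ H, w t x ≤ 0 := by
    refine nonpos_of_strict_subsolution hν.le hHc hwcont fun t htI x hxH hpos _ => ?_
    have hbx := hbnonneg x hxH.1 hxH.2
    have hbx0 : 0 ≤ b x := le_trans (by positivity) hbx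
    have htt : 0 ≤ t₁ - t := by linarith [htI.2]
    have hZb : 0 ≤ Z' * b x := by positivity
    have hZt : 0 ≤ Z' * (ν * (t₁ - t) / ℓ ^ 2) := by positivity
    have hpos' : κ + B₀ + Z' * b x + Z' * (ν * (t₁ - t) / ℓ ^ 2) < z t x := by
      simp only [hw] at hpos; linarith
    have ht0 : t₀ < t := by
      rcases htI.1.lt_or_eq with h | h
      · exact h
      · have h5 := hbot x hxH.1 hxH.2
        rw [h] at h5
        have : Z * (ν * (t₁ - t) / ℓ ^ 2) ≤ Z' * (ν * (t₁ - t) / ℓ ^ 2) := by gcongr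
        linarith
    have hxn : 0 < inner ℝ n (x - xc) := by
      rcases hxH.2.lt_or_eq with h | h
      · exact h
      · have := hflat t htI x hxH.1 h.symm
        linarith
    have hxl : ‖x - xc‖ < ℓ := by
      rcases hxH.1.lt_or_eq with h | h
      · exact h
      · have h5 := hbound t htI x hxH.1 hxH.2
        rw [h, div_self (by positivity)] at hbx
        nlinarith
    obtain ⟨g, hgG, hg⟩ := hheat t ⟨ht0, htI.2⟩ x hxl hxn
    have hq := HeatAt.quadratic ν t x (κ + B₀ + Z' * (ν * t₁ / ℓ ^ 2)) (-(Z' * ν / ℓ ^ 2))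
      (Z' * ((d + 1) / ℓ)) (Z' / ℓ ^ 2) (Z' * (d + 1) / ℓ ^ 2) n xc
    have hwh := hg.sub hq
    have hweq : (fun t x => z t x - (κ + B₀ + Z' * (ν * t₁ / ℓ ^ 2) + -(Z' * ν / ℓ ^ 2) * t +
        Z' * ((d + 1) / ℓ) * inner ℝ n (x - xc) + Z' / ℓ ^ 2 * ‖x - xc‖ ^ 2
        - Z' * (d + 1) / ℓ ^ 2 * inner ℝ n (x - xc) ^ 2)) = w := by
      funext t x
      simp only [hw, hb]
      ring
    rw [hweq] at hwh
    refine ⟨ht0, ?_, _, ?_, hwh⟩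
    · have o1 : ∀ᶠ y in 𝓝 x, ‖y - xc‖ < ℓ :=
        (Continuous.tendsto (by fun_prop : Continuous fun y : Euc d => ‖y - xc‖) x).eventually
          (gt_mem_nhds hxl)
      have o2 : ∀ᶠ y in 𝓝 x, 0 < inner ℝ n (y - xc) :=
        (Continuous.tendsto (by fun_prop : Continuous fun y : Euc d => inner ℝ n (y - xc))
          x).eventually (lt_mem_nhds hxn)
      filter_upwards [o1, o2] with y h1 h2
      exact ⟨h1.le, h2.le⟩
    · rw [hn]
      have e : -(Z' * ν / ℓ ^ 2) - ν * (2 * (Z' / ℓ ^ 2) * d - 2 * (Z' * (d + 1) / ℓ ^ 2) * 1 ^ 2)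
          = Z * ν / ℓ ^ 2 + G := by
        rw [hZ']; field_simp; ring
      rw [e]
      have : 0 < Z * ν / ℓ ^ 2 := by positivity
      linarith
  have h6 := hle t₁ (right_mem_Icc.2 ht) _ hpt
  simp only [hw] at h6
  have hba : b (xc + a • n) ≤ (d + 1) * (a / ℓ) := by
    have e1 : inner ℝ n (xc + a • n - xc) = a := by
      rw [add_sub_cancel_left, inner_smul_right, real_inner_self_eq_norm_sq, hn]; ring
    have e2 : ‖xc + a • n - xc‖ = a := by
      rw [add_sub_cancel_left, norm_smul, hn, Real.norm_eq_abs, abs_of_nonneg ha, mul_one]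
    have e3 : b (xc + a • n) = (d + 1) * (a / ℓ) - d * (a ^ 2 / ℓ ^ 2) := by
      simp only [hb]
      rw [e1, e2]
      ring
    have : 0 ≤ (d : ℝ) * (a ^ 2 / ℓ ^ 2) := by positivity
    linarith
  have h7 : Z' * b (xc + a • n) ≤ Z' * ((d + 1) * (a / ℓ)) := by gcongr
  have h8 : Z' * (ν * (t₁ - t₁) / ℓ ^ 2) = 0 := by simp
  have h9 : (d + 1) * Z' * (a / ℓ) = Z' * ((d + 1) * (a / ℓ)) := by ring
  linarith

/-- The mixed second difference of `g` with steps `h`, `k`. -/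
def secondDiff {E : Type*} [AddCommGroup E] (g : E → ℝ) (h k x : E) : ℝ :=
  g (x + h + k) - g (x + h) - g (x + k) + g x

section
variable {E : Type*} [NormedAddCommGroup E] [NormedSpace ℝ E]

/-- Mean value theorem along a segment. -/
lemma exists_diff_eq_fderiv {g : E → ℝ} {g1 : E → E →L[ℝ] ℝ} {x h : E}
    (h1 : ∀ s ∈ Icc (0:ℝ) 1, HasFDerivAt g (g1 (x + s • h)) (x + s • h)) :
    ∃ s ∈ Icc (0:ℝ) 1, g (x + h) - g x = g1 (x + s • h) h := by
  have hd : ∀ s ∈ Icc (0:ℝ) 1, HasDerivAt (fun s : ℝ => g (x + s • h)) (g1 (x + s • h) h) s := by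
    intro s hs
    have h2 : HasDerivAt (fun s : ℝ => x + s • h) h s := by
      simpa using ((hasDerivAt_id s).smul_const h).const_add x
    exact (h1 s hs).comp_hasDerivAt s h2
  obtain ⟨s, hs, he⟩ := exists_hasDerivAt_eq_slope (fun s : ℝ => g (x + s • h))
    (fun s => g1 (x + s • h) h) zero_lt_one
    (fun s hs => (hd s hs).continuousAt.continuousWithinAt)
    (fun s hs => hd s ⟨hs.1.le, hs.2.le⟩)
  refine ⟨s, ⟨hs.1.le, hs.2.le⟩, ?_⟩
  rw [he]
  simp

/-- Mean value theorem for mixed second differences. -/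
lemma exists_secondDiff_eq {g : E → ℝ} {g1 : E → E →L[ℝ] ℝ} {g2 : E → E →L[ℝ] E →L[ℝ] ℝ}
    {x h k : E}
    (h1 : ∀ s ∈ Icc (0:ℝ) 1, ∀ r ∈ Icc (0:ℝ) 1,
      HasFDerivAt g (g1 (x + s • h + r • k)) (x + s • h + r • k))
    (h2 : ∀ s ∈ Icc (0:ℝ) 1, ∀ r ∈ Icc (0:ℝ) 1,
      HasFDerivAt g1 (g2 (x + s • h + r • k)) (x + s • h + r • k)) :
    ∃ s ∈ Icc (0:ℝ) 1, ∃ r ∈ Icc (0:ℝ) 1, secondDiff g h k x = g2 (x + s • h + r • k) k h := by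
  obtain ⟨s, hs, he⟩ := exists_diff_eq_fderiv (g := fun y => g (y + k) - g y)
    (g1 := fun y => g1 (y + k) - g1 y) (x := x) (h := h) (fun s hs => by
      refine HasFDerivAt.sub ?_ ?_
      · have := h1 s hs 1 (by simp)
        rw [one_smul] at this
        exact (hasFDerivAt_comp_add_right k).2 this
      · simpa using h1 s hs 0 (by simp))
  obtain ⟨r, hr, he'⟩ := exists_diff_eq_fderiv (g := fun y => g1 y h)
    (g1 := fun y => (g2 y).flip h) (x := x + s • h) (h := k) (fun r hr => by
      have := (h2 s hs r hr).clm_apply (hasFDerivAt_const h _)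
      simpa using this)
  refine ⟨s, hs, r, hr, ?_⟩
  have : secondDiff g h k x = g (x + h + k) - g (x + h) - (g (x + k) - g x) := by
    unfold secondDiff; ring
  rw [this, he, ← ContinuousLinearMap.flip_apply, ← he']
  rfl

lemma abs_secondDiff_sub_le {g : E → ℝ} {g1 : E → E →L[ℝ] ℝ} {g2 : E → E →L[ℝ] E →L[ℝ] ℝ}
    {x h k : E} {P : Set E} {c K : ℝ}
    (hP : ∀ s ∈ Icc (0:ℝ) 1, ∀ r ∈ Icc (0:ℝ) 1, x + s • h + r • k ∈ P)
    (h1 : ∀ y ∈ P, HasFDerivAt g (g1 y) y) (h2 : ∀ y ∈ P, HasFDerivAt g1 (g2 y) y)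
    (hK : ∀ s ∈ Icc (0:ℝ) 1, ∀ r ∈ Icc (0:ℝ) 1, |g2 (x + s • h + r • k) k h - c| ≤ K) :
    |secondDiff g h k x - c| ≤ K := by
  obtain ⟨s, hs, r, hr, he⟩ := exists_secondDiff_eq (g := g) (x := x) (h := h) (k := k)
    (fun s hs r hr => h1 _ (hP s hs r hr)) (fun s hs r hr => h2 _ (hP s hs r hr))
  rw [he]
  exact hK s hs r hr

end

namespace HeatAt

variable {d : ℕ} {ν : ℝ} {z : ℝ → Euc d → ℝ} {t : ℝ} {x : Euc d}

lemma of_hasFDerivAt {a : ℝ} {g1 : Euc d → Euc d →L[ℝ] ℝ}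
    {g2 : Euc d → Euc d →L[ℝ] Euc d →L[ℝ] ℝ} (ht : HasDerivAt (fun s => z s x) a t)
    (h1 : ∀ᶠ y in 𝓝 x, HasFDerivAt (z t) (g1 y) y) (h2 : ∀ᶠ y in 𝓝 x, HasFDerivAt g1 (g2 y) y)
    (hc : ContinuousAt g2 x) : HeatAt ν z t x (a - ν * ∑ j, g2 x (ebasis d j) (ebasis d j)) := by
  refine ⟨a, g2 x, ht, fun v => ?_, rfl⟩
  rw [Metric.tendsto_nhds]
  intro ε hε
  have hcv : Tendsto (fun y => g2 y v v) (𝓝 x) (𝓝 (g2 x v v)) :=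
    (ContinuousAt.clm_apply (ContinuousAt.clm_apply hc continuousAt_const) continuousAt_const)
  obtain ⟨η, hη, hb⟩ := Metric.eventually_nhds_iff_ball.1
    ((h1.and h2).and (Metric.tendsto_nhds.1 hcv (ε / 2) (half_pos hε)))
  have hs0 : ∀ᶠ s : ℝ in 𝓝[≠] 0, |s| * ‖v‖ < η := by
    have : Tendsto (fun s : ℝ => |s| * ‖v‖) (𝓝[≠] 0) (𝓝 0) := by
      have hcn : Continuous (fun s : ℝ => |s| * ‖v‖) := by fun_prop
      simpa using (hcn.tendsto 0).mono_left nhdsWithin_le_nhds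
    exact this.eventually (gt_mem_nhds hη)
  filter_upwards [hs0, self_mem_nhdsWithin] with s hs hs'
  have hs' : s ≠ 0 := hs'
  have hmem : ∀ p ∈ Icc (0:ℝ) 1, ∀ r ∈ Icc (0:ℝ) 1,
      x - s • v + p • (s • v) + r • (s • v) ∈ Metric.ball x η := by
    intro p hp r hr
    have : x - s • v + p • (s • v) + r • (s • v) = x + ((p + r - 1) * s) • v := by module
    rw [this, Metric.mem_ball, dist_eq_norm, add_sub_cancel_left, norm_smul, Real.norm_eq_abs,
      abs_mul]
    have : |p + r - 1| ≤ 1 := abs_le.2 ⟨by linarith [hp.1, hr.1], by linarith [hp.2, hr.2]⟩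
    have : |p + r - 1| * |s| ≤ |s| := mul_le_of_le_one_left (abs_nonneg s) this
    nlinarith [norm_nonneg v]
  have key := abs_secondDiff_sub_le (g := z t) (x := x - s • v) (h := s • v) (k := s • v)
    (P := Metric.ball x η) (c := g2 x (s • v) (s • v)) (K := s ^ 2 * (ε / 2)) hmem
    (fun y hy => (hb y hy).1.1) (fun y hy => (hb y hy).1.2) (fun p hp r hr => by
      have h3 := (hb _ (hmem p hp r hr)).2
      simp only [map_smul, smul_apply, smul_eq_mul]
      rw [Real.dist_eq] at h3
      rw [show ∀ a b : ℝ, s * (s * a) - s * (s * b) = s ^ 2 * (a - b) by intros; ring, abs_mul,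
        abs_of_nonneg (sq_nonneg s)]
      exact mul_le_mul_of_nonneg_left h3.le (sq_nonneg s))
  have e : secondDiff (z t) (s • v) (s • v) (x - s • v) =
      z t (x + s • v) + z t (x - s • v) - 2 * z t x := by
    unfold secondDiff
    rw [sub_add_cancel]
    ring
  rw [e] at key
  simp only [map_smul, smul_apply, smul_eq_mul] at key
  rw [Real.dist_eq]
  have hs2 : 0 < s ^ 2 := by positivity
  have : (z t (x + s • v) + z t (x - s • v) - 2 * z t x) / s ^ 2 - g2 x v v =
      (z t (x + s • v) + z t (x - s • v) - 2 * z t x - s * (s * g2 x v v)) / s ^ 2 := by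
    field_simp
  rw [this, abs_div, abs_of_pos hs2, div_lt_iff₀ hs2]
  nlinarith

lemma translate_space {g : ℝ} {h : Euc d} (hz : HeatAt ν z t (x + h) g) :
    HeatAt ν (fun t x => z t (x + h)) t x g := by
  have := HeatAt.translate (t := t) (s := 0) (h := h) (x := x) (z := z) (ν := ν) (g := g)
    (by simpa using hz)
  simpa using this

lemma secondDiff {f : Euc d → ℝ} {h k : Euc d} (h1 : HeatAt ν z t (x + h + k) (f (x + h + k)))
    (h2 : HeatAt ν z t (x + h) (f (x + h))) (h3 : HeatAt ν z t (x + k) (f (x + k)))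
    (h4 : HeatAt ν z t x (f x)) :
    HeatAt ν (fun t x => secondDiff (z t) h k x) t x (_root_.secondDiff f h k x) := by
  have h1' : HeatAt ν (fun t x => z t (x + h + k)) t x (f (x + h + k)) := by
    have := HeatAt.translate_space (z := z) (t := t) (x := x) (h := h + k) (ν := ν)
      (g := f (x + h + k)) (by rwa [← add_assoc])
    simpa only [← add_assoc] using this
  exact ((h1'.sub h2.translate_space).sub h3.translate_space).add h4

end HeatAt

lemma abs_bilin_sub_le {d : ℕ} (B B' : Euc d →L[ℝ] Euc d →L[ℝ] ℝ) (v w : Euc d) :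
    |B v w - B' v w| ≤ dist B B' * ‖v‖ * ‖w‖ := by
  have h : dist B B' = ‖B - B'‖ := dist_eq_norm B B'
  rw [h]
  exact ContinuousLinearMap.le_opNorm₂ (B - B') v w

/-- A normalized boundary chart: near `x₀` the domain is a sublevel set of `ψ`, with inner unit
normal `e` at `x₀`, and `M` controls the second derivative of `ψ` and its Lipschitz constant. -/
structure BdryChart {d : ℕ} (D : Set (Euc d)) (r M : ℝ) (x₀ : Euc d) (ψ : Euc d → ℝ)
    (e : Euc d) : Prop where
  norm_e : ‖e‖ = 1
  fderiv₁ : ∀ y, HasFDerivAt ψ (dx1 ψ y) y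
  fderiv₂ : ∀ y, HasFDerivAt (dx1 ψ) (dx2 ψ y) y
  mem_iff : ∀ y ∈ Metric.ball x₀ r, y ∈ D ↔ ψ y < 0
  zero : ψ x₀ = 0
  grad : ∀ v, dx1 ψ x₀ v = -inner ℝ e v
  bound₂ : ∀ y ∈ Metric.ball x₀ r, ∀ v w, |dx2 ψ y v w| ≤ M * ‖v‖ * ‖w‖
  lip₂ : ∀ y ∈ Metric.ball x₀ r, ∀ z ∈ Metric.ball x₀ r, ∀ v w,
    |dx2 ψ y v w - dx2 ψ z v w| ≤ M * ‖y - z‖ * ‖v‖ * ‖w‖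

/-- Every boundary point has a chart with parameters `r`, `M`. -/
def HasCharts {d : ℕ} (D : Set (Euc d)) (r M : ℝ) : Prop :=
  ∀ x₀ ∈ frontier D, ∃ ψ e, BdryChart D r M x₀ ψ e

lemma BdryChart.mono {d : ℕ} {D : Set (Euc d)} {r M r' M' : ℝ} {x₀ : Euc d} {ψ : Euc d → ℝ}
    {e : Euc d} (h : BdryChart D r M x₀ ψ e) (hr : r' ≤ r) (hM : M ≤ M') :
    BdryChart D r' M' x₀ ψ e where
  norm_e := h.norm_e
  fderiv₁ := h.fderiv₁
  fderiv₂ := h.fderiv₂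
  mem_iff := fun y hy => h.mem_iff y (Metric.ball_subset_ball hr hy)
  zero := h.zero
  grad := h.grad
  bound₂ := fun y hy v w => (h.bound₂ y (Metric.ball_subset_ball hr hy) v w).trans (by gcongr)
  lip₂ := fun y hy z hz v w => (h.lip₂ y (Metric.ball_subset_ball hr hy) z
    (Metric.ball_subset_ball hr hz) v w).trans (by gcongr)

lemma eq_zero_of_mem_frontier {X : Type*} [TopologicalSpace X] {D U : Set X} {ψ : X → ℝ}
    (hD : IsOpen D) (hU : IsOpen U) (hψ : Continuous ψ) (h : ∀ y ∈ U, y ∈ D ↔ ψ y < 0)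
    {x : X} (hx : x ∈ frontier D) (hxU : x ∈ U) : ψ x = 0 := by
  have h1 : x ∉ D := by
    rw [hD.frontier_eq] at hx; exact hx.2
  have h2 : 0 ≤ ψ x := by
    by_contra! h3
    exact h1 ((h x hxU).2 h3)
  refine le_antisymm ?_ h2
  have h3 : x ∈ closure D := frontier_subset_closure hx
  by_contra! h4
  have : {y | 0 < ψ y} ∩ U ∈ 𝓝 x :=
    Filter.inter_mem ((isOpen_lt continuous_const hψ).mem_nhds h4) (hU.mem_nhds hxU)
  obtain ⟨y, ⟨hy1, hy2⟩, hyD⟩ := mem_closure_iff_nhds.1 h3 _ this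
  have := (h y hy2).1 hyD
  have hy1 : 0 < ψ y := hy1
  linarith

lemma exists_local_charts {d : ℕ} {D : Set (Euc d)} (hD : IsOpen D) (hC : HasC3Boundary D)
    {p : Euc d} (hp : p ∈ frontier D) :
    ∃ r > 0, ∃ M, ∀ x₀ ∈ frontier D ∩ Metric.ball p r, ∃ ψ e, BdryChart D r M x₀ ψ e := by
  obtain ⟨U, ψ, hU, hpU, hψ, hne, hDU⟩ := hC p hp
  have hd1 : ContDiff ℝ 2 (dx1 ψ) := hψ.fderiv_right (by norm_num)
  have hd2 : ContDiff ℝ 1 (dx2 ψ) := ContDiff.fderiv_right (m := 1) hd1 (by norm_num)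
  have hf1 : ∀ y, HasFDerivAt ψ (dx1 ψ y) y := fun y =>
    (hψ.differentiable (by norm_num) y).hasFDerivAt
  have hf2 : ∀ y, HasFDerivAt (dx1 ψ) (dx2 ψ y) y := fun y =>
    (hd1.differentiable (by norm_num) y).hasFDerivAt
  obtain ⟨K, t, ht, hlip⟩ := (hd2.contDiffAt (x := p)).exists_lipschitzOnWith
  have hm : 0 < ‖dx1 ψ p‖ := norm_pos_iff.2 (hne p hpU)
  set m := ‖dx1 ψ p‖ / 2 with hm_def
  have hm0 : 0 < m := by positivity
  have e1 : ∀ᶠ y in 𝓝 p, m < ‖dx1 ψ y‖ :=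
    (hd1.continuous.norm.tendsto p).eventually (lt_mem_nhds (half_lt_self hm))
  have e2 : ∀ᶠ y in 𝓝 p, dist (dx2 ψ y) (dx2 ψ p) < 1 :=
    Metric.tendsto_nhds.1 (hd2.continuous.tendsto p) 1 one_pos
  obtain ⟨ε, hε, hb⟩ := Metric.eventually_nhds_iff_ball.1
    (((e1.and e2).and (hU.mem_nhds hpU)).and ht)
  refine ⟨ε / 2, by positivity, max ((‖dx2 ψ p‖ + 1) / m) (K / m), fun x₀ hx₀ => ?_⟩
  have hsub : Metric.ball x₀ (ε / 2) ⊆ Metric.ball p ε :=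
    Metric.ball_subset_ball' (by have := hx₀.2; rw [Metric.mem_ball] at this; linarith)
  have hx₀U : x₀ ∈ Metric.ball x₀ (ε / 2) := Metric.mem_ball_self (by positivity)
  set c := ‖dx1 ψ x₀‖ with hc
  have hmc : m < c := (hb x₀ (hsub hx₀U)).1.1.1
  have hc0 : 0 < c := hm0.trans hmc
  set n := (InnerProductSpace.toDual ℝ (Euc d)).symm (dx1 ψ x₀) with hn
  have hnn : ‖n‖ = c := by rw [hn, LinearIsometryEquiv.norm_map]
  have hmem : ∀ y ∈ U, y ∈ D ↔ ψ y < 0 := fun y hy => by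
    constructor
    · intro h
      have : y ∈ D ∩ U := ⟨h, hy⟩
      rw [hDU] at this
      exact this.2
    · intro h
      have : y ∈ {y ∈ U | ψ y < 0} := ⟨hy, h⟩
      rw [← hDU] at this
      exact this.1
  have h1 : dx1 (fun y => c⁻¹ * ψ y) = fun y => c⁻¹ • dx1 ψ y := by
    funext y
    exact ((hf1 y).const_mul c⁻¹).fderiv
  have h2 : dx2 (fun y => c⁻¹ * ψ y) = fun y => c⁻¹ • dx2 ψ y := by
    funext y
    have : dx2 (fun y => c⁻¹ * ψ y) y = fderiv ℝ (dx1 (fun y => c⁻¹ * ψ y)) y := rfl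
    rw [this, h1]
    exact ((hf2 y).const_smul c⁻¹).fderiv
  have hcinv : c⁻¹ ≤ m⁻¹ := inv_anti₀ hm0 hmc.le
  refine ⟨fun y => c⁻¹ * ψ y, -(c⁻¹ • n), ?_, ?_, ?_, ?_, ?_, ?_, ?_, ?_⟩
  · rw [norm_neg, norm_smul, hnn, norm_inv, Real.norm_eq_abs, abs_of_pos hc0,
      inv_mul_cancel₀ hc0.ne']
  · intro y
    rw [h1]
    exact (hf1 y).const_mul c⁻¹
  · intro y
    rw [h1, h2]
    exact (hf2 y).const_smul c⁻¹
  · intro y hy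
    rw [hmem y (hb y (hsub hy)).1.2]
    constructor
    · intro h
      exact mul_neg_of_pos_of_neg (by positivity) h
    · intro h
      by_contra! h3
      have : 0 ≤ c⁻¹ * ψ y := by positivity
      linarith
  · rw [eq_zero_of_mem_frontier hD hU hψ.continuous hmem hx₀.1 (hb x₀ (hsub hx₀U)).1.2, mul_zero]
  · intro v
    rw [h1]
    have : inner ℝ n v = dx1 ψ x₀ v := InnerProductSpace.toDual_symm_apply
    simp [inner_smul_left, this]
  · intro y hy v w
    rw [h2]
    simp only [smul_apply, smul_eq_mul]
    rw [abs_mul, abs_inv, abs_of_pos hc0]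
    have h3 : |dx2 ψ y v w| ≤ (‖dx2 ψ p‖ + 1) * ‖v‖ * ‖w‖ := by
      have i1 := (abs_bilin_sub_le (dx2 ψ y) (dx2 ψ p) v w).trans
        (by gcongr; exact (hb y (hsub hy)).1.1.2.le : _ ≤ 1 * ‖v‖ * ‖w‖)
      have i2 := ContinuousLinearMap.le_opNorm₂ (dx2 ψ p) v w
      rw [Real.norm_eq_abs] at i2
      have := abs_sub_abs_le_abs_sub (dx2 ψ y v w) (dx2 ψ p v w)
      linarith
    have h0 : 0 ≤ ‖dx2 ψ p‖ := norm_nonneg (dx2 ψ p)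
    calc c⁻¹ * |dx2 ψ y v w| ≤ m⁻¹ * ((‖dx2 ψ p‖ + 1) * ‖v‖ * ‖w‖) := by gcongr
      _ = (‖dx2 ψ p‖ + 1) / m * ‖v‖ * ‖w‖ := by ring
      _ ≤ _ := by gcongr; exact le_max_left _ _
  · intro y hy z hz v w
    rw [h2]
    simp only [smul_apply, smul_eq_mul]
    rw [← mul_sub, abs_mul, abs_inv, abs_of_pos hc0]
    have h3 : |dx2 ψ y v w - dx2 ψ z v w| ≤ K * ‖y - z‖ * ‖v‖ * ‖w‖ := by
      have i1 := hlip.dist_le_mul y (hb y (hsub hy)).2 z (hb z (hsub hz)).2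
      rw [dist_eq_norm y z] at i1
      exact (abs_bilin_sub_le (dx2 ψ y) (dx2 ψ z) v w).trans (by gcongr)
    calc c⁻¹ * |dx2 ψ y v w - dx2 ψ z v w| ≤ m⁻¹ * (K * ‖y - z‖ * ‖v‖ * ‖w‖) := by gcongr
      _ = K / m * ‖y - z‖ * ‖v‖ * ‖w‖ := by ring
      _ ≤ _ := by gcongr; exact le_max_right _ _

lemma exists_charts {d : ℕ} {D : Set (Euc d)} (hD : GoodDomain D) :
    ∃ r > 0, ∃ M ≥ 1, HasCharts D r M := by
  obtain ⟨ho, -, hb, hC⟩ := hD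
  have hc : IsCompact (frontier D) :=
    Metric.isCompact_of_isClosed_isBounded isClosed_frontier
      (hb.closure.subset frontier_subset_closure)
  have : ∃ r > 0, ∃ M ≥ (1:ℝ), ∀ x₀ ∈ frontier D ∩ frontier D, ∃ ψ e, BdryChart D r M x₀ ψ e := by
    refine hc.induction_on (p := fun s => ∃ r > 0, ∃ M ≥ (1:ℝ), ∀ x₀ ∈ frontier D ∩ s,
      ∃ ψ e, BdryChart D r M x₀ ψ e) ⟨1, one_pos, 1, le_rfl, by simp⟩ ?_ ?_ ?_
    · rintro s t hst ⟨r, hr, M, hM, h⟩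
      exact ⟨r, hr, M, hM, fun x hx => h x ⟨hx.1, hst hx.2⟩⟩
    · rintro s t ⟨r, hr, M, hM, h⟩ ⟨r', hr', M', hM', h'⟩
      refine ⟨min r r', lt_min hr hr', max M M', le_max_of_le_left hM, ?_⟩
      rintro x ⟨hx, hx' | hx'⟩
      · obtain ⟨ψ, e, hψ⟩ := h x ⟨hx, hx'⟩
        exact ⟨ψ, e, hψ.mono (min_le_left _ _) (le_max_left _ _)⟩
      · obtain ⟨ψ, e, hψ⟩ := h' x ⟨hx, hx'⟩
        exact ⟨ψ, e, hψ.mono (min_le_right _ _) (le_max_right _ _)⟩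
    · intro p hp
      obtain ⟨r, hr, M, h⟩ := exists_local_charts ho hC hp
      refine ⟨Metric.ball p r, mem_nhdsWithin_of_mem_nhds (Metric.ball_mem_nhds p hr), r, hr,
        max M 1, le_max_right _ _, fun x hx => ?_⟩
      obtain ⟨ψ, e, hψ⟩ := h x hx
      exact ⟨ψ, e, hψ.mono le_rfl (le_max_left _ _)⟩
  obtain ⟨r, hr, M, hM, h⟩ := this
  exact ⟨r, hr, M, hM, fun x hx => h x ⟨hx, hx⟩⟩

lemma exists_mem_segment_frontier {E : Type*} [NormedAddCommGroup E] [NormedSpace ℝ E] {D : Set E}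
    (hD : IsOpen D) {x y : E} (hx : x ∈ D) (hy : y ∉ D) : ∃ z ∈ segment ℝ x y, z ∈ frontier D := by
  by_contra! h
  have : segment ℝ x y ⊆ D := by
    refine (convex_segment x y).isPreconnected.subset_of_closure_inter_subset hD
      ⟨x, left_mem_segment ℝ x y, hx⟩ ?_
    rintro z ⟨hz, hzs⟩
    by_contra hzD
    exact h z hzs (by rw [hD.frontier_eq]; exact ⟨hz, hzD⟩)
  exact hy (this (right_mem_segment ℝ x y))

lemma exists_frontier_dist_le {E : Type*} [NormedAddCommGroup E] [NormedSpace ℝ E] {D : Set E}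
    (hD : IsOpen D) {x y : E} (hx : x ∈ D) (hy : y ∉ D) :
    ∃ z ∈ frontier D, ‖x - z‖ ≤ ‖x - y‖ ∧ ‖z - y‖ ≤ ‖x - y‖ := by
  obtain ⟨z, hz, hzf⟩ := exists_mem_segment_frontier hD hx hy
  have := dist_add_dist_of_mem_segment hz
  simp only [dist_eq_norm] at this
  exact ⟨z, hzf, by linarith [norm_nonneg (z - y)], by linarith [norm_nonneg (x - z)]⟩

namespace BdryChart

variable {d : ℕ} {D : Set (Euc d)} {r M : ℝ} {x₀ : Euc d} {ψ : Euc d → ℝ} {e : Euc d}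

lemma eq_zero (h : BdryChart D r M x₀ ψ e) (hD : IsOpen D) {y : Euc d} (hy : y ∈ frontier D)
    (hyr : y ∈ Metric.ball x₀ r) : ψ y = 0 :=
  eq_zero_of_mem_frontier hD Metric.isOpen_ball
    (continuous_iff_continuousAt.2 fun y => (h.fderiv₁ y).continuousAt) h.mem_iff hy hyr

lemma segment_mem_ball {s : ℝ} (hs : s ∈ Icc (0:ℝ) 1) {y z : Euc d} (hy : y ∈ Metric.ball x₀ r)
    (hz : y + z ∈ Metric.ball x₀ r) : y + s • z ∈ Metric.ball x₀ r := by
  have := (convex_ball x₀ r).add_smul_sub_mem hy hz hs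
  simpa using this

lemma abs_grad_sub_le (h : BdryChart D r M x₀ ψ e) {y y' : Euc d} (hy : y ∈ Metric.ball x₀ r)
    (hy' : y' ∈ Metric.ball x₀ r) (v : Euc d) :
    |dx1 ψ y v - dx1 ψ y' v| ≤ M * ‖y - y'‖ * ‖v‖ := by
  obtain ⟨s, hs, he⟩ := exists_diff_eq_fderiv (g := fun y => dx1 ψ y v)
    (g1 := fun y => (dx2 ψ y).flip v) (x := y') (h := y - y') (fun s _ => by
      simpa using (h.fderiv₂ (y' + s • (y - y'))).clm_apply (hasFDerivAt_const v _))
  simp only [add_sub_cancel, ContinuousLinearMap.flip_apply] at he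
  rw [he]
  exact h.bound₂ _ (segment_mem_ball hs hy' (by rw [add_sub_cancel]; exact hy)) _ _

lemma abs_grad_add_le (h : BdryChart D r M x₀ ψ e) {y : Euc d} (hy : y ∈ Metric.ball x₀ r)
    (v : Euc d) : |dx1 ψ y v + inner ℝ e v| ≤ M * ‖y - x₀‖ * ‖v‖ := by
  have hr : 0 < r := dist_nonneg.trans_lt hy
  have := h.abs_grad_sub_le hy (Metric.mem_ball_self hr) v
  rwa [h.grad, sub_neg_eq_add] at this

lemma abs_add_le (h : BdryChart D r M x₀ ψ e) (hM : 0 ≤ M) {y : Euc d}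
    (hy : y ∈ Metric.ball x₀ r) : |ψ y + inner ℝ e (y - x₀)| ≤ M * ‖y - x₀‖ ^ 2 := by
  have hr : 0 < r := dist_nonneg.trans_lt hy
  obtain ⟨s, hs, he⟩ := exists_diff_eq_fderiv (g := ψ) (g1 := dx1 ψ) (x := x₀) (h := y - x₀)
    (fun s _ => h.fderiv₁ _)
  rw [add_sub_cancel, h.zero, sub_zero] at he
  have hb := segment_mem_ball hs (Metric.mem_ball_self hr) (z := y - x₀)
    (by rw [add_sub_cancel]; exact hy)
  have h1 := h.abs_grad_add_le hb (y - x₀)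
  rw [he]
  refine h1.trans ?_
  rw [add_sub_cancel_left, norm_smul, Real.norm_eq_abs, abs_of_nonneg hs.1]
  have : s * ‖y - x₀‖ ≤ ‖y - x₀‖ := mul_le_of_le_one_left (norm_nonneg _) hs.2
  calc M * (s * ‖y - x₀‖) * ‖y - x₀‖ ≤ M * ‖y - x₀‖ * ‖y - x₀‖ := by gcongr
    _ = _ := by ring

lemma mem_of_lt (h : BdryChart D r M x₀ ψ e) (hM : 0 ≤ M) {y : Euc d}
    (hy : y ∈ Metric.ball x₀ r) (hlt : M * ‖y - x₀‖ ^ 2 < inner ℝ e (y - x₀)) : y ∈ D := by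
  rw [h.mem_iff y hy]
  linarith [(abs_le.1 (h.abs_add_le hM hy)).2]

lemma notMem_of_le (h : BdryChart D r M x₀ ψ e) (hM : 0 ≤ M) {y : Euc d}
    (hy : y ∈ Metric.ball x₀ r) (hlt : inner ℝ e (y - x₀) ≤ -(M * ‖y - x₀‖ ^ 2)) : y ∉ D := by
  rw [h.mem_iff y hy]
  linarith [(abs_le.1 (h.abs_add_le hM hy)).1]

end BdryChart

/-- A uniform local interior cone condition. -/
def ConeCond {d : ℕ} (D : Set (Euc d)) (r : ℝ) : Prop :=
  ∀ x ∈ D, ∃ e : Euc d, ‖e‖ = 1 ∧ ∀ y ∈ D, ‖y - x‖ ≤ r → ∀ η : Euc d, ‖η - e‖ ≤ 1 / 2 →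
    ∀ s ∈ Icc 0 r, y + s • η ∈ D

lemma HasCharts.coneCond {d : ℕ} (hd : 0 < d) {D : Set (Euc d)} (hD : IsOpen D) {r M : ℝ}
    (hr : 0 < r) (hM : 1 ≤ M) (h : HasCharts D r M) : ∃ r' > 0, ConeCond D r' := by
  have hM0 : 0 < M := by linarith
  refine ⟨min (r / 6) (1 / (36 * M)), by positivity, fun x hx => ?_⟩
  set q := min (r / 6) (1 / (36 * M)) with hq
  have hq0 : 0 < q := by positivity
  have hq1 : 6 * q ≤ r := by have := min_le_left (r / 6) (1 / (36 * M)); rw [← hq] at this; linarith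
  have hq2 : M * q ≤ 1 / 36 := by
    have := min_le_right (r / 6) (1 / (36 * M)); rw [← hq] at this
    calc M * q ≤ M * (1 / (36 * M)) := by gcongr
      _ = 1 / 36 := by field_simp
  have hη : ∀ {e η : Euc d}, ‖e‖ = 1 → ‖η - e‖ ≤ 1 / 2 → ‖η‖ ≤ 3 / 2 := fun {e η} he hη => by
    have := norm_sub_norm_le η e
    linarith
  by_cases hnear : ∃ x₀ ∈ frontier D, ‖x - x₀‖ < 3 * q
  · obtain ⟨x₀, hx₀, hxx⟩ := hnear
    obtain ⟨ψ, e, hψ⟩ := h x₀ hx₀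
    refine ⟨e, hψ.norm_e, fun y hy hyx η hηe s hs => ?_⟩
    have hηn := hη hψ.norm_e hηe
    have hin : 1 / 2 ≤ inner ℝ e η := by
      have h1 : inner ℝ e η = 1 + inner ℝ e (η - e) := by
        rw [inner_sub_right, real_inner_self_eq_norm_sq, hψ.norm_e]; ring
      have h2 := neg_le_of_abs_le (abs_real_inner_le_norm e (η - e))
      rw [hψ.norm_e] at h2
      linarith
    have hyx₀ : ‖y - x₀‖ ≤ 4 * q := by
      have := norm_sub_le_norm_sub_add_norm_sub y x x₀
      linarith
    have hball : ∀ τ ∈ Icc (0:ℝ) 1, ‖y + τ • (s • η) - x₀‖ ≤ 5.5 * q := by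
      intro τ hτ
      have h1 : ‖y + τ • (s • η) - x₀‖ ≤ ‖y - x₀‖ + ‖τ • (s • η)‖ := by
        rw [add_sub_right_comm]; exact norm_add_le _ _
      rw [norm_smul, norm_smul, Real.norm_eq_abs, Real.norm_eq_abs, abs_of_nonneg hτ.1,
        abs_of_nonneg hs.1] at h1
      have h2 : τ * (s * ‖η‖) ≤ 1 * (q * (3 / 2)) := by
        gcongr
        · exact mul_nonneg hs.1 (norm_nonneg _)
        · exact hτ.2
        · exact hs.2
      linarith
    have hb : ∀ τ ∈ Icc (0:ℝ) 1, y + τ • (s • η) ∈ Metric.ball x₀ r := fun τ hτ => by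
      rw [Metric.mem_ball, dist_eq_norm]
      linarith [hball τ hτ]
    have hyb := hb 0 (by simp)
    have hyb1 := hb 1 (by simp)
    rw [zero_smul, add_zero] at hyb
    rw [one_smul] at hyb1
    rw [hψ.mem_iff _ hyb] at hy
    rw [hψ.mem_iff _ hyb1]
    obtain ⟨τ, hτ, he⟩ := exists_diff_eq_fderiv (g := ψ) (g1 := dx1 ψ) (x := y) (h := s • η)
      (fun s _ => hψ.fderiv₁ _)
    have h3 := (abs_le.1 (hψ.abs_grad_add_le (hb τ hτ) η)).2
    have h4 : M * ‖y + τ • (s • η) - x₀‖ * ‖η‖ ≤ M * (5.5 * q) * (3 / 2) := by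
      gcongr
      exact hball τ hτ
    rw [map_smul, smul_eq_mul] at he
    have h5 : dx1 ψ (y + τ • (s • η)) η ≤ 0 := by linarith
    have := mul_nonpos_of_nonneg_of_nonpos hs.1 h5
    linarith
  · push Not at hnear
    refine ⟨ebasis d ⟨0, hd⟩, by simp [ebasis], fun y hy hyx η hηe s hs => ?_⟩
    have hηn := hη (e := ebasis d ⟨0, hd⟩) (by simp [ebasis]) hηe
    by_contra hnot
    obtain ⟨z, hz, hz1, -⟩ := exists_frontier_dist_le hD hx hnot
    have h1 := hnear z hz
    have h2 : ‖x - (y + s • η)‖ ≤ ‖x - y‖ + ‖s • η‖ := by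
      rw [← sub_sub]; exact norm_sub_le _ _
    rw [norm_smul, Real.norm_eq_abs, abs_of_nonneg hs.1] at h2
    have h3 : s * ‖η‖ ≤ q * (3 / 2) := by
      gcongr
      exact hs.2
    rw [norm_sub_rev] at hyx
    linarith

section
variable {d : ℕ} {D : Set (Euc d)} {r : ℝ}

lemma abs_le_of_unit {E : Type*} [NormedAddCommGroup E] [NormedSpace ℝ E] {L : E →L[ℝ] ℝ} {K : ℝ}
    (h : ∀ v, ‖v‖ = 1 → |L v| ≤ K) (v : E) : |L v| ≤ K * ‖v‖ := by
  rcases eq_or_ne v 0 with rfl | hv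
  · simp
  · have hn : ‖v‖ ≠ 0 := norm_ne_zero_iff.2 hv
    have h1 := h (‖v‖⁻¹ • v) (by rw [norm_smul, norm_inv, norm_norm, inv_mul_cancel₀ hn])
    rw [map_smul, smul_eq_mul, abs_mul, abs_inv, abs_norm, inv_mul_le_iff₀ (by positivity)] at h1
    linarith

lemma abs_bilin_le_of_unit {B : Euc d →L[ℝ] Euc d →L[ℝ] ℝ} {K : ℝ}
    (h : ∀ v w, ‖v‖ = 1 → ‖w‖ = 1 → |B v w| ≤ K) (v w : Euc d) : |B v w| ≤ K * ‖v‖ * ‖w‖ := by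
  refine abs_le_of_unit (fun w hw => ?_) w
  exact abs_le_of_unit (L := B.flip w) (fun v hv => h v w hv hw) v

/-- A bound for the values of a functional on a ball around a unit vector bounds its norm. -/
lemma abs_le_of_cone {E : Type*} [NormedAddCommGroup E] [NormedSpace ℝ E] {L : E →L[ℝ] ℝ} {e : E}
    {K : ℝ} (h : ∀ v, ‖v - e‖ ≤ 1 / 2 → |L v| ≤ K) (v : E) : |L v| ≤ 4 * K * ‖v‖ := by
  refine abs_le_of_unit (fun v hv => ?_) v
  have h1 := h (e + (1 / 2 : ℝ) • v) (by rw [add_sub_cancel_left, norm_smul, hv]; norm_num)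
  have h2 := h e (by norm_num)
  rw [map_add, map_smul, smul_eq_mul] at h1
  rw [abs_le] at *
  constructor <;> linarith

lemma abs_bilin_le_of_cone {B : Euc d →L[ℝ] Euc d →L[ℝ] ℝ} {e : Euc d} {K : ℝ}
    (h : ∀ v w, ‖v - e‖ ≤ 1 / 2 → ‖w - e‖ ≤ 1 / 2 → |B v w| ≤ K) (v w : Euc d) :
    |B v w| ≤ 16 * K * ‖v‖ * ‖w‖ := by
  have h1 : ∀ w, ‖w - e‖ ≤ 1 / 2 → ∀ v, |B v w| ≤ 4 * K * ‖v‖ := fun w hw v =>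
    abs_le_of_cone (L := B.flip w) (fun v hv => h v w hv hw) v
  have := abs_le_of_cone (L := B v) (fun w hw => h1 w hw v) w
  linarith

/-- A function with bounded gradient is locally Lipschitz up to the boundary. -/
lemma ConeCond.abs_sub_le (hD : ConeCond D r) {g : Euc d → ℝ} {g1 : Euc d → Euc d →L[ℝ] ℝ} {K : ℝ}
    (h1 : ∀ y ∈ D, HasFDerivAt g (g1 y) y) (hK : ∀ y ∈ D, ∀ v, |g1 y v| ≤ K * ‖v‖)
    {x y : Euc d} (hx : x ∈ D) (hy : y ∈ D) (hxy : ‖x - y‖ ≤ r / 2) :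
    |g x - g y| ≤ 5 * K * ‖x - y‖ := by
  obtain ⟨e, he, hcone⟩ := hD x hx
  set ρ := ‖x - y‖ with hρ
  have hρ0 : 0 ≤ ρ := norm_nonneg _
  have hleg : ∀ p ∈ D, ‖p - x‖ ≤ r → |g (p + (2 * ρ) • e) - g p| ≤ 2 * K * ρ := by
    intro p hp hpx
    have hmem : ∀ s ∈ Icc (0:ℝ) 1, p + s • ((2 * ρ) • e) ∈ D := fun s hs => by
      rw [smul_smul]
      refine hcone p hp hpx e (by norm_num) _ ⟨by have := hs.1; positivity, ?_⟩
      calc s * (2 * ρ) ≤ 1 * (2 * ρ) := by gcongr; exact hs.2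
        _ ≤ r := by linarith
    obtain ⟨s, hs, heq⟩ := exists_diff_eq_fderiv (fun s hs => h1 _ (hmem s hs))
    rw [heq]
    refine (hK _ (hmem s hs) _).trans (le_of_eq ?_)
    rw [norm_smul, he, Real.norm_eq_abs, abs_of_nonneg (by positivity)]
    ring
  have hmid : |g (x + (2 * ρ) • e + (y - x)) - g (x + (2 * ρ) • e)| ≤ K * ρ := by
    have hmem : ∀ s ∈ Icc (0:ℝ) 1, x + (2 * ρ) • e + s • (y - x) ∈ D := fun s hs => by
      rcases hρ0.eq_or_lt with h0 | h0
      · have : x = y := by rw [← sub_eq_zero, ← norm_eq_zero, ← hρ, h0]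
        rw [← h0, this]
        simpa using hy
      have e1 : x + (2 * ρ) • e + s • (y - x) = x + (2 * ρ) • (e + (s / (2 * ρ)) • (y - x)) := by
        rw [smul_add, smul_smul, mul_div_cancel₀ _ (by positivity), add_assoc]
      rw [e1]
      refine hcone x hx (by simpa using (by linarith : 0 ≤ r)) _ ?_ _ ⟨by positivity, by linarith⟩
      rw [add_sub_cancel_left, norm_smul, norm_sub_rev, ← hρ, Real.norm_eq_abs,
        abs_of_nonneg (by have := hs.1; positivity)]
      have : s / (2 * ρ) * ρ = s / 2 := by field_simp
      rw [this]
      linarith [hs.2]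
    obtain ⟨s, hs, heq⟩ := exists_diff_eq_fderiv (fun s hs => h1 _ (hmem s hs))
    rw [heq]
    refine (hK _ (hmem s hs) _).trans (le_of_eq ?_)
    rw [norm_sub_rev]
  have e2 : x + (2 * ρ) • e + (y - x) = y + (2 * ρ) • e := by abel
  rw [e2] at hmid
  have i1 := hleg x hx (by simpa using (by linarith : 0 ≤ r))
  have i2 := hleg y hy (by rw [norm_sub_rev, ← hρ]; linarith)
  rw [abs_le] at *
  constructor <;> linarith

/-- Interpolation for first derivatives. -/
lemma ConeCond.abs_fderiv_le (hD : ConeCond D r) {g : Euc d → ℝ} {g1 : Euc d → Euc d →L[ℝ] ℝ}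
    {g2 : Euc d → Euc d →L[ℝ] Euc d →L[ℝ] ℝ} {K ω ρ : ℝ}
    (h1 : ∀ y ∈ D, HasFDerivAt g (g1 y) y) (h2 : ∀ y ∈ D, HasFDerivAt g1 (g2 y) y)
    (hK0 : 0 ≤ K) (hK : ∀ y ∈ D, ∀ v w, |g2 y v w| ≤ K * ‖v‖ * ‖w‖) {x : Euc d} (hx : x ∈ D)
    (hρ : 0 < ρ) (hρr : ρ ≤ r) (hω : ∀ p ∈ D, ‖p - x‖ ≤ 2 * ρ → |g p - g x| ≤ ω) (v : Euc d) :
    |g1 x v| ≤ 4 * (3 * K * ρ + ω / ρ) * ‖v‖ := by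
  obtain ⟨e, he, hcone⟩ := hD x hx
  refine abs_le_of_cone (e := e) (fun a ha => ?_) v
  have hr : 0 ≤ r := hρ.le.trans hρr
  have han : ‖a‖ ≤ 3 / 2 := by have := norm_sub_norm_le a e; linarith
  have hmem : ∀ s ∈ Icc (0:ℝ) 1, x + s • (ρ • a) ∈ D := fun s hs => by
    rw [smul_smul]
    refine hcone x hx (by simpa) a ha _ ⟨by have := hs.1; positivity, ?_⟩
    have : s * ρ ≤ 1 * ρ := by gcongr; exact hs.2
    linarith
  obtain ⟨s, hs, heq⟩ := exists_diff_eq_fderiv (fun s hs => h1 _ (hmem s hs))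
  have hmem' : ∀ τ ∈ Icc (0:ℝ) 1, x + τ • (s • (ρ • a)) ∈ D := fun τ hτ => by
    rw [smul_smul]
    exact hmem _ ⟨mul_nonneg hτ.1 hs.1, mul_le_one₀ hτ.2 hs.1 hs.2⟩
  obtain ⟨τ, hτ, heq'⟩ := exists_diff_eq_fderiv (g := fun y => g1 y a)
    (g1 := fun y => (g2 y).flip a) (x := x) (h := s • (ρ • a)) (fun τ hτ => by
      simpa using (h2 _ (hmem' τ hτ)).clm_apply (hasFDerivAt_const a _))
  rw [ContinuousLinearMap.flip_apply] at heq'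
  have i1 := hK _ (hmem' τ hτ) (s • (ρ • a)) a
  rw [← heq', norm_smul, norm_smul, Real.norm_eq_abs, Real.norm_eq_abs, abs_of_nonneg hs.1,
    abs_of_pos hρ] at i1
  have i2 : K * (s * (ρ * ‖a‖)) * ‖a‖ ≤ K * (1 * (ρ * (3 / 2))) * (3 / 2) := by
    have := hs.2
    gcongr
  have i3 := hω (x + ρ • a) (by simpa using hmem 1 (by simp)) (by
    rw [add_sub_cancel_left, norm_smul, Real.norm_eq_abs, abs_of_pos hρ]
    nlinarith)
  rw [heq, map_smul, smul_eq_mul, abs_mul, abs_of_pos hρ] at i3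
  have i4 : |g1 (x + s • (ρ • a)) a| ≤ ω / ρ := by rw [le_div_iff₀ hρ]; linarith
  have i5 := abs_sub_abs_le_abs_sub (g1 x a) (g1 (x + s • (ρ • a)) a)
  rw [abs_sub_comm] at i5
  have : 0 ≤ K * ρ := by positivity
  linarith

/-- Interpolation for second derivatives. -/
lemma ConeCond.abs_fderiv₂_le (hD : ConeCond D r) {g : Euc d → ℝ} {g1 : Euc d → Euc d →L[ℝ] ℝ}
    {g2 : Euc d → Euc d →L[ℝ] Euc d →L[ℝ] ℝ} {S ω ρ γ : ℝ} (hγ : γ ∈ Ioo (0:ℝ) 1) (hS : 0 ≤ S)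
    (h1 : ∀ y ∈ D, HasFDerivAt g (g1 y) y) (h2 : ∀ y ∈ D, HasFDerivAt g1 (g2 y) y)
    (hSg : ∀ x ∈ D, ∀ y ∈ D, ∀ v w, |g2 x v w - g2 y v w| ≤ S * ‖x - y‖ ^ γ * ‖v‖ * ‖w‖)
    {x : Euc d} (hx : x ∈ D) (hρ : 0 < ρ) (hρr : 2 * ρ ≤ r)
    (hω : ∀ p ∈ D, ‖p - x‖ ≤ 3 * ρ → |g p - g x| ≤ ω) (v w : Euc d) :
    |g2 x v w| ≤ 128 * (S * ρ ^ γ + ω / ρ ^ 2) * ‖v‖ * ‖w‖ := by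
  obtain ⟨e, he, hcone⟩ := hD x hx
  have hr : 0 ≤ r := by linarith
  have key : |g2 x v w| ≤ 16 * (27 / 4 * (S * ρ ^ γ) + 3 * ω / ρ ^ 2) * ‖v‖ * ‖w‖ := by
    refine abs_bilin_le_of_cone (e := e) (fun b a hb ha => ?_) v w
    have hn : ∀ a : Euc d, ‖a - e‖ ≤ 1 / 2 → ‖a‖ ≤ 3 / 2 := fun a ha => by
      have := norm_sub_norm_le a e; linarith
    have hsc : ∀ s ∈ Icc (0:ℝ) 1, s * ρ ∈ Icc 0 r := fun s hs => by
      refine ⟨by have := hs.1; positivity, ?_⟩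
      have : s * ρ ≤ 1 * ρ := by gcongr; exact hs.2
      linarith
    have hsn : ∀ a : Euc d, ‖a - e‖ ≤ 1 / 2 → ∀ s ∈ Icc (0:ℝ) 1, ‖s • (ρ • a)‖ ≤ 3 / 2 * ρ :=
      fun a ha s hs => by
        rw [norm_smul, norm_smul, Real.norm_eq_abs, Real.norm_eq_abs, abs_of_nonneg hs.1,
          abs_of_pos hρ]
        have := hn a ha
        calc s * (ρ * ‖a‖) ≤ 1 * (ρ * (3 / 2)) := by gcongr; exact hs.2
          _ = _ := by ring
    have hmem : ∀ s ∈ Icc (0:ℝ) 1, ∀ τ ∈ Icc (0:ℝ) 1, x + s • (ρ • a) + τ • (ρ • b) ∈ D := by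
      intro s hs τ hτ
      rw [smul_smul τ]
      refine hcone _ ?_ ?_ b hb _ (hsc τ hτ)
      · rw [smul_smul]
        exact hcone x hx (by simpa) a ha _ (hsc s hs)
      · rw [add_sub_cancel_left]
        linarith [hsn a ha s hs]
    have hdist : ∀ s ∈ Icc (0:ℝ) 1, ∀ τ ∈ Icc (0:ℝ) 1,
        ‖x + s • (ρ • a) + τ • (ρ • b) - x‖ ≤ 3 * ρ := by
      intro s hs τ hτ
      rw [add_assoc, add_sub_cancel_left]
      linarith [norm_add_le (s • (ρ • a)) (τ • (ρ • b)), hsn a ha s hs, hsn b hb τ hτ]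
    have i1 := abs_secondDiff_sub_le (c := g2 x (ρ • b) (ρ • a))
      (K := ρ ^ 2 * (27 / 4 * (S * ρ ^ γ))) hmem h1 h2 (fun s hs τ hτ => by
        refine (hSg _ (hmem s hs τ hτ) x hx _ _).trans ?_
        have j1 : ‖x + s • (ρ • a) + τ • (ρ • b) - x‖ ^ γ ≤ 3 * ρ ^ γ := by
          calc _ ≤ (3 * ρ) ^ γ := Real.rpow_le_rpow (norm_nonneg _) (hdist s hs τ hτ) hγ.1.le
            _ = 3 ^ γ * ρ ^ γ := Real.mul_rpow (by norm_num) hρ.le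
            _ ≤ 3 ^ (1:ℝ) * ρ ^ γ := by
              gcongr
              · norm_num
              · exact hγ.2.le
            _ = _ := by norm_num
        rw [norm_smul, norm_smul, Real.norm_eq_abs, abs_of_pos hρ]
        have j2 := hn a ha
        have j3 := hn b hb
        calc _ ≤ S * (3 * ρ ^ γ) * (ρ * (3 / 2)) * (ρ * (3 / 2)) := by gcongr
          _ = _ := by ring)
    have o1 := hω _ (hmem 1 (by simp) 1 (by simp)) (hdist 1 (by simp) 1 (by simp))
    have o2 := hω _ (hmem 1 (by simp) 0 (by simp)) (hdist 1 (by simp) 0 (by simp))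
    have o3 := hω _ (hmem 0 (by simp) 1 (by simp)) (hdist 0 (by simp) 1 (by simp))
    simp only [one_smul, zero_smul, add_zero] at o1 o2 o3
    have i2 : |secondDiff g (ρ • a) (ρ • b) x| ≤ 3 * ω := by
      unfold secondDiff
      rw [abs_le] at *
      constructor <;> linarith
    simp only [map_smul, smul_apply, smul_eq_mul] at i1
    have i3 : ρ ^ 2 * |g2 x b a| ≤ ρ ^ 2 * (27 / 4 * (S * ρ ^ γ)) + 3 * ω := by
      have := abs_sub_abs_le_abs_sub (ρ * (ρ * g2 x b a)) (secondDiff g (ρ • a) (ρ • b) x)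
      rw [abs_sub_comm, abs_mul, abs_mul, abs_of_pos hρ] at this
      linarith
    have hρ2 : 0 < ρ ^ 2 := by positivity
    rw [← mul_le_mul_iff_right₀ hρ2]
    refine i3.trans (le_of_eq ?_)
    field_simp
  refine key.trans ?_
  have hω0 : 0 ≤ ω := (abs_nonneg _).trans (hω x hx (by simpa using hρ.le))
  have : 0 ≤ S * ρ ^ γ := by positivity
  have : 0 ≤ ω / ρ ^ 2 := by positivity
  have hle : 16 * (27 / 4 * (S * ρ ^ γ) + 3 * ω / ρ ^ 2) ≤ 128 * (S * ρ ^ γ + ω / ρ ^ 2) := by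
    rw [mul_div_assoc]
    linarith
  exact mul_le_mul_of_nonneg_right (mul_le_mul_of_nonneg_right hle (norm_nonneg v)) (norm_nonneg w)

end

section
variable {d : ℕ} {D : Set (Euc d)} {γ ν K a S W : ℝ} {u f : ℝ → Euc d → ℝ}

lemma continuousAt_of_bilin_le {g2 : Euc d → Euc d →L[ℝ] Euc d →L[ℝ] ℝ} {x : Euc d} {φ : Euc d → ℝ}
    (hφ : Tendsto φ (𝓝 x) (𝓝 0)) (hφ0 : ∀ y, 0 ≤ φ y)
    (h : ∀ᶠ y in 𝓝 x, ∀ v w, |g2 y v w - g2 x v w| ≤ φ y * ‖v‖ * ‖w‖) : ContinuousAt g2 x := by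
  refine (tendsto_iff_dist_tendsto_zero (α := Euc d →L[ℝ] Euc d →L[ℝ] ℝ) (f := g2) (a := g2 x)).2 ?_
  refine squeeze_zero' (Eventually.of_forall fun y => dist_nonneg) ?_ hφ
  filter_upwards [h] with y hy
  have : ‖g2 y - g2 x‖ ≤ φ y := ContinuousLinearMap.opNorm_le_bound₂ _ (hφ0 y) hy
  calc dist (g2 y) (g2 x) = ‖g2 y - g2 x‖ := dist_eq_norm (g2 y) (g2 x)
    _ ≤ φ y := this

/-- `S` is a `γ`-Hölder constant of the second differential of `g` on the closure of `D`. -/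
def HolAt {d : ℕ} (γ : ℝ) (D : Set (Euc d)) (g : Euc d → ℝ) (S : ℝ) : Prop :=
  ∀ x ∈ closure D, ∀ y ∈ closure D, ∀ v w,
    |dx2 g x v w - dx2 g y v w| ≤ S * ‖x - y‖ ^ γ * ‖v‖ * ‖w‖

/-- A classical solution of `∂ₜ u - ν Δ u = f` on `[a, ∞) × D̄` vanishing on the boundary. -/
structure IsSol {d : ℕ} (ν : ℝ) (D : Set (Euc d)) (a : ℝ) (u f : ℝ → Euc d → ℝ) : Prop where
  d1 : ∀ t ≥ a, ∀ x ∈ closure D, HasFDerivAt (u t) (dx1 (u t) x) x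
  d2 : ∀ t ≥ a, ∀ x ∈ closure D, HasFDerivAt (dx1 (u t)) (dx2 (u t) x) x
  dt : ∀ t ≥ a, ∀ x ∈ closure D, HasDerivAt (fun s => u s x) (dtt u t x) t
  cont : ContinuousOn (fun p : ℝ × Euc d => u p.1 p.2) (Ici a ×ˢ closure D)
  pde : ∀ t ≥ a, ∀ x ∈ closure D, dtt u t x - ν * lapl (u t) x = f t x
  bc : ∀ t ≥ a, ∀ x ∈ frontier D, u t x = 0

/-- A solution together with quantitative control: `S` bounds the Hölder constants of the second
spatial differential, and `W` the lower order quantities. -/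
structure Ctrl {d : ℕ} (γ ν K : ℝ) (D : Set (Euc d)) (a : ℝ) (u f : ℝ → Euc d → ℝ) (S W : ℝ) :
    Prop where
  sol : IsSol ν D a u f
  S_pos : 0 < S
  W_pos : 0 < W
  hol2 : ∀ t ≥ a, HolAt γ D (u t) S
  bd1 : ∀ t ≥ a, ∀ x ∈ closure D, ∀ v, |dx1 (u t) x v| ≤ W * ‖v‖
  lip1 : ∀ t ≥ a, ∀ x ∈ closure D, ∀ y ∈ closure D, ∀ v,
    |dx1 (u t) x v - dx1 (u t) y v| ≤ W * ‖x - y‖ * ‖v‖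
  time1 : ∀ t ≥ a, ∀ s ≥ a, ∀ x ∈ closure D, ∀ v,
    |dx1 (u t) x v - dx1 (u s) x v| ≤ W * √|t - s| * ‖v‖
  f_space : ∀ t ≥ a, ∀ x ∈ closure D, ∀ y ∈ closure D, |f t x - f t y| ≤ W * ‖x - y‖ ^ γ
  f_time : ∀ t ≥ a, ∀ s ≥ a, ∀ x ∈ closure D, |f t x - f s x| ≤ W * |t - s| ^ (γ / 2)
  dtt_time : ∀ t ≥ a, ∀ s ≥ a, ∀ x ∈ closure D,
    |dtt u t x - dtt u s x| ≤ K * (S + W) * |t - s| ^ (γ / 2)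

lemma norm_ebasis (j : Fin d) : ‖ebasis d j‖ = 1 := by simp [ebasis]

lemma HolAt.abs_lapl_sub_le {g : Euc d → ℝ} (h : HolAt γ D g S) {x y : Euc d} (hx : x ∈ closure D)
    (hy : y ∈ closure D) : |lapl g x - lapl g y| ≤ d * (S * ‖x - y‖ ^ γ) := by
  unfold lapl
  rw [← Finset.sum_sub_distrib]
  refine (Finset.abs_sum_le_sum_abs _ _).trans ?_
  refine (Finset.sum_le_card_nsmul _ _ (S * ‖x - y‖ ^ γ) fun j _ => ?_).trans (by simp)
  simpa [norm_ebasis] using h x hx y hy (ebasis d j) (ebasis d j)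

lemma HolAt.continuousAt {g : Euc d → ℝ} (hγ : 0 < γ) (hS : 0 ≤ S) (h : HolAt γ D g S)
    (hD : IsOpen D) {x : Euc d} (hx : x ∈ D) : ContinuousAt (dx2 g) x := by
  refine continuousAt_of_bilin_le (φ := fun y => S * ‖y - x‖ ^ γ) ?_ (fun y => by positivity) ?_
  · have : ContinuousAt (fun y => S * ‖y - x‖ ^ γ) x := by
      refine continuousAt_const.mul (ContinuousAt.rpow_const (by fun_prop) (Or.inr hγ.le))
    simpa [ContinuousAt, Real.zero_rpow hγ.ne'] using this
  · filter_upwards [hD.mem_nhds hx] with y hy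
    exact h y (subset_closure hy) x (subset_closure hx)

namespace Ctrl

lemma dtt_space (h : Ctrl γ ν K D a u f S W) (hν : 0 < ν) {t S' : ℝ} (ht : a ≤ t)
    (hS' : HolAt γ D (u t) S') {x y : Euc d} (hx : x ∈ closure D) (hy : y ∈ closure D) :
    |dtt u t x - dtt u t y| ≤ (ν * d * S' + W) * ‖x - y‖ ^ γ := by
  have h1 := hS'.abs_lapl_sub_le hx hy
  have h2 := h.f_space t ht x hx y hy
  have h3 : dtt u t x - dtt u t y = ν * (lapl (u t) x - lapl (u t) y) + (f t x - f t y) := by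
    rw [← h.sol.pde t ht x hx, ← h.sol.pde t ht y hy]; ring
  rw [h3]
  refine (abs_add_le _ _).trans ?_
  rw [abs_mul, abs_of_pos hν]
  nlinarith

lemma heatAt (h : Ctrl γ ν K D a u f S W) (hγ : 0 < γ) (hD : IsOpen D) {t : ℝ} (ht : a ≤ t)
    {x : Euc d} (hx : x ∈ D) : HeatAt ν u t x (f t x) := by
  have hx' := subset_closure hx
  rw [← h.sol.pde t ht x hx']
  refine HeatAt.of_hasFDerivAt (g1 := dx1 (u t)) (h.sol.dt t ht x hx') ?_ ?_ ((h.hol2 t ht).continuousAt hγ h.S_pos.le hD hx)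
  · filter_upwards [hD.mem_nhds hx] with y hy using h.sol.d1 t ht y (subset_closure hy)
  · filter_upwards [hD.mem_nhds hx] with y hy using h.sol.d2 t ht y (subset_closure hy)

end Ctrl

lemma IsSol.dtt_eq_zero (h : IsSol ν D a u f) {t : ℝ} (ht : a ≤ t) {x : Euc d}
    (hx : x ∈ frontier D) : dtt u t x = 0 := by
  have h1 := (h.dt t ht x (frontier_subset_closure hx)).hasDerivWithinAt (s := Ici a)
  have h2 : HasDerivWithinAt (fun s => u s x) 0 (Ici a) t :=
    (hasDerivWithinAt_const t (Ici a) (0:ℝ)).congr (fun s hs => h.bc s hs x hx) (h.bc t ht x hx)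
  exact (uniqueDiffOn_Ici a t ht).eq_deriv _ h1 h2

/-- `halfBall_estimate` on the parabolic window of height `ℓ² / ν`, truncated at the initial
time `a`. -/
lemma halfBall_window {ν ℓ t₁ κ B₀ Z G : ℝ} (hν : 0 < ν) (hℓ : 0 < ℓ) (ht : a ≤ t₁)
    (hκ : 0 ≤ κ) (hB₀ : 0 ≤ B₀) (hZ : 0 < Z) (hG : 0 ≤ G) {n xc : Euc d} (hn : ‖n‖ = 1)
    {z : ℝ → Euc d → ℝ}
    (hcont : ContinuousOn (fun p : ℝ × Euc d => z p.1 p.2)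
      (Ici a ×ˢ {x : Euc d | ‖x - xc‖ ≤ ℓ ∧ 0 ≤ inner ℝ n (x - xc)}))
    (hheat : ∀ t, a ≤ t → |t - t₁| ≤ ℓ ^ 2 / ν → ∀ x, ‖x - xc‖ < ℓ → 0 < inner ℝ n (x - xc) →
      ∃ g ≤ G, HeatAt ν z t x g)
    (hbound : ∀ t, a ≤ t → |t - t₁| ≤ ℓ ^ 2 / ν → ∀ x, ‖x - xc‖ ≤ ℓ → 0 ≤ inner ℝ n (x - xc) →
      z t x ≤ Z)
    (hflat : ∀ t, a ≤ t → |t - t₁| ≤ ℓ ^ 2 / ν → ∀ x, ‖x - xc‖ ≤ ℓ → inner ℝ n (x - xc) = 0 →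
      z t x ≤ κ)
    (hbot : a + ℓ ^ 2 / ν ≤ t₁ ∨ (|a - t₁| ≤ ℓ ^ 2 / ν → ∀ x, ‖x - xc‖ ≤ ℓ →
      0 ≤ inner ℝ n (x - xc) → z a x ≤ B₀))
    {b : ℝ} (hb : 0 ≤ b) (hbℓ : b ≤ ℓ) :
    z t₁ (xc + b • n) ≤ κ + B₀ + (d + 1) * (Z + G * ℓ ^ 2 / ν) * (b / ℓ) := by
  have hq : 0 ≤ ℓ ^ 2 / ν := by positivity
  by_cases hc : a + ℓ ^ 2 / ν ≤ t₁
  · have hwin : ∀ t ∈ Icc (t₁ - ℓ ^ 2 / ν) t₁, a ≤ t ∧ |t - t₁| ≤ ℓ ^ 2 / ν := fun t ht => by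
      refine ⟨by linarith [ht.1], ?_⟩
      rw [abs_le]; constructor <;> linarith [ht.1, ht.2]
    have key := halfBall_estimate (t₀ := t₁ - ℓ ^ 2 / ν) (κ := κ) (B₀ := 0) (Z := Z) (G := G) hν hℓ
      (by linarith) hκ le_rfl hZ hG hn
      (hcont.mono (prod_mono (fun t ht => (hwin t ht).1) subset_rfl))
      (fun t ht => hheat t (hwin t ⟨ht.1.le, ht.2⟩).1 (hwin t ⟨ht.1.le, ht.2⟩).2)
      (fun t ht => hbound t (hwin t ht).1 (hwin t ht).2)
      (fun t ht => hflat t (hwin t ht).1 (hwin t ht).2)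
      (fun x h1 h2 => by
        have hm := hwin (t₁ - ℓ ^ 2 / ν) ⟨le_rfl, by linarith⟩
        have : ν * (t₁ - (t₁ - ℓ ^ 2 / ν)) / ℓ ^ 2 = 1 := by field_simp; ring
        rw [this]
        simpa using hbound _ hm.1 hm.2 x h1 h2) hb hbℓ
    linarith
  · replace hbot := hbot.resolve_left hc
    have hwin : ∀ t ∈ Icc a t₁, a ≤ t ∧ |t - t₁| ≤ ℓ ^ 2 / ν := fun t ht => by
      refine ⟨ht.1, ?_⟩
      rw [abs_le]; constructor <;> linarith [ht.1, ht.2]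
    exact halfBall_estimate (t₀ := a) (κ := κ) (B₀ := B₀) (Z := Z) (G := G) hν hℓ ht hκ hB₀ hZ hG hn
      (hcont.mono (prod_mono (fun t ht => (hwin t ht).1) subset_rfl))
      (fun t ht => hheat t (hwin t ⟨ht.1.le, ht.2⟩).1 (hwin t ⟨ht.1.le, ht.2⟩).2)
      (fun t ht => hbound t (hwin t ht).1 (hwin t ht).2)
      (fun t ht => hflat t (hwin t ht).1 (hwin t ht).2)
      (fun x h1 h2 => (hbot (hwin a ⟨le_rfl, ht⟩).2 x h1 h2).trans (by
        have : 0 ≤ Z * (ν * (t₁ - a) / ℓ ^ 2) := by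
          have : 0 ≤ t₁ - a := by linarith
          positivity
        linarith)) hb hbℓ

end

section
variable {d : ℕ} {D : Set (Euc d)} {γ ν K a S W : ℝ} {u f : ℝ → Euc d → ℝ}

lemma exists_reflection {n : Euc d} (hn : ‖n‖ = 1) :
    ∃ R : Euc d ≃ₗᵢ[ℝ] Euc d, ∀ v, R v = v - (2 * inner ℝ n v) • n := by
  refine ⟨(ℝ ∙ n)ᗮ.reflection, fun v => ?_⟩
  rw [Submodule.reflection_orthogonal_apply, Submodule.reflection_singleton_apply, hn]
  simp only [RCLike.ofReal_real_eq_id, id_eq, one_pow, div_one]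
  module

lemma ContinuousOn.comp_shift {H : Set (Euc d)}
    (hu : ContinuousOn (fun p : ℝ × Euc d => u p.1 p.2) (Ici a ×ˢ closure D)) {s : ℝ} (hs : 0 ≤ s)
    {Φ : Euc d → Euc d} (hΦ : Continuous Φ) (hm : ∀ p ∈ H, Φ p ∈ closure D) :
    ContinuousOn (fun p : ℝ × Euc d => u (p.1 + s) (Φ p.2)) (Ici a ×ˢ H) := by
  have : ContinuousOn (fun p : ℝ × Euc d => (p.1 + s, Φ p.2)) (Ici a ×ˢ H) := by fun_prop
  refine hu.comp this fun p hp => ⟨?_, hm _ hp.2⟩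
  have : a ≤ p.1 := hp.1
  exact show a ≤ p.1 + s by linarith

lemma ContinuousOn.secondDiff_comp {H : Set (Euc d)} {h k : Euc d}
    (hu : ContinuousOn (fun p : ℝ × Euc d => u p.1 p.2) (Ici a ×ˢ closure D))
    {Φ : Euc d → Euc d} (hΦ : Continuous Φ) (hm : ∀ p ∈ H, Φ p + h + k ∈ closure D)
    (hm1 : ∀ p ∈ H, Φ p + h ∈ closure D) (hm2 : ∀ p ∈ H, Φ p + k ∈ closure D)
    (hm3 : ∀ p ∈ H, Φ p ∈ closure D) :
    ContinuousOn (fun p : ℝ × Euc d => secondDiff (u p.1) h k (Φ p.2)) (Ici a ×ˢ H) := by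
  have e1 := hu.comp_shift le_rfl (Φ := fun p => Φ p + h + k) (by fun_prop) hm
  have e2 := hu.comp_shift le_rfl (Φ := fun p => Φ p + h) (by fun_prop) hm1
  have e3 := hu.comp_shift le_rfl (Φ := fun p => Φ p + k) (by fun_prop) hm2
  have e4 := hu.comp_shift le_rfl hΦ hm3
  simp only [add_zero] at e1 e2 e3 e4
  exact ((e1.sub e2).sub e3).add e4

lemma norm_stencil_le {h k : Euc d} {η : ℝ} (hh : ‖h‖ ≤ η) (hk : ‖k‖ ≤ η) {s r : ℝ}
    (hs : s ∈ Icc (0:ℝ) 1) (hr : r ∈ Icc (0:ℝ) 1) : ‖s • h + r • k‖ ≤ 2 * η := by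
  have h1 : ‖s • h‖ ≤ η := by
    rw [norm_smul, Real.norm_eq_abs, abs_of_nonneg hs.1]
    nlinarith [norm_nonneg h, hs.1, hs.2]
  have h2 : ‖r • k‖ ≤ η := by
    rw [norm_smul, Real.norm_eq_abs, abs_of_nonneg hr.1]
    nlinarith [norm_nonneg k, hr.1, hr.2]
  linarith [norm_add_le (s • h) (r • k)]

/-- The Hölder difference of the second differential at two points symmetric about the centre of
an interior ball. -/
lemma Ctrl.interior_diff_le (h : Ctrl γ ν K D a u f S W) (hγ : γ ∈ Ioo (0:ℝ) 1) (hν : 0 < ν)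
    (hD : IsOpen D) {t : ℝ} (ht : a ≤ t) {m n : Euc d} (hn : ‖n‖ = 1) {ρ L ε S₀ : ℝ} (hρ : 0 < ρ)
    (hL : 4 ≤ L) (hε : 0 < ε) (hε1 : ε ≤ 1) (hball : ∀ p, ‖p - m‖ ≤ 2 * (L * ρ) → p ∈ D)
    (hS₀ : 0 ≤ S₀) (hinit : a + (L * ρ) ^ 2 / ν ≤ t ∨ HolAt γ D (u a) S₀) {v w : Euc d}
    (hv : ‖v‖ = 1) (hw : ‖w‖ = 1) :
    dx2 (u t) (m + (ρ / 2) • n) w v - dx2 (u t) (m - (ρ / 2) • n) w v ≤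
      (S * (2 * (2 * ε) ^ γ) + S₀ * (3 * L) ^ γ +
        (d + 1) * (S * (3 * L) ^ γ + 4 * W * (2 * L) ^ γ * L ^ 2 / (ν * ε ^ 2)) * (1 / (2 * L)))
      * ρ ^ γ := by
  obtain ⟨R, hR⟩ := exists_reflection hn
  set ℓ := L * ρ with hℓ
  have hℓ0 : 0 < ℓ := by positivity
  set k := (ε * ρ) • v with hk
  set l := (ε * ρ) • w with hl
  have hη : 0 < ε * ρ := by positivity
  have hηℓ : 4 * (ε * ρ) ≤ ℓ := by rw [hℓ]; nlinarith
  have hρℓ : 4 * ρ ≤ ℓ := by rw [hℓ]; nlinarith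
  have hkn : ‖k‖ ≤ ε * ρ := by rw [hk, norm_smul, hv, Real.norm_eq_abs, abs_of_pos hη, mul_one]
  have hln : ‖l‖ ≤ ε * ρ := by rw [hl, norm_smul, hw, Real.norm_eq_abs, abs_of_pos hη, mul_one]
  set c := m - R m with hc
  have hR' : ∀ p, R p + c = p - (2 * inner ℝ n (p - m)) • n := fun p => by
    have : R p + c = m + R (p - m) := by rw [map_sub]; module
    rw [this, hR]; abel_nf
  have hRm : ∀ p, ‖R p + c - m‖ = ‖p - m‖ := fun p => by
    have : R p + c - m = R (p - m) := by rw [map_sub]; module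
    rw [this, LinearIsometryEquiv.norm_map]
  have hRd : ∀ p, ‖p - m‖ ≤ ℓ → ‖p - (R p + c)‖ ≤ 2 * ℓ := fun p hp => by
    have := norm_sub_le (p - m) (R p + c - m)
    rw [sub_sub_sub_cancel_right, hRm] at this
    linarith
  have hst : ∀ p, ‖p - m‖ ≤ ℓ → ∀ s ∈ Icc (0:ℝ) 1, ∀ r ∈ Icc (0:ℝ) 1, p + s • k + r • l ∈ D := by
    intro p hp s hs r hr
    refine hball _ ?_
    have h1 := norm_stencil_le hkn hln hs hr
    have : p + s • k + r • l - m = (p - m) + (s • k + r • l) := by module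
    rw [this]
    linarith [norm_add_le (p - m) (s • k + r • l)]
  have hst' : ∀ p, ‖p - m‖ ≤ ℓ → p + k + l ∈ D ∧ p + k ∈ D ∧ p + l ∈ D ∧ p ∈ D := fun p hp => by
    have e1 := hst p hp 1 (by simp) 1 (by simp)
    have e2 := hst p hp 1 (by simp) 0 (by simp)
    have e3 := hst p hp 0 (by simp) 1 (by simp)
    have e4 := hst p hp 0 (by simp) 0 (by simp)
    simp only [one_smul, zero_smul, add_zero] at e1 e2 e3 e4
    exact ⟨e1, e2, e3, e4⟩
  -- the second difference is a value of the second differential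
  have hsd : ∀ s, a ≤ s → ∀ p, ‖p - m‖ ≤ ℓ → ∃ ξ ∈ D, ‖ξ - p‖ ≤ 2 * (ε * ρ) ∧
      secondDiff (u s) k l p = (ε * ρ) ^ 2 * dx2 (u s) ξ w v := by
    intro s hs p hp
    obtain ⟨σ, hσ, r, hr, he⟩ := exists_secondDiff_eq (g := u s) (g1 := dx1 (u s))
      (g2 := dx2 (u s)) (x := p) (h := k) (k := l)
      (fun σ hσ r hr => h.sol.d1 s hs _ (subset_closure (hst p hp σ hσ r hr)))
      (fun σ hσ r hr => h.sol.d2 s hs _ (subset_closure (hst p hp σ hσ r hr)))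
    refine ⟨_, hst p hp σ hσ r hr, ?_, ?_⟩
    · rw [add_assoc, add_sub_cancel_left]
      exact norm_stencil_le hkn hln hσ hr
    · rw [he]
      nth_rewrite 2 [hk]
      nth_rewrite 2 [hl]
      simp only [map_smul, smul_apply, smul_eq_mul]
      ring
  set z : ℝ → Euc d → ℝ := fun s p =>
    secondDiff (u s) k l p - secondDiff (u s) k l (R p + c) with hz
  have hzb : ∀ s, a ≤ s → ∀ S', 0 ≤ S' → HolAt γ D (u s) S' → ∀ p, ‖p - m‖ ≤ ℓ →
      z s p ≤ (ε * ρ) ^ 2 * (S' * (3 * ℓ) ^ γ) := by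
    intro s hs S' hS' hSt p hp
    obtain ⟨ξ, hξ, hξp, e1⟩ := hsd s hs p hp
    obtain ⟨ξ', hξ', hξp', e2⟩ := hsd s hs (R p + c) ((hRm p).trans_le hp)
    rw [hz]
    simp only
    rw [e1, e2, ← mul_sub]
    refine mul_le_mul_of_nonneg_left ?_ (by positivity)
    have := hSt ξ (subset_closure hξ) ξ' (subset_closure hξ') w v
    rw [hv, hw, mul_one, mul_one] at this
    refine (le_abs_self _).trans (this.trans ?_)
    have hd : ‖ξ - ξ'‖ ≤ 3 * ℓ := by
      have : ξ - ξ' = (ξ - p) + (p - (R p + c)) - (ξ' - (R p + c)) := by abel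
      rw [this]
      refine (norm_sub_le _ _).trans ?_
      linarith [norm_add_le (ξ - p) (p - (R p + c)), hRd p hp]
    exact mul_le_mul_of_nonneg_left (Real.rpow_le_rpow (norm_nonneg _) hd hγ.1.le) hS'
  have hmain := halfBall_window (a := a) (t₁ := t) (κ := 0) (B₀ := (ε * ρ) ^ 2 * (S₀ * (3 * ℓ) ^ γ))
    (Z := (ε * ρ) ^ 2 * (S * (3 * ℓ) ^ γ)) (G := 4 * (W * (2 * ℓ) ^ γ)) (n := n) (xc := m) (z := z)
    hν hℓ0 ht le_rfl (by positivity) (by have := h.S_pos; positivity)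
    (by have := h.W_pos; positivity) hn ?_ ?_ ?_ ?_ ?_ (b := ρ / 2) (by positivity) (by linarith)
  · obtain ⟨ξ, hξ, hξp, e1⟩ := hsd t ht (m + (ρ / 2) • n) (by
      rw [add_sub_cancel_left, norm_smul, hn, Real.norm_eq_abs, abs_of_pos (by positivity)]
      linarith)
    have hRx : R (m + (ρ / 2) • n) + c = m - (ρ / 2) • n := by
      rw [hR', add_sub_cancel_left, inner_smul_right, real_inner_self_eq_norm_sq, hn]
      module
    obtain ⟨ξ', hξ', hξp', e2⟩ := hsd t ht (m - (ρ / 2) • n) (by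
      rw [sub_sub_cancel_left, norm_neg, norm_smul, hn, Real.norm_eq_abs, abs_of_pos (by positivity)]
      linarith)
    have hx : m + (ρ / 2) • n ∈ D := (hst' _ (by
      rw [add_sub_cancel_left, norm_smul, hn, Real.norm_eq_abs, abs_of_pos (by positivity)]
      linarith)).2.2.2
    have hy : m - (ρ / 2) • n ∈ D := (hst' _ (by
      rw [sub_sub_cancel_left, norm_neg, norm_smul, hn, Real.norm_eq_abs, abs_of_pos (by positivity)]
      linarith)).2.2.2
    rw [hz] at hmain
    simp only at hmain
    rw [hRx, e1, e2] at hmain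
    have j1 := h.hol2 t ht _ (subset_closure hξ) _ (subset_closure hx) w v
    have j2 := h.hol2 t ht _ (subset_closure hξ') _ (subset_closure hy) w v
    rw [hv, hw, mul_one, mul_one] at j1 j2
    have hS := h.S_pos
    have k1 : S * ‖ξ - (m + (ρ / 2) • n)‖ ^ γ ≤ S * ((2 * ε) ^ γ * ρ ^ γ) := by
      rw [← Real.mul_rpow (by positivity) (by positivity), mul_assoc]
      exact mul_le_mul_of_nonneg_left (Real.rpow_le_rpow (norm_nonneg _) hξp hγ.1.le) hS.le
    have k2 : S * ‖ξ' - (m - (ρ / 2) • n)‖ ^ γ ≤ S * ((2 * ε) ^ γ * ρ ^ γ) := by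
      rw [← Real.mul_rpow (by positivity) (by positivity), mul_assoc]
      exact mul_le_mul_of_nonneg_left (Real.rpow_le_rpow (norm_nonneg _) hξp' hγ.1.le) hS.le
    have e3 : (3 * ℓ) ^ γ = (3 * L) ^ γ * ρ ^ γ := by
      rw [← Real.mul_rpow (by positivity) (by positivity), hℓ, mul_assoc]
    have e4 : (2 * ℓ) ^ γ = (2 * L) ^ γ * ρ ^ γ := by
      rw [← Real.mul_rpow (by positivity) (by positivity), hℓ, mul_assoc]
    rw [e3, e4] at hmain
    have hm2 : dx2 (u t) ξ w v - dx2 (u t) ξ' w v ≤ (S₀ * (3 * L) ^ γ +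
        (d + 1) * (S * (3 * L) ^ γ + 4 * W * (2 * L) ^ γ * L ^ 2 / (ν * ε ^ 2)) * (1 / (2 * L)))
      * ρ ^ γ := by
      have hp : 0 < (ε * ρ) ^ 2 := by positivity
      rw [← mul_le_mul_iff_right₀ hp, mul_sub]
      refine hmain.trans (le_of_eq ?_)
      rw [hℓ]
      field_simp
      ring
    have j1' := (abs_le.1 (j1.trans k1)).1
    have j2' := (abs_le.1 (j2.trans k2)).2
    nlinarith
  · have hm1 : ∀ p ∈ {x : Euc d | ‖x - m‖ ≤ ℓ ∧ 0 ≤ inner ℝ n (x - m)}, ‖p - m‖ ≤ ℓ :=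
      fun p hp => hp.1
    have hm2 : ∀ p ∈ {x : Euc d | ‖x - m‖ ≤ ℓ ∧ 0 ≤ inner ℝ n (x - m)}, ‖R p + c - m‖ ≤ ℓ :=
      fun p hp => (hRm p).trans_le hp.1
    exact (h.sol.cont.secondDiff_comp continuous_id
        (fun p hp => subset_closure (hst' p (hm1 p hp)).1)
        (fun p hp => subset_closure (hst' p (hm1 p hp)).2.1)
        (fun p hp => subset_closure (hst' p (hm1 p hp)).2.2.1)
        (fun p hp => subset_closure (hst' p (hm1 p hp)).2.2.2)).sub
      (h.sol.cont.secondDiff_comp (Φ := fun p => R p + c) (by fun_prop)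
        (fun p hp => subset_closure (hst' _ (hm2 p hp)).1)
        (fun p hp => subset_closure (hst' _ (hm2 p hp)).2.1)
        (fun p hp => subset_closure (hst' _ (hm2 p hp)).2.2.1)
        (fun p hp => subset_closure (hst' _ (hm2 p hp)).2.2.2))
  · intro s hs _ p hp _
    have hp1 := hst' p hp.le
    have hp2 := hst' (R p + c) ((hRm p).trans_le hp.le)
    have hsd1 : ∀ q, q + k + l ∈ D ∧ q + k ∈ D ∧ q + l ∈ D ∧ q ∈ D →
        HeatAt ν (fun t x => secondDiff (u t) k l x) s q (secondDiff (f s) k l q) := fun q hq =>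
      HeatAt.secondDiff (h.heatAt hγ.1 hD hs hq.1) (h.heatAt hγ.1 hD hs hq.2.1)
        (h.heatAt hγ.1 hD hs hq.2.2.1) (h.heatAt hγ.1 hD hs hq.2.2.2)
    refine ⟨_, ?_, (hsd1 p hp1).sub ((hsd1 _ hp2).comp_isometry R)⟩
    have hf : ∀ e, p + e ∈ D → R p + c + e ∈ D →
        |f s (p + e) - f s (R p + c + e)| ≤ W * (2 * ℓ) ^ γ := fun e h1 h2 => by
      refine (h.f_space s hs _ (subset_closure h1) _ (subset_closure h2)).trans ?_
      rw [add_sub_add_right_eq_sub]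
      exact mul_le_mul_of_nonneg_left
        (Real.rpow_le_rpow (norm_nonneg _) (hRd p hp.le) hγ.1.le) h.W_pos.le
    have f1 := abs_le.1 (hf (k + l) (by rw [← add_assoc]; exact hp1.1)
      (by rw [← add_assoc]; exact hp2.1))
    have f2 := abs_le.1 (hf k hp1.2.1 hp2.2.1)
    have f3 := abs_le.1 (hf l hp1.2.2.1 hp2.2.2.1)
    have f4 := abs_le.1 (hf 0 (by simpa using hp1.2.2.2) (by rw [add_zero]; exact hp2.2.2.2))
    simp only [← add_assoc, add_zero] at f1 f4
    unfold secondDiff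
    linarith
  · intro s hs _ p hp _
    exact hzb s hs S h.S_pos.le (h.hol2 s hs) p hp
  · intro s hs _ p hp h0
    have : R p + c = p := by rw [hR', h0]; simp
    rw [hz]
    simp only [this, sub_self, le_refl]
  · refine hinit.imp_right fun hh _ p hp _ => hzb a le_rfl S₀ hS₀ hh p hp

end

lemma exists_first_exit {E : Type*} [NormedAddCommGroup E] [NormedSpace ℝ E] {D : Set E}
    (hD : IsOpen D) {x y : E} (hx : x ∈ D) (hy : y ∉ D) :
    ∃ s ∈ Icc (0:ℝ) 1, x + s • (y - x) ∈ frontier D ∧ ∀ r ∈ Ico 0 s, x + r • (y - x) ∈ D := by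
  have hcont : Continuous fun s : ℝ => x + s • (y - x) := by fun_prop
  have hK : IsCompact (Icc (0:ℝ) 1 ∩ (fun s : ℝ => x + s • (y - x)) ⁻¹' Dᶜ) :=
    isCompact_Icc.inter_right (hD.isClosed_compl.preimage hcont)
  obtain ⟨s, ⟨hs, hsD⟩, hmin⟩ := hK.exists_isLeast ⟨1, by simp, by simpa using hy⟩
  have hlt : ∀ r ∈ Ico 0 s, x + r • (y - x) ∈ D := fun r hr => by
    by_contra hc
    exact absurd (hmin ⟨⟨hr.1, hr.2.le.trans hs.2⟩, hc⟩) (not_le.2 hr.2)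
  refine ⟨s, hs, ⟨?_, ?_⟩, hlt⟩
  · have hs0 : s ≠ 0 := by
      rintro rfl
      exact hsD (by simpa using hx)
    have hs0' : 0 < s := lt_of_le_of_ne hs.1 hs0.symm
    refine closure_mono (s := (fun s : ℝ => x + s • (y - x)) '' Ico 0 s)
      (image_subset_iff.2 hlt) ?_
    refine image_closure_subset_closure_image hcont ⟨s, ?_, rfl⟩
    rw [closure_Ico hs0'.ne]
    exact ⟨hs.1, le_rfl⟩
  · rw [hD.interior_eq]
    exact hsD

/-- A function vanishing on the boundary is controlled by its gradient bound times the distance to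
a point outside. -/
lemma abs_le_of_exit {E : Type*} [NormedAddCommGroup E] [NormedSpace ℝ E] {D B : Set E}
    (hD : IsOpen D) (hB : Convex ℝ B) {g : E → ℝ} {g1 : E → E →L[ℝ] ℝ} {K : ℝ} (hK : 0 ≤ K)
    (h1 : ∀ y ∈ closure D ∩ B, HasFDerivAt g (g1 y) y)
    (hb : ∀ y ∈ closure D ∩ B, ∀ v, |g1 y v| ≤ K * ‖v‖) (h0 : ∀ y ∈ frontier D ∩ B, g y = 0)
    {x y : E} (hx : x ∈ D) (hy : y ∉ D) (hxB : x ∈ B) (hyB : y ∈ B) : |g x| ≤ K * ‖y - x‖ := by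
  obtain ⟨s, hs, hz, hlt⟩ := exists_first_exit hD hx hy
  have hBm : ∀ r ∈ Icc (0:ℝ) 1, x + r • (y - x) ∈ B := fun r hr =>
    hB.add_smul_sub_mem hxB hyB hr
  have hmem : ∀ r ∈ Icc (0:ℝ) 1, x + r • (s • (y - x)) ∈ closure D ∩ B := by
    intro r hr
    rw [smul_smul]
    have hrs : r * s ∈ Icc (0:ℝ) 1 := ⟨mul_nonneg hr.1 hs.1, mul_le_one₀ hr.2 hs.1 hs.2⟩
    refine ⟨?_, hBm _ hrs⟩
    rcases lt_or_eq_of_le (show r * s ≤ s by nlinarith [hr.2, hs.1]) with h | h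
    · exact subset_closure (hlt _ ⟨hrs.1, h⟩)
    · rw [h]; exact frontier_subset_closure hz
  obtain ⟨r, hr, he⟩ := exists_diff_eq_fderiv (g := g) (g1 := g1) (x := x) (h := s • (y - x))
    fun r hr => h1 _ (hmem r hr)
  rw [h0 _ ⟨hz, hBm s hs⟩, zero_sub] at he
  rw [← abs_neg, he]
  refine (hb _ (hmem r hr) _).trans ?_
  rw [norm_smul, Real.norm_eq_abs, abs_of_nonneg hs.1]
  refine mul_le_mul_of_nonneg_left ?_ hK
  nlinarith [norm_nonneg (y - x), hs.2]

section
variable {d : ℕ} {D : Set (Euc d)} {r M : ℝ} {x₀ e : Euc d} {ψ : Euc d → ℝ}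

namespace BdryChart

/-- A function vanishing on the boundary has no tangential derivative. -/
lemma fderiv_tangential_eq_zero (h : BdryChart D r M x₀ ψ e) (hD : IsOpen D) (hr : 0 < r)
    (hM : 1 ≤ M) (hx₀ : x₀ ∈ frontier D) {g : Euc d → ℝ} {g1 : Euc d →L[ℝ] ℝ}
    (hg : HasFDerivAt g g1 x₀) (h0 : ∀ y ∈ frontier D, g y = 0) {v : Euc d} (hv : inner ℝ e v = 0) :
    g1 v = 0 := by
  wlog hv1 : ‖v‖ = 1 generalizing v
  · by_cases hv0 : v = 0
    · simp [hv0]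
    have := this (v := ‖v‖⁻¹ • v) (by rw [inner_smul_right, hv, mul_zero])
      (by rw [norm_smul, norm_inv, norm_norm, inv_mul_cancel₀ (norm_ne_zero_iff.2 hv0)])
    rw [map_smul, smul_eq_mul, mul_eq_zero] at this
    exact this.resolve_left (inv_ne_zero (norm_ne_zero_iff.2 hv0))
  have hM0 : 0 < M := by linarith
  have key : ∀ ε > 0, |g1 v| ≤ (1 + ‖g1‖) * ε := by
    intro ε hε
    obtain ⟨δ, hδ, hb⟩ := Metric.eventually_nhds_iff_ball.1 (hg.isLittleO.def (half_pos hε))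
    obtain ⟨s, hs0, hs⟩ : ∃ s : ℝ, 0 < s ∧ s < δ / 3 ∧ s < r / 3 ∧ s < 1 / (2 * M) ∧
        s < ε / (2 * M) := by
      have : 0 < min (min (δ / 3) (r / 3)) (min (1 / (2 * M)) (ε / (2 * M))) := by positivity
      refine ⟨_, half_pos this, ?_⟩
      have hlt := half_lt_self this
      simp only [lt_min_iff] at hlt
      exact ⟨hlt.1.1, hlt.1.2, hlt.2.1, hlt.2.2⟩
    obtain ⟨hs1, hs2, hs3, hs4⟩ := hs
    rw [lt_div_iff₀ (by positivity)] at hs3 hs4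
    set μ := 2 * M * s ^ 2 with hμ
    have hμs : μ ≤ s := by rw [hμ]; nlinarith
    have hμ0 : 0 < μ := by positivity
    have hnorm : ∀ τ : ℝ, ‖s • v + τ • e‖ ^ 2 = s ^ 2 + τ ^ 2 := fun τ => by
      rw [norm_add_sq_real, norm_smul, norm_smul, hv1, h.norm_e, inner_smul_left, inner_smul_right,
        real_inner_comm, hv]
      simp
    have hnorm1 : ∀ τ : ℝ, |τ| ≤ μ → ‖s • v + τ • e‖ ≤ 2 * s := fun τ hτ => by
      refine (norm_add_le _ _).trans ?_
      rw [norm_smul, norm_smul, hv1, h.norm_e, Real.norm_eq_abs, Real.norm_eq_abs, abs_of_pos hs0]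
      linarith
    have hin : ∀ τ : ℝ, inner ℝ e (s • v + τ • e) = τ := fun τ => by
      rw [inner_add_right, inner_smul_right, inner_smul_right, hv, real_inner_self_eq_norm_sq,
        h.norm_e]
      ring
    have hlt : M * (s ^ 2 + μ ^ 2) < μ := by
      have h1 : μ ^ 2 < s ^ 2 := by
        have : μ < s := by rw [hμ]; nlinarith
        nlinarith
      calc M * (s ^ 2 + μ ^ 2) < M * (s ^ 2 + s ^ 2) := by gcongr
        _ = μ := by rw [hμ]; ring
    have hp : x₀ + (s • v + μ • e) ∈ D := by
      refine h.mem_of_lt hM0.le ?_ ?_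
      · rw [Metric.mem_ball, dist_eq_norm, add_sub_cancel_left]
        linarith [hnorm1 μ (abs_of_pos hμ0).le]
      · rw [add_sub_cancel_left, hnorm, hin]; exact hlt
    have hq : x₀ + (s • v + (-μ) • e) ∉ D := by
      refine h.notMem_of_le hM0.le ?_ ?_
      · rw [Metric.mem_ball, dist_eq_norm, add_sub_cancel_left]
        linarith [hnorm1 (-μ) (by rw [abs_neg, abs_of_pos hμ0])]
      · rw [add_sub_cancel_left, hnorm, hin, neg_sq]; linarith
    obtain ⟨ρ, hρ, hz, -⟩ := exists_first_exit hD hp hq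
    set τ := μ - ρ * (2 * μ) with hτ
    have hτμ : |τ| ≤ μ := by
      rw [abs_le, hτ]; constructor <;> nlinarith [hρ.1, hρ.2]
    have hz' : x₀ + (s • v + μ • e) + ρ • (x₀ + (s • v + (-μ) • e) - (x₀ + (s • v + μ • e))) =
        x₀ + (s • v + τ • e) := by rw [hτ]; module
    rw [hz'] at hz
    have hb1 := hb (x₀ + (s • v + τ • e)) (by
      rw [Metric.mem_ball, dist_eq_norm, add_sub_cancel_left]
      linarith [hnorm1 τ hτμ])
    rw [h0 _ hz, h0 _ hx₀, add_sub_cancel_left, sub_zero, zero_sub, norm_neg, map_add, map_smul,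
      map_smul, smul_eq_mul, smul_eq_mul, Real.norm_eq_abs] at hb1
    have hge : |g1 e| ≤ ‖g1‖ := by simpa [h.norm_e] using g1.le_opNorm e
    have h1 : |τ * g1 e| ≤ μ * ‖g1‖ := by
      rw [abs_mul]; exact mul_le_mul hτμ hge (abs_nonneg _) hμ0.le
    have h2 : |s * g1 v| ≤ ε * s + μ * ‖g1‖ := by
      have h3 := abs_sub_abs_le_abs_sub (s * g1 v) (-(τ * g1 e))
      rw [abs_neg, sub_neg_eq_add] at h3
      have := hnorm1 τ hτμ
      nlinarith
    rw [abs_mul, abs_of_pos hs0] at h2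
    have h3 : μ ≤ ε * s := by rw [hμ]; nlinarith
    have h4 : s * |g1 v| ≤ s * ((1 + ‖g1‖) * ε) := by
      have : 0 ≤ ‖g1‖ := norm_nonneg g1
      nlinarith
    exact le_of_mul_le_mul_left h4 hs0
  have hg0 : 0 ≤ ‖g1‖ := norm_nonneg g1
  refine abs_nonpos_iff.1 (le_of_forall_pos_le_add fun ε hε => ?_)
  have := key (ε / (1 + ‖g1‖)) (by positivity)
  rw [mul_div_cancel₀ _ (by positivity)] at this
  linarith

/-! Half balls based at `x₀ + 32 M ℓ² e`. -/

variable {ℓ : ℝ}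

lemma mem_of_halfBall (h : BdryChart D r M x₀ ψ e) (hM : 1 ≤ M) (hℓ : 0 < ℓ)
    (hℓM : 32 * M * ℓ ≤ 1) (hℓr : 6 * ℓ < r) {p : Euc d}
    (hp : ‖p - (x₀ + (32 * M * ℓ ^ 2) • e)‖ ≤ 4 * ℓ)
    (hp0 : 0 ≤ inner ℝ e (p - (x₀ + (32 * M * ℓ ^ 2) • e))) : p ∈ D ∧ ‖p - x₀‖ ≤ 5 * ℓ := by
  set μ := 32 * M * ℓ ^ 2 with hμ
  have hμ0 : 0 < μ := by positivity
  have hμℓ : μ ≤ ℓ := by rw [hμ]; nlinarith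
  have hpn : ‖p - x₀‖ ≤ 5 * ℓ := by
    have : p - x₀ = (p - (x₀ + μ • e)) + μ • e := by module
    rw [this]
    refine (norm_add_le _ _).trans ?_
    rw [norm_smul, h.norm_e, Real.norm_eq_abs, abs_of_pos hμ0]
    linarith
  have hin : inner ℝ e (p - (x₀ + μ • e)) = inner ℝ e (p - x₀) - μ := by
    rw [← sub_sub, inner_sub_right, inner_smul_right, real_inner_self_eq_norm_sq, h.norm_e]
    ring
  refine ⟨h.mem_of_lt (by linarith) ?_ ?_, hpn⟩
  · rw [Metric.mem_ball, dist_eq_norm]; linarith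
  · rw [hin] at hp0
    have : ‖p - x₀‖ ^ 2 ≤ (5 * ℓ) ^ 2 := by gcongr
    have : M * ‖p - x₀‖ ^ 2 ≤ M * (25 * ℓ ^ 2) := by gcongr; linarith
    have : 0 < M * ℓ ^ 2 := by positivity
    nlinarith

lemma notMem_of_face (h : BdryChart D r M x₀ ψ e) (hM : 1 ≤ M) (hℓ : 0 < ℓ)
    (hℓM : 32 * M * ℓ ≤ 1) (hℓr : 6 * ℓ < r) {p : Euc d}
    (hp : ‖p - (x₀ + (32 * M * ℓ ^ 2) • e)‖ ≤ 4 * ℓ)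
    (hp0 : inner ℝ e (p - (x₀ + (32 * M * ℓ ^ 2) • e)) = 0) :
    p - (64 * M * ℓ ^ 2) • e ∉ D ∧ ‖p - (64 * M * ℓ ^ 2) • e - x₀‖ ≤ 5 * ℓ := by
  set μ := 32 * M * ℓ ^ 2 with hμ
  have hμ0 : 0 < μ := by positivity
  have hμℓ : μ ≤ ℓ := by rw [hμ]; nlinarith
  have h2μ : 64 * M * ℓ ^ 2 = 2 * μ := by rw [hμ]; ring
  rw [h2μ]
  have hpn : ‖p - (2 * μ) • e - x₀‖ ≤ 5 * ℓ := by
    have : p - (2 * μ) • e - x₀ = (p - (x₀ + μ • e)) - μ • e := by module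
    rw [this]
    refine (norm_sub_le _ _).trans ?_
    rw [norm_smul, h.norm_e, Real.norm_eq_abs, abs_of_pos hμ0]
    linarith
  have hin : inner ℝ e (p - (2 * μ) • e - x₀) = -μ := by
    have : p - (2 * μ) • e - x₀ = (p - (x₀ + μ • e)) - μ • e := by module
    rw [this, inner_sub_right, hp0, inner_smul_right, real_inner_self_eq_norm_sq, h.norm_e]
    ring
  refine ⟨h.notMem_of_le (by linarith) ?_ ?_, hpn⟩
  · rw [Metric.mem_ball, dist_eq_norm]; linarith
  · rw [hin]
    have : ‖p - (2 * μ) • e - x₀‖ ^ 2 ≤ (5 * ℓ) ^ 2 := by gcongr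
    have : M * ‖p - (2 * μ) • e - x₀‖ ^ 2 ≤ M * (25 * ℓ ^ 2) := by gcongr; linarith
    have : 0 < M * ℓ ^ 2 := by positivity
    nlinarith

/-- Shifting inwards moves points of `D` near `x₀` into the half ball. -/
lemma shift_mem_halfBall (h : BdryChart D r M x₀ ψ e) (hM : 1 ≤ M) {σ : ℝ} (hσ : 0 < σ)
    (hσℓ : 50 * σ ≤ ℓ) (hℓr : 6 * ℓ < r) (hμσ : 32 * M * ℓ ^ 2 ≤ 10 * σ) {p : Euc d} (hp : p ∈ D)
    (hpσ : ‖p - x₀‖ ≤ 40 * σ) :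
    ‖p + (64 * M * ℓ ^ 2) • e - (x₀ + (32 * M * ℓ ^ 2) • e)‖ ≤ 50 * σ ∧
      0 ≤ inner ℝ e (p + (64 * M * ℓ ^ 2) • e - (x₀ + (32 * M * ℓ ^ 2) • e)) := by
  set μ := 32 * M * ℓ ^ 2 with hμ
  have hμ0 : 0 ≤ μ := by positivity
  have h2μ : 64 * M * ℓ ^ 2 = 2 * μ := by rw [hμ]; ring
  rw [h2μ]
  have : p + (2 * μ) • e - (x₀ + μ • e) = (p - x₀) + μ • e := by module
  rw [this]
  constructor
  · refine (norm_add_le _ _).trans ?_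
    rw [norm_smul, h.norm_e, Real.norm_eq_abs, abs_of_nonneg hμ0]
    linarith
  · rw [inner_add_right, inner_smul_right, real_inner_self_eq_norm_sq, h.norm_e]
    by_contra hc
    refine h.notMem_of_le (by linarith) (y := p) ?_ ?_ hp
    · rw [Metric.mem_ball, dist_eq_norm]; linarith
    · have : ‖p - x₀‖ ^ 2 ≤ (40 * σ) ^ 2 := by gcongr
      have h2 : M * ‖p - x₀‖ ^ 2 ≤ M * ℓ ^ 2 := by
        gcongr ?_ * ?_
        nlinarith
      have : 0 ≤ M * ℓ ^ 2 := by positivity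
      push Not at hc
      nlinarith

end BdryChart

/-- Orthogonal projection of `p` to the hyperplane through `xc` orthogonal to `e`. -/
lemma projection_props {p xc e : Euc d} (he : ‖e‖ = 1) :
    let b := inner ℝ e (p - xc)
    inner ℝ e (p - b • e - xc) = 0 ∧ ‖p - b • e - xc‖ ≤ ‖p - xc‖ ∧ |b| ≤ ‖p - xc‖ ∧
      ∀ y, inner ℝ e (y - (p - b • e)) = inner ℝ e (y - xc) := by
  intro b
  have h1 : inner ℝ e (p - b • e - xc) = 0 := by
    have : p - b • e - xc = (p - xc) - b • e := by module
    rw [this, inner_sub_right, inner_smul_right, real_inner_self_eq_norm_sq, he]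
    simp [b]
  have hsq : ‖p - xc‖ ^ 2 = ‖p - b • e - xc‖ ^ 2 + b ^ 2 := by
    have : p - xc = (p - b • e - xc) + b • e := by module
    rw [this, norm_add_sq_real, inner_smul_right, real_inner_comm, h1, norm_smul, he,
      Real.norm_eq_abs]
    simp
  refine ⟨h1, ?_, ?_, fun y => ?_⟩
  · exact abs_le_of_sq_le_sq' (by nlinarith [sq_nonneg b]) (norm_nonneg _) |>.2
  · exact abs_le_of_sq_le_sq (by nlinarith [sq_nonneg ‖p - b • e - xc‖]) (norm_nonneg _)
  · have : y - (p - b • e) = (y - xc) - (p - b • e - xc) := by abel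
    rw [this, inner_sub_right, h1, sub_zero]

end

section
variable {d : ℕ}

/-- `u` with a multiple of the defining function of the domain subtracted. -/
def flatten (q : ℝ) (ψ : Euc d → ℝ) (u : ℝ → Euc d → ℝ) (s : ℝ) (p : Euc d) : ℝ :=
  u s p - q * ψ p

/-- The first spatial differential of `flatten`. -/
def flatten1 (q : ℝ) (ψ : Euc d → ℝ) (u : ℝ → Euc d → ℝ) (s : ℝ) (p : Euc d) : Euc d →L[ℝ] ℝ :=
  dx1 (u s) p - q • dx1 ψ p

/-- The second spatial differential of `flatten`. -/
def flatten2 (q : ℝ) (ψ : Euc d → ℝ) (u : ℝ → Euc d → ℝ) (s : ℝ) (p : Euc d) :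
    Euc d →L[ℝ] Euc d →L[ℝ] ℝ :=
  dx2 (u s) p - q • dx2 ψ p

lemma flatten2_apply (q : ℝ) (ψ : Euc d → ℝ) (u : ℝ → Euc d → ℝ) (s : ℝ) (p v w : Euc d) :
    flatten2 q ψ u s p v w = dx2 (u s) p v w - q * dx2 ψ p v w := by
  simp [flatten2]

/-- A controlled solution, a time `t₁` and a boundary point `x₀` with a chart. -/
structure BdrySetup (γ ν K : ℝ) (D : Set (Euc d)) (r M a : ℝ) (u f : ℝ → Euc d → ℝ) (S W t₁ : ℝ)
    (x₀ : Euc d) (ψ : Euc d → ℝ) (e : Euc d) (q : ℝ) : Prop where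
  ctrl : Ctrl γ ν K D a u f S W
  hγ : γ ∈ Ioo (0:ℝ) 1
  hν : 0 < ν
  open_ : IsOpen D
  chart : BdryChart D r M x₀ ψ e
  hM : 1 ≤ M
  hr : 0 < r
  hr2 : r ≤ 1 / 2
  hx₀ : x₀ ∈ frontier D
  ht₁ : a ≤ t₁
  hq : q = -dx1 (u t₁) x₀ e

namespace BdrySetup

variable {γ ν K : ℝ} {D : Set (Euc d)} {r M a : ℝ} {u f : ℝ → Euc d → ℝ} {S W t₁ : ℝ}
  {x₀ : Euc d} {ψ : Euc d → ℝ} {e : Euc d} {q : ℝ}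

lemma abs_q_le (h : BdrySetup γ ν K D r M a u f S W t₁ x₀ ψ e q) : |q| ≤ W := by
  rw [h.hq, abs_neg]
  simpa [h.chart.norm_e] using h.ctrl.bd1 t₁ h.ht₁ x₀ (frontier_subset_closure h.hx₀) e

lemma hasFDerivAt (h : BdrySetup γ ν K D r M a u f S W t₁ x₀ ψ e q) {s : ℝ} (hs : a ≤ s)
    {p : Euc d} (hp : p ∈ closure D) : HasFDerivAt (flatten q ψ u s) (flatten1 q ψ u s p) p :=
  (h.ctrl.sol.d1 s hs p hp).sub ((h.chart.fderiv₁ p).const_smul q)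

lemma hasFDerivAt₂ (h : BdrySetup γ ν K D r M a u f S W t₁ x₀ ψ e q) {s : ℝ} (hs : a ≤ s)
    {p : Euc d} (hp : p ∈ closure D) :
    HasFDerivAt (flatten1 q ψ u s) (flatten2 q ψ u s p) p :=
  (h.ctrl.sol.d2 s hs p hp).sub ((h.chart.fderiv₂ p).const_smul q)

lemma dist_le_one (h : BdrySetup γ ν K D r M a u f S W t₁ x₀ ψ e q) {p p' : Euc d}
    (hp : p ∈ Metric.ball x₀ r) (hp' : p' ∈ Metric.ball x₀ r) : ‖p - p'‖ ≤ 1 := by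
  rw [Metric.mem_ball, dist_eq_norm] at hp hp'
  have := norm_sub_le (p - x₀) (p' - x₀)
  rw [sub_sub_sub_cancel_right] at this
  linarith [h.hr2]

lemma le_rpow (h : BdrySetup γ ν K D r M a u f S W t₁ x₀ ψ e q) {b : ℝ} (hb : 0 ≤ b)
    (hb1 : b ≤ 1) : b ≤ b ^ γ := by
  simpa using Real.rpow_le_rpow_of_exponent_ge' hb hb1 h.hγ.1.le h.hγ.2.le

lemma abs_flatten1_le (h : BdrySetup γ ν K D r M a u f S W t₁ x₀ ψ e q) {s : ℝ} (hs : a ≤ s)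
    {ℓ : ℝ} (hℓ : 0 < ℓ) (hsl : |s - t₁| ≤ ℓ ^ 2 / ν) (hℓr : 6 * ℓ < r) {p : Euc d}
    (hp : p ∈ closure D) (hpℓ : ‖p - x₀‖ ≤ 5 * ℓ) (v : Euc d) :
    |flatten1 q ψ u s p v| ≤ W * (1 / √ν + 5 + 5 * M) * ℓ * ‖v‖ := by
  have hx := frontier_subset_closure h.hx₀
  have hW := h.ctrl.W_pos
  have hM := h.hM
  have e0 : dx1 (u t₁) x₀ v - q * dx1 ψ x₀ v = 0 := by
    have h1 := h.chart.fderiv_tangential_eq_zero h.open_ h.hr h.hM h.hx₀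
      (h.ctrl.sol.d1 t₁ h.ht₁ x₀ hx) (h.ctrl.sol.bc t₁ h.ht₁) (v := v - (inner ℝ e v) • e) (by
        rw [inner_sub_right, inner_smul_right, real_inner_self_eq_norm_sq, h.chart.norm_e]; ring)
    rw [map_sub, map_smul, smul_eq_mul] at h1
    rw [h.chart.grad, h.hq]
    linarith
  have h1 := h.ctrl.time1 s hs t₁ h.ht₁ p hp v
  have h2 := h.ctrl.lip1 t₁ h.ht₁ p hp x₀ hx v
  have h3 := h.chart.abs_grad_sub_le (y := p) (y' := x₀)
    (by rw [Metric.mem_ball, dist_eq_norm]; linarith) (Metric.mem_ball_self h.hr) v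
  have hsq : √|s - t₁| ≤ ℓ / √ν := by
    rw [← Real.sqrt_sq hℓ.le, ← Real.sqrt_div (sq_nonneg ℓ)]
    exact Real.sqrt_le_sqrt hsl
  have hqW := h.abs_q_le
  have e1 : flatten1 q ψ u s p v = (dx1 (u s) p v - dx1 (u t₁) p v) +
      (dx1 (u t₁) p v - dx1 (u t₁) x₀ v) - q * (dx1 ψ p v - dx1 ψ x₀ v) := by
    simp only [flatten1, sub_apply, smul_apply, smul_eq_mul]
    linarith
  rw [e1]
  have hv := norm_nonneg v
  have k1 : W * √|s - t₁| * ‖v‖ ≤ W * (ℓ / √ν) * ‖v‖ := by gcongr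
  have k2 : W * ‖p - x₀‖ * ‖v‖ ≤ W * (5 * ℓ) * ‖v‖ := by gcongr
  have k3 : |q * (dx1 ψ p v - dx1 ψ x₀ v)| ≤ W * (M * (5 * ℓ) * ‖v‖) := by
    rw [abs_mul]
    refine mul_le_mul hqW (h3.trans ?_) (abs_nonneg _) hW.le
    gcongr
  refine (abs_sub _ _).trans ?_
  have := abs_add_le (dx1 (u s) p v - dx1 (u t₁) p v) (dx1 (u t₁) p v - dx1 (u t₁) x₀ v)
  have e2 : W * (1 / √ν + 5 + 5 * M) * ℓ * ‖v‖ = W * (ℓ / √ν) * ‖v‖ + W * (5 * ℓ) * ‖v‖ +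
    W * (M * (5 * ℓ) * ‖v‖) := by ring
  linarith

lemma abs_flatten2_sub_le (h : BdrySetup γ ν K D r M a u f S W t₁ x₀ ψ e q) {s S' : ℝ}
    (hS' : HolAt γ D (u s) S') {p p' : Euc d} (hp : p ∈ closure D)
    (hp' : p' ∈ closure D) (hpr : p ∈ Metric.ball x₀ r) (hpr' : p' ∈ Metric.ball x₀ r)
    (v w : Euc d) :
    |flatten2 q ψ u s p v w - flatten2 q ψ u s p' v w| ≤
      (S' + M * W) * ‖p - p'‖ ^ γ * ‖v‖ * ‖w‖ := by
  have h1 := hS' p hp p' hp' v w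
  have h2 := h.chart.lip₂ p hpr p' hpr' v w
  have h3 := h.le_rpow (norm_nonneg (p - p')) (h.dist_le_one hpr hpr')
  have hW := h.ctrl.W_pos
  have hM := h.hM
  rw [flatten2_apply, flatten2_apply]
  have e1 : dx2 (u s) p v w - q * dx2 ψ p v w - (dx2 (u s) p' v w - q * dx2 ψ p' v w) =
    (dx2 (u s) p v w - dx2 (u s) p' v w) - q * (dx2 ψ p v w - dx2 ψ p' v w) := by ring
  rw [e1]
  refine (abs_sub _ _).trans ?_
  have k3 : |q * (dx2 ψ p v w - dx2 ψ p' v w)| ≤ W * (M * ‖p - p'‖ ^ γ * ‖v‖ * ‖w‖) := by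
    rw [abs_mul]
    refine mul_le_mul h.abs_q_le (h2.trans ?_) (abs_nonneg _) hW.le
    gcongr
  calc _ ≤ S' * ‖p - p'‖ ^ γ * ‖v‖ * ‖w‖ + W * (M * ‖p - p'‖ ^ γ * ‖v‖ * ‖w‖) := add_le_add h1 k3
    _ = _ := by ring

/-- The right-hand side of the heat equation satisfied by `flatten`. -/
def rhs (ν q : ℝ) (ψ : Euc d → ℝ) (f : ℝ → Euc d → ℝ) (s : ℝ) (p : Euc d) : ℝ :=
  f s p + q * ν * lapl ψ p

lemma heatAt (h : BdrySetup γ ν K D r M a u f S W t₁ x₀ ψ e q) {s : ℝ} (hs : a ≤ s) {p : Euc d}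
    (hp : p ∈ D) (hpr : p ∈ Metric.ball x₀ r) :
    HeatAt ν (flatten q ψ u) s p (rhs ν q ψ f s p) := by
  have h1 := h.ctrl.heatAt h.hγ.1 h.open_ hs hp
  have h2 : HeatAt ν (fun (_ : ℝ) x => ψ x) s p (0 - ν * lapl ψ p) := by
    refine HeatAt.of_hasFDerivAt (g1 := dx1 ψ) (hasDerivAt_const s _)
      (Eventually.of_forall h.chart.fderiv₁) (Eventually.of_forall h.chart.fderiv₂) ?_
    refine continuousAt_of_bilin_le (φ := fun y => M * ‖y - p‖) ?_
      (fun y => by have := h.hM; positivity) ?_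
    · have : ContinuousAt (fun y => M * ‖y - p‖) p := by fun_prop
      simpa [ContinuousAt] using this
    · filter_upwards [Metric.isOpen_ball.mem_nhds hpr] with y hy
      exact h.chart.lip₂ y hy p hpr
  exact (h1.sub (h2.const_mul q)).congr_value (by unfold rhs; ring)

lemma abs_rhs_sub_le (h : BdrySetup γ ν K D r M a u f S W t₁ x₀ ψ e q) {s : ℝ} (hs : a ≤ s)
    {p p' : Euc d} (hp : p ∈ closure D) (hp' : p' ∈ closure D) (hpr : p ∈ Metric.ball x₀ r)
    (hpr' : p' ∈ Metric.ball x₀ r) :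
    |rhs ν q ψ f s p - rhs ν q ψ f s p'| ≤ (1 + ν * d * M) * W * ‖p - p'‖ ^ γ := by
  have h1 := h.ctrl.f_space s hs p hp p' hp'
  have h3 := h.le_rpow (norm_nonneg (p - p')) (h.dist_le_one hpr hpr')
  have hW := h.ctrl.W_pos
  have hM := h.hM
  have hν := h.hν
  have h2 : |lapl ψ p - lapl ψ p'| ≤ d * (M * ‖p - p'‖ ^ γ) := by
    unfold lapl
    rw [← Finset.sum_sub_distrib]
    refine (Finset.abs_sum_le_sum_abs _ _).trans ?_
    refine (Finset.sum_le_card_nsmul _ _ (M * ‖p - p'‖ ^ γ) fun j _ => ?_).trans (by simp)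
    have := h.chart.lip₂ p hpr p' hpr' (ebasis d j) (ebasis d j)
    rw [norm_ebasis, mul_one, mul_one] at this
    exact this.trans (by gcongr)
  unfold rhs
  have e1 : f s p + q * ν * lapl ψ p - (f s p' + q * ν * lapl ψ p') = (f s p - f s p') +
    q * ν * (lapl ψ p - lapl ψ p') := by ring
  rw [e1]
  refine (abs_add_le _ _).trans ?_
  have k3 : |q * ν * (lapl ψ p - lapl ψ p')| ≤ W * ν * (d * (M * ‖p - p'‖ ^ γ)) := by
    rw [abs_mul, abs_mul, abs_of_pos hν]
    have := h.abs_q_le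
    gcongr
  calc _ ≤ W * ‖p - p'‖ ^ γ + W * ν * (d * (M * ‖p - p'‖ ^ γ)) := add_le_add h1 k3
    _ = _ := by ring

lemma flatten_eq_zero (h : BdrySetup γ ν K D r M a u f S W t₁ x₀ ψ e q) {s : ℝ} (hs : a ≤ s)
    {p : Euc d} (hp : p ∈ frontier D) (hpr : p ∈ Metric.ball x₀ r) : flatten q ψ u s p = 0 := by
  unfold flatten
  rw [h.ctrl.sol.bc s hs p hp, h.chart.eq_zero h.open_ hp hpr]
  ring

/-- The gradient constant. -/
def gradConst (ν M : ℝ) : ℝ := 1 / √ν + 5 + 5 * M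

lemma gradConst_pos (h : BdrySetup γ ν K D r M a u f S W t₁ x₀ ψ e q) : 0 < gradConst ν M := by
  have := h.hM
  unfold gradConst
  positivity

/-- Smallness of `flatten` on the flat face of the half ball. -/
lemma abs_flatten_face_le (h : BdrySetup γ ν K D r M a u f S W t₁ x₀ ψ e q) {s : ℝ} (hs : a ≤ s)
    {ℓ : ℝ} (hℓ : 0 < ℓ) (hsl : |s - t₁| ≤ ℓ ^ 2 / ν) (hℓM : 32 * M * ℓ ≤ 1) (hℓr : 6 * ℓ < r)
    {p : Euc d} (hp : ‖p - (x₀ + (32 * M * ℓ ^ 2) • e)‖ ≤ 4 * ℓ)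
    (hp0 : inner ℝ e (p - (x₀ + (32 * M * ℓ ^ 2) • e)) = 0) :
    |flatten q ψ u s p| ≤ 64 * M * gradConst ν M * W * ℓ ^ 3 := by
  obtain ⟨hpD, hpn⟩ := h.chart.mem_of_halfBall h.hM hℓ hℓM hℓr hp hp0.ge
  obtain ⟨hqD, hqn⟩ := h.chart.notMem_of_face h.hM hℓ hℓM hℓr hp hp0
  have hW := h.ctrl.W_pos
  have hM := h.hM
  have hκ := h.gradConst_pos
  have hball : ∀ y ∈ Metric.closedBall x₀ (5 * ℓ), y ∈ Metric.ball x₀ r := fun y hy => by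
    rw [Metric.mem_closedBall] at hy; rw [Metric.mem_ball]; linarith
  have key := abs_le_of_exit h.open_ (convex_closedBall x₀ (5 * ℓ)) (g := flatten q ψ u s)
    (g1 := flatten1 q ψ u s) (K := W * gradConst ν M * ℓ) (by positivity)
    (fun y hy => h.hasFDerivAt hs hy.1)
    (fun y hy v => h.abs_flatten1_le hs hℓ hsl hℓr hy.1
      (by simpa [dist_eq_norm] using hy.2) v)
    (fun y hy => h.flatten_eq_zero hs hy.1 (hball y hy.2)) hpD hqD
    (by simpa [dist_eq_norm] using hpn) (by rw [Metric.mem_closedBall, dist_eq_norm]; exact hqn)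
  refine key.trans (le_of_eq ?_)
  rw [sub_sub_cancel_left, norm_neg, norm_smul, h.chart.norm_e, Real.norm_eq_abs,
    abs_of_pos (by positivity)]
  ring

end BdrySetup

end

section
variable {d : ℕ}

/-- Rescaling of the conclusion of `halfBall_window`. -/
lemma window_algebra {γ ν σ L ε κ P₀ P Q m b X : ℝ} (hγ : 0 ≤ γ) (hγ1 : γ ≤ 1) (hν : 0 < ν)
    (hσ : 0 < σ) (hσ1 : σ ≤ 1) (hL : 0 < L) (hε : 0 < ε) (hκ : 0 ≤ κ) (hP : 0 ≤ P) (hQ : 0 ≤ Q)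
    (hm : 0 ≤ m) (hb : b ≤ 50 * σ)
    (h : (ε * σ) ^ 2 * X ≤ κ * (L * σ) ^ 3 + (ε * σ) ^ 2 * (P₀ * (L * σ) ^ γ) +
      m * ((ε * σ) ^ 2 * (P * (L * σ) ^ γ) + 2 * (Q * (L * σ) ^ γ) * (L * σ) ^ 2 / ν) *
        (b / (L * σ))) :
    X ≤ (κ * L ^ 3 / ε ^ 2 + P₀ * L ^ γ +
      m * (P * L ^ γ + 2 * Q * L ^ γ * L ^ 2 / (ν * ε ^ 2)) * (50 / L)) * σ ^ γ := by
  have hσγ : σ ≤ σ ^ γ := by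
    simpa using Real.rpow_le_rpow_of_exponent_ge' hσ.le hσ1 hγ hγ1
  have hbL : b / (L * σ) ≤ 50 / L := by
    rw [div_le_div_iff₀ (by positivity) hL]
    nlinarith
  rw [Real.mul_rpow hL.le hσ.le] at h
  rw [← mul_le_mul_iff_right₀ (show 0 < (ε * σ) ^ 2 by positivity)]
  refine h.trans ?_
  have j1 : κ * (L * σ) ^ 3 ≤ (ε * σ) ^ 2 * (κ * L ^ 3 / ε ^ 2 * σ ^ γ) := by
    calc _ = (ε * σ) ^ 2 * (κ * L ^ 3 / ε ^ 2 * σ) := by field_simp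
      _ ≤ _ := by gcongr
  have j2 : m * ((ε * σ) ^ 2 * (P * (L ^ γ * σ ^ γ)) + 2 * (Q * (L ^ γ * σ ^ γ)) * (L * σ) ^ 2 / ν) *
        (b / (L * σ)) ≤ m * ((ε * σ) ^ 2 * (P * (L ^ γ * σ ^ γ)) +
        2 * (Q * (L ^ γ * σ ^ γ)) * (L * σ) ^ 2 / ν) * (50 / L) := by gcongr
  refine (add_le_add (add_le_add j1 le_rfl) j2).trans (le_of_eq ?_)
  field_simp

/-- The centre of the flat face of the interior half ball at scale `ℓ`. -/
def faceCentre (M : ℝ) (x₀ e : Euc d) (ℓ : ℝ) : Euc d := x₀ + (32 * M * ℓ ^ 2) • e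

namespace BdrySetup

variable {γ ν K : ℝ} {D : Set (Euc d)} {r M a : ℝ} {u f : ℝ → Euc d → ℝ} {S W t₁ : ℝ}
  {x₀ : Euc d} {ψ : Euc d → ℝ} {e : Euc d} {q : ℝ}

/-- Constant for the tangential second derivatives. -/
def tangConst (ν M : ℝ) : ℝ := 6 * M + 256 * M * gradConst ν M

lemma tangConst_pos (h : BdrySetup γ ν K D r M a u f S W t₁ x₀ ψ e q) : 0 < tangConst ν M := by
  have := h.hM
  have := h.gradConst_pos
  unfold tangConst
  positivity

lemma mem_ball_of_le {ℓ : ℝ} (hℓ : 0 < ℓ) (hℓr : 6 * ℓ < r) {p : Euc d} (hp : ‖p - x₀‖ ≤ 5 * ℓ) :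
    p ∈ Metric.ball x₀ r := by
  rw [Metric.mem_ball, dist_eq_norm]; linarith

lemma exists_secondDiff_flatten_eq (h : BdrySetup γ ν K D r M a u f S W t₁ x₀ ψ e q) {s : ℝ}
    (hs : a ≤ s) {η : ℝ} (hη : 0 ≤ η) {v w : Euc d} (hv : ‖v‖ = 1) (hw : ‖w‖ = 1) {p : Euc d}
    (hst : ∀ σ ∈ Icc (0:ℝ) 1, ∀ τ ∈ Icc (0:ℝ) 1, p + σ • (η • v) + τ • (η • w) ∈ D) :
    ∃ σ ∈ Icc (0:ℝ) 1, ∃ τ ∈ Icc (0:ℝ) 1,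
      ‖p + σ • (η • v) + τ • (η • w) - p‖ ≤ 2 * η ∧
      secondDiff (flatten q ψ u s) (η • v) (η • w) p =
        η ^ 2 * flatten2 q ψ u s (p + σ • (η • v) + τ • (η • w)) w v := by
  obtain ⟨σ, hσ, τ, hτ, he⟩ := exists_secondDiff_eq (g := flatten q ψ u s)
    (g1 := flatten1 q ψ u s) (g2 := flatten2 q ψ u s) (x := p) (h := η • v) (k := η • w)
    (fun σ hσ τ hτ => h.hasFDerivAt hs (subset_closure (hst σ hσ τ hτ)))
    (fun σ hσ τ hτ => h.hasFDerivAt₂ hs (subset_closure (hst σ hσ τ hτ)))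
  refine ⟨σ, hσ, τ, hτ, ?_, ?_⟩
  · rw [add_assoc, add_sub_cancel_left]
    refine norm_stencil_le ?_ ?_ hσ hτ <;>
      rw [norm_smul, Real.norm_eq_abs, abs_of_nonneg hη] <;> simp [hv, hw]
  · rw [he]
    generalize p + σ • η • v + τ • η • w = ξ
    simp only [map_smul, smul_apply, smul_eq_mul]
    ring

lemma inner_stencil {n : Euc d} {p xc v w : Euc d} (hv : inner ℝ n v = 0) (hw : inner ℝ n w = 0)
    (η σ τ : ℝ) : inner ℝ n (p + σ • (η • v) + τ • (η • w) - xc) = inner ℝ n (p - xc) := by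
  have : p + σ • (η • v) + τ • (η • w) - xc = (p - xc) + σ • (η • v) + τ • (η • w) := by abel
  rw [this, inner_add_right, inner_add_right, inner_smul_right, inner_smul_right,
    inner_smul_right, inner_smul_right, hv, hw]
  ring

lemma norm_stencil_sub_le {p xc v w : Euc d} (hv : ‖v‖ = 1) (hw : ‖w‖ = 1) {η σ τ : ℝ}
    (hη : 0 ≤ η) (hσ : σ ∈ Icc (0:ℝ) 1) (hτ : τ ∈ Icc (0:ℝ) 1) :
    ‖p + σ • (η • v) + τ • (η • w) - xc‖ ≤ ‖p - xc‖ + 2 * η := by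
  have : p + σ • (η • v) + τ • (η • w) - xc = (p - xc) + (σ • (η • v) + τ • (η • w)) := by abel
  rw [this]
  refine (norm_add_le _ _).trans (add_le_add le_rfl (norm_stencil_le ?_ ?_ hσ hτ)) <;>
    rw [norm_smul, Real.norm_eq_abs, abs_of_nonneg hη] <;> simp [hv, hw]

/-- A priori size of the tangential second derivatives on the half ball. -/
lemma abs_flatten2_tangential_le (h : BdrySetup γ ν K D r M a u f S W t₁ x₀ ψ e q) {s : ℝ}
    (hs : a ≤ s) {ℓ : ℝ} (hℓ : 0 < ℓ) (hsl : |s - t₁| ≤ ℓ ^ 2 / ν) (hℓM : 32 * M * ℓ ≤ 1)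
    (hℓr : 6 * ℓ < r) {S' : ℝ} (hS'0 : 0 ≤ S') (hS' : HolAt γ D (u s) S') {v w : Euc d}
    (hv : ‖v‖ = 1) (hw : ‖w‖ = 1) (hve : inner ℝ e v = 0) (hwe : inner ℝ e w = 0) {p : Euc d}
    (hp : ‖p - faceCentre M x₀ e ℓ‖ ≤ 4 * ℓ) (hp0 : 0 ≤ inner ℝ e (p - faceCentre M x₀ e ℓ)) :
    |flatten2 q ψ u s p w v| ≤ (6 * S' + tangConst ν M * W) * ℓ ^ γ := by
  have hγ := h.hγ.1
  have hM := h.hM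
  have hW := h.ctrl.W_pos
  have hκ := h.gradConst_pos
  set xc := faceCentre M x₀ e ℓ with hxc
  have hin : ∀ y, ‖y - xc‖ ≤ 4 * ℓ → 0 ≤ inner ℝ e (y - xc) → y ∈ D ∧ ‖y - x₀‖ ≤ 5 * ℓ :=
    fun y h1 h2 => h.chart.mem_of_halfBall h.hM hℓ hℓM hℓr h1 h2
  have hst : ∀ σ ∈ Icc (0:ℝ) 1, ∀ τ ∈ Icc (0:ℝ) 1,
      ‖xc + σ • (ℓ • v) + τ • (ℓ • w) - xc‖ ≤ 4 * ℓ ∧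
      inner ℝ e (xc + σ • (ℓ • v) + τ • (ℓ • w) - xc) = 0 := fun σ hσ τ hτ => by
    refine ⟨?_, ?_⟩
    · have := norm_stencil_sub_le (p := xc) (xc := xc) hv hw hℓ.le hσ hτ
      rw [sub_self, norm_zero] at this
      linarith
    · rw [inner_stencil hve hwe, sub_self, inner_zero_right]
  obtain ⟨σ, hσ, τ, hτ, hξ, he⟩ := h.exists_secondDiff_flatten_eq hs hℓ.le hv hw (p := xc)
    (fun σ hσ τ hτ => (hin _ (hst σ hσ τ hτ).1 (hst σ hσ τ hτ).2.ge).1)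
  have hface : ∀ σ ∈ Icc (0:ℝ) 1, ∀ τ ∈ Icc (0:ℝ) 1,
      |flatten q ψ u s (xc + σ • (ℓ • v) + τ • (ℓ • w))| ≤ 64 * M * gradConst ν M * W * ℓ ^ 3 :=
    fun σ hσ τ hτ => h.abs_flatten_face_le hs hℓ hsl hℓM hℓr (hst σ hσ τ hτ).1 (hst σ hσ τ hτ).2
  have f1 := abs_le.1 (hface 1 (by simp) 1 (by simp))
  have f2 := abs_le.1 (hface 1 (by simp) 0 (by simp))
  have f3 := abs_le.1 (hface 0 (by simp) 1 (by simp))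
  have f4 := abs_le.1 (hface 0 (by simp) 0 (by simp))
  simp only [one_smul, zero_smul, add_zero] at f1 f2 f3 f4
  obtain ⟨hm1, hm2⟩ := hst σ hσ τ hτ
  generalize hξd : xc + σ • (ℓ • v) + τ • (ℓ • w) = ξ at *
  have hsd : |ℓ ^ 2 * flatten2 q ψ u s ξ w v| ≤ 256 * M * gradConst ν M * W * ℓ ^ 3 := by
    rw [← he]
    unfold secondDiff
    rw [abs_le]
    constructor <;> linarith
  have hξb : |flatten2 q ψ u s ξ w v| ≤ 256 * M * gradConst ν M * W * ℓ := by
    rw [abs_mul, abs_of_pos (by positivity)] at hsd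
    rw [← mul_le_mul_iff_right₀ (show (0:ℝ) < ℓ ^ 2 by positivity)]
    linarith
  obtain ⟨hξD, hξx⟩ := hin ξ hm1 hm2.ge
  obtain ⟨hpD, hpx⟩ := hin p hp hp0
  have hd := h.abs_flatten2_sub_le hS' (subset_closure hpD) (subset_closure hξD)
    (mem_ball_of_le hℓ hℓr hpx) (mem_ball_of_le hℓ hℓr hξx) w v
  rw [hv, hw, mul_one, mul_one] at hd
  have hℓ1 : ℓ ≤ 1 := by linarith [h.hr2]
  have hle := h.le_rpow hℓ.le hℓ1
  have hpξ : ‖p - ξ‖ ≤ 6 * ℓ := by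
    have := norm_sub_le (p - xc) (ξ - xc)
    rw [sub_sub_sub_cancel_right] at this
    linarith
  have h6 : ‖p - ξ‖ ^ γ ≤ 6 * ℓ ^ γ := by
    refine (Real.rpow_le_rpow (norm_nonneg _) hpξ hγ.le).trans ?_
    rw [Real.mul_rpow (by norm_num) hℓ.le]
    have : (6:ℝ) ^ γ ≤ 6 ^ (1:ℝ) := Real.rpow_le_rpow_of_exponent_le (by norm_num) h.hγ.2.le
    rw [Real.rpow_one] at this
    gcongr
  have k1 : (S' + M * W) * ‖p - ξ‖ ^ γ ≤ (S' + M * W) * (6 * ℓ ^ γ) :=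
    mul_le_mul_of_nonneg_left h6 (by positivity)
  have k2 : 256 * M * gradConst ν M * W * ℓ ≤ 256 * M * gradConst ν M * W * ℓ ^ γ :=
    mul_le_mul_of_nonneg_left hle (by positivity)
  have k3 : |flatten2 q ψ u s p w v| ≤ |flatten2 q ψ u s p w v - flatten2 q ψ u s ξ w v| +
      |flatten2 q ψ u s ξ w v| := by
    simpa using abs_add_le (flatten2 q ψ u s p w v - flatten2 q ψ u s ξ w v) (flatten2 q ψ u s ξ w v)
  calc _ ≤ (S' + M * W) * (6 * ℓ ^ γ) + 256 * M * gradConst ν M * W * ℓ ^ γ := by linarith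
    _ = _ := by unfold tangConst; ring

lemma continuousOn_flatten (h : BdrySetup γ ν K D r M a u f S W t₁ x₀ ψ e q) :
    ContinuousOn (fun p : ℝ × Euc d => flatten q ψ u p.1 p.2) (Ici a ×ˢ closure D) := by
  have hψ : Continuous ψ := continuous_iff_continuousAt.2 fun y => (h.chart.fderiv₁ y).continuousAt
  exact h.ctrl.sol.cont.sub (by fun_prop)

set_option maxHeartbeats 1000000 in
/-- Smallness of the tangential second derivatives near the boundary, with explicit constants. -/
lemma flatten2_tangential_le (h : BdrySetup γ ν K D r M a u f S W t₁ x₀ ψ e q)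
    {σ L ε S₀ : ℝ} (hσ : 0 < σ) (hL : 50 ≤ L) (hε : 0 < ε) (hε1 : ε ≤ 1)
    (hℓM : 32 * M * (L * σ) ≤ 1) (hℓr : 6 * (L * σ) < r)
    (hμ : 64 * M * L ^ 2 * σ ≤ ε) (hS₀ : 0 ≤ S₀)
    (hinit : a + (L * σ) ^ 2 / ν ≤ t₁ ∨ HolAt γ D (u a) S₀) {v w : Euc d}
    (hv : ‖v‖ = 1) (hw : ‖w‖ = 1) (hve : inner ℝ e v = 0) (hwe : inner ℝ e w = 0) {p : Euc d}
    (hp : p ∈ D) (hpσ : ‖p - x₀‖ ≤ 40 * σ) :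
    flatten2 q ψ u t₁ p w v ≤ ((S + M * W) * (3 * ε) ^ γ +
      256 * M * gradConst ν M * W * L ^ 3 / ε ^ 2 + (6 * S₀ + tangConst ν M * W) * L ^ γ +
      (d + 1) * ((6 * S + tangConst ν M * W) * L ^ γ +
        2 * ((1 + ν * d * M) * W) * L ^ γ * L ^ 2 / (ν * ε ^ 2)) * (50 / L)) * σ ^ γ := by
  have hγ := h.hγ.1
  have hM := h.hM
  have hW := h.ctrl.W_pos
  have hS := h.ctrl.S_pos
  have hκ := h.gradConst_pos
  have hC2 := h.tangConst_pos
  have hν := h.hν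
  have he := h.chart.norm_e
  set ℓ := L * σ with hℓd
  have hℓ : 0 < ℓ := by positivity
  set η := ε * σ with hηd
  have hη : 0 < η := by positivity
  have hσℓ : 50 * σ ≤ ℓ := by rw [hℓd]; nlinarith
  have hησ : η ≤ σ := by rw [hηd]; nlinarith
  have hℓ1 : ℓ ≤ 1 := by linarith [h.hr2]
  set xc := faceCentre M x₀ e ℓ with hxc
  have hμσ : 64 * M * ℓ ^ 2 ≤ η := by
    rw [hℓd, hηd]
    calc 64 * M * (L * σ) ^ 2 = 64 * M * L ^ 2 * σ * σ := by ring
      _ ≤ ε * σ := by gcongr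
  set p' := p + (64 * M * ℓ ^ 2) • e with hp'd
  obtain ⟨hp'n, hp'0⟩ : ‖p' - xc‖ ≤ 50 * σ ∧ 0 ≤ inner ℝ e (p' - xc) :=
    h.chart.shift_mem_halfBall h.hM hσ hσℓ hℓr (by linarith) hp hpσ
  set b := inner ℝ e (p' - xc) with hb
  obtain ⟨hm0, hmn, hbn, hmi⟩ := projection_props (p := p') (xc := xc) he
  rw [← hb] at hm0 hmn hbn hmi
  rw [abs_of_nonneg hp'0] at hbn
  set m := p' - b • e with hm
  have hin : ∀ y, ‖y - xc‖ ≤ 4 * ℓ → 0 ≤ inner ℝ e (y - xc) → y ∈ D ∧ ‖y - x₀‖ ≤ 5 * ℓ :=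
    fun y h1 h2 => h.chart.mem_of_halfBall h.hM hℓ hℓM hℓr h1 h2
  have hnear : ∀ y, ‖y - m‖ ≤ ℓ → ‖y - xc‖ ≤ 2 * ℓ := fun y hy => by
    have := norm_add_le (y - m) (m - xc)
    rw [sub_add_sub_cancel] at this
    linarith
  have hst : ∀ y, ‖y - m‖ ≤ ℓ → ∀ s ∈ Icc (0:ℝ) 1, ∀ τ ∈ Icc (0:ℝ) 1,
      ‖y + s • (η • v) + τ • (η • w) - xc‖ ≤ 4 * ℓ ∧
      inner ℝ e (y + s • (η • v) + τ • (η • w) - xc) = inner ℝ e (y - m) := by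
    intro y hy s hs τ hτ
    refine ⟨?_, ?_⟩
    · have := norm_stencil_sub_le (p := y) (xc := xc) hv hw hη.le hs hτ
      linarith [hnear y hy]
    · rw [inner_stencil hve hwe, hmi]
  have hstD : ∀ y, ‖y - m‖ ≤ ℓ → 0 ≤ inner ℝ e (y - m) → ∀ s ∈ Icc (0:ℝ) 1, ∀ τ ∈ Icc (0:ℝ) 1,
      y + s • (η • v) + τ • (η • w) ∈ D ∧ ‖y + s • (η • v) + τ • (η • w) - x₀‖ ≤ 5 * ℓ :=
    fun y hy hy0 s hs τ hτ => hin _ (hst y hy s hs τ hτ).1 (by rw [(hst y hy s hs τ hτ).2]; exact hy0)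
  have hst' : ∀ y, ‖y - m‖ ≤ ℓ → 0 ≤ inner ℝ e (y - m) →
      (y + η • v + η • w ∈ D ∧ ‖y + η • v + η • w - x₀‖ ≤ 5 * ℓ) ∧
      (y + η • v ∈ D ∧ ‖y + η • v - x₀‖ ≤ 5 * ℓ) ∧
      (y + η • w ∈ D ∧ ‖y + η • w - x₀‖ ≤ 5 * ℓ) ∧ (y ∈ D ∧ ‖y - x₀‖ ≤ 5 * ℓ) := by
    intro y hy hy0
    have e1 := hstD y hy hy0 1 (by simp) 1 (by simp)
    have e2 := hstD y hy hy0 1 (by simp) 0 (by simp)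
    have e3 := hstD y hy hy0 0 (by simp) 1 (by simp)
    have e4 := hstD y hy hy0 0 (by simp) 0 (by simp)
    simp only [one_smul, zero_smul, add_zero] at e1 e2 e3 e4
    exact ⟨e1, e2, e3, e4⟩
  have hzb : ∀ s, a ≤ s → |s - t₁| ≤ ℓ ^ 2 / ν → ∀ S', 0 ≤ S' → HolAt γ D (u s) S' →
      ∀ y, ‖y - m‖ ≤ ℓ → 0 ≤ inner ℝ e (y - m) →
      secondDiff (flatten q ψ u s) (η • v) (η • w) y ≤
        η ^ 2 * ((6 * S' + tangConst ν M * W) * ℓ ^ γ) := by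
    intro s hs hsl S' hS' hSt y hy hy0
    obtain ⟨i, hi, j, hj, -, e1⟩ := h.exists_secondDiff_flatten_eq hs hη.le hv hw (p := y)
      (fun s hs τ hτ => (hstD y hy hy0 s hs τ hτ).1)
    rw [e1]
    refine mul_le_mul_of_nonneg_left ((le_abs_self _).trans ?_) (by positivity)
    exact h.abs_flatten2_tangential_le hs hℓ hsl hℓM hℓr hS' hSt hv hw hve hwe
      (hst y hy i hi j hj).1 (by rw [hxc.symm, (hst y hy i hi j hj).2]; exact hy0)
  have hmain := halfBall_window (a := a) (t₁ := t₁) (κ := 256 * M * gradConst ν M * W * ℓ ^ 3)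
    (B₀ := η ^ 2 * ((6 * S₀ + tangConst ν M * W) * ℓ ^ γ))
    (Z := η ^ 2 * ((6 * S + tangConst ν M * W) * ℓ ^ γ))
    (G := 2 * ((1 + ν * d * M) * W * ℓ ^ γ)) (n := e) (xc := m)
    (z := fun s y => secondDiff (flatten q ψ u s) (η • v) (η • w) y)
    hν hℓ h.ht₁ (by positivity) (by positivity) (by positivity) (by positivity) he ?_ ?_ ?_ ?_ ?_
    (b := b) hp'0 (by linarith)
  · have hmb : m + b • e = p' := by rw [hm]; abel
    have hpm : ‖p' - m‖ ≤ ℓ := by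
      rw [hm, sub_sub_cancel, norm_smul, he, Real.norm_eq_abs, abs_of_nonneg hp'0]; linarith
    have hpi : 0 ≤ inner ℝ e (p' - m) := by rw [hmi]; exact hp'0
    rw [hmb] at hmain
    obtain ⟨i, hi, j, hj, hξp, e1⟩ := h.exists_secondDiff_flatten_eq h.ht₁ hη.le hv hw (p := p')
      (fun s hs τ hτ => (hstD p' hpm hpi s hs τ hτ).1)
    rw [e1] at hmain
    obtain ⟨hξD, hξx⟩ := hstD p' hpm hpi i hi j hj
    generalize p' + i • η • v + j • η • w = ξ at *
    have hpp : ‖p - p'‖ ≤ η := by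
      rw [hp'd, sub_add_cancel_left, norm_neg, norm_smul, he, Real.norm_eq_abs,
        abs_of_nonneg (by positivity)]
      linarith
    have hpξ : ‖p - ξ‖ ≤ 3 * η := by
      have := norm_sub_le (p - p') (ξ - p')
      rw [sub_sub_sub_cancel_right] at this
      linarith
    have hd := h.abs_flatten2_sub_le (h.ctrl.hol2 t₁ h.ht₁) (subset_closure hp)
      (subset_closure hξD) (mem_ball_of_le hℓ hℓr (by linarith)) (mem_ball_of_le hℓ hℓr hξx) w v
    rw [hv, hw, mul_one, mul_one] at hd
    have k1 : (S + M * W) * ‖p - ξ‖ ^ γ ≤ (S + M * W) * ((3 * ε) ^ γ * σ ^ γ) := by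
      rw [← Real.mul_rpow (by positivity) (by positivity), mul_assoc 3]
      exact mul_le_mul_of_nonneg_left (Real.rpow_le_rpow (norm_nonneg _) hpξ hγ.le) (by positivity)
    have e3 : ℓ ^ γ = L ^ γ * σ ^ γ := by
      rw [← Real.mul_rpow (by positivity) (by positivity)]
    have hm2 := window_algebra hγ.le h.hγ.2.le hν hσ (by nlinarith) (by positivity : 0 < L) hε
      (by positivity) (by positivity) (by positivity) (by positivity) (by linarith) hmain
    have hd' := (abs_le.1 (hd.trans k1)).2
    refine (sub_le_iff_le_add.1 hd').trans ((add_le_add le_rfl hm2).trans (le_of_eq ?_))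
    ring
  · exact ContinuousOn.secondDiff_comp (u := flatten q ψ u) (Φ := fun y => y) h.continuousOn_flatten
      continuous_id
      (fun y hy => subset_closure (hst' y hy.1 hy.2).1.1)
      (fun y hy => subset_closure (hst' y hy.1 hy.2).2.1.1)
      (fun y hy => subset_closure (hst' y hy.1 hy.2).2.2.1.1)
      (fun y hy => subset_closure (hst' y hy.1 hy.2).2.2.2.1)
  · intro s hs _ y hy hy0
    obtain ⟨q1, q2, q3, q4⟩ := hst' y hy.le hy0.le
    have hb := fun y (hy : ‖y - x₀‖ ≤ 5 * ℓ) => mem_ball_of_le (r := r) hℓ hℓr hy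
    refine ⟨_, ?_, HeatAt.secondDiff (f := rhs ν q ψ f s) (h.heatAt hs q1.1 (hb _ q1.2))
      (h.heatAt hs q2.1 (hb _ q2.2)) (h.heatAt hs q3.1 (hb _ q3.2)) (h.heatAt hs q4.1 (hb _ q4.2))⟩
    have g1 := h.abs_rhs_sub_le hs (subset_closure q1.1) (subset_closure q2.1) (hb _ q1.2)
      (hb _ q2.2)
    have g2 := h.abs_rhs_sub_le hs (subset_closure q3.1) (subset_closure q4.1) (hb _ q3.2)
      (hb _ q4.2)
    have hn : ‖η • w‖ ≤ ℓ := by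
      rw [norm_smul, hw, Real.norm_eq_abs, abs_of_pos hη]; linarith
    rw [add_sub_cancel_left] at g1 g2
    have hle : (1 + ν * d * M) * W * ‖η • w‖ ^ γ ≤ (1 + ν * d * M) * W * ℓ ^ γ :=
      mul_le_mul_of_nonneg_left (Real.rpow_le_rpow (norm_nonneg _) hn hγ.le) (by positivity)
    have g1' := abs_le.1 (g1.trans hle)
    have g2' := abs_le.1 (g2.trans hle)
    unfold secondDiff
    linarith
  · exact fun s hs hsl y hy hy0 => hzb s hs hsl S hS.le (h.ctrl.hol2 s hs) y hy hy0
  · intro s hs hsl y hy hy0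
    have hf : ∀ i ∈ Icc (0:ℝ) 1, ∀ j ∈ Icc (0:ℝ) 1, |flatten q ψ u s (y + i • (η • v) + j • (η • w))|
        ≤ 64 * M * gradConst ν M * W * ℓ ^ 3 := fun i hi j hj =>
      h.abs_flatten_face_le hs hℓ hsl hℓM hℓr (hst y hy i hi j hj).1
        ((hst y hy i hi j hj).2.trans hy0)
    have f1 := abs_le.1 (hf 1 (by simp) 1 (by simp))
    have f2 := abs_le.1 (hf 1 (by simp) 0 (by simp))
    have f3 := abs_le.1 (hf 0 (by simp) 1 (by simp))
    have f4 := abs_le.1 (hf 0 (by simp) 0 (by simp))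
    simp only [one_smul, zero_smul, add_zero] at f1 f2 f3 f4
    unfold secondDiff
    linarith
  · exact hinit.imp_right fun hh hsl y hy hy0 => hzb a le_rfl hsl S₀ hS₀ hh y hy hy0

end BdrySetup

end

section
variable {d : ℕ}

namespace BdrySetup

variable {γ ν K : ℝ} {D : Set (Euc d)} {r M a : ℝ} {u f : ℝ → Euc d → ℝ} {S W t₁ : ℝ}
  {x₀ : Euc d} {ψ : Euc d → ℝ} {e : Euc d} {q : ℝ}

lemma _root_.IsSol.exists_time_diff_eq (h : IsSol ν D a u f) {s τ : ℝ} (hs : a ≤ s) (hτ : 0 < τ)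
    {y : Euc d} (hy : y ∈ closure D) :
    ∃ s' ∈ Icc s (s + τ), u (s + τ) y - u s y = τ * dtt u s' y := by
  obtain ⟨s', hs', he⟩ := exists_hasDerivAt_eq_slope (fun s => u s y) (fun s => dtt u s y)
    (a := s) (b := s + τ) (by linarith)
    (fun x hx => (h.dt x (hs.trans hx.1) y hy).continuousAt.continuousWithinAt)
    (fun x hx => h.dt x (hs.trans hx.1.le) y hy)
  refine ⟨s', ⟨hs'.1.le, hs'.2.le⟩, ?_⟩
  rw [he]
  simp only [add_sub_cancel_left]
  field_simp

lemma abs_dtt_le (h : BdrySetup γ ν K D r M a u f S W t₁ x₀ ψ e q) {s S' : ℝ} (hs : a ≤ s)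
    (hS'0 : 0 ≤ S') (hS' : HolAt γ D (u s) S') {y y₀ : Euc d} (hy : y ∈ closure D)
    (hy₀ : y₀ ∈ frontier D) {ρ : ℝ} (hd : ‖y - y₀‖ ≤ ρ) :
    |dtt u s y| ≤ (ν * d * S' + W) * ρ ^ γ := by
  have h1 := h.ctrl.dtt_space h.hν hs hS' hy (frontier_subset_closure hy₀)
  rw [h.ctrl.sol.dtt_eq_zero hs hy₀, sub_zero] at h1
  refine h1.trans (mul_le_mul_of_nonneg_left (Real.rpow_le_rpow (norm_nonneg _) hd h.hγ.1.le) ?_)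
  have := h.hν
  have := h.ctrl.W_pos
  positivity

lemma rpow_five_le (h : BdrySetup γ ν K D r M a u f S W t₁ x₀ ψ e q) {ℓ : ℝ} (hℓ : 0 ≤ ℓ) :
    (5 * ℓ) ^ γ ≤ 5 * ℓ ^ γ := by
  rw [Real.mul_rpow (by norm_num) hℓ]
  have : (5:ℝ) ^ γ ≤ 5 ^ (1:ℝ) := Real.rpow_le_rpow_of_exponent_le (by norm_num) h.hγ.2.le
  rw [Real.rpow_one] at this
  gcongr

set_option maxHeartbeats 1000000 in
/-- Smallness of the time derivative near the boundary, with explicit constants. -/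
lemma dtt_le (h : BdrySetup γ ν K D r M a u f S W t₁ x₀ ψ e q) (hK : 0 ≤ K)
    {σ L ε S₀ : ℝ} (hσ : 0 < σ) (hL : 50 ≤ L) (hε : 0 < ε) (hε1 : ε ≤ 1)
    (hℓM : 32 * M * (L * σ) ≤ 1) (hℓr : 6 * (L * σ) < r)
    (hμ : 64 * M * L ^ 2 * σ ≤ ε) (hS₀ : 0 ≤ S₀)
    (hinit : a + (L * σ) ^ 2 / ν ≤ t₁ ∨ HolAt γ D (u a) S₀) {c : ℝ} (hc : |c| = 1) {p : Euc d}
    (hp : p ∈ D) (hpσ : ‖p - x₀‖ ≤ 40 * σ) :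
    c * dtt u t₁ p ≤ ((K * (S + W) + (ν * d * S + W)) * ε ^ γ + (((ν * d * S + W) * ε ^ γ +
      5 * (ν * d * S₀ + W) * L ^ γ + K * (S + W) * ε ^ γ) +
      (d + 1) * ((5 * (ν * d * S + W)) * L ^ γ +
        2 * W * L ^ γ * L ^ 2 / (ν * ε ^ 2)) * (50 / L))) * σ ^ γ := by
  have hγ := h.hγ.1
  have hM := h.hM
  have hW := h.ctrl.W_pos
  have hS := h.ctrl.S_pos
  have hν := h.hν
  have he := h.chart.norm_e
  set ℓ := L * σ with hℓd
  have hℓ : 0 < ℓ := by positivity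
  set η := ε * σ with hηd
  have hη : 0 < η := by positivity
  have hσℓ : 50 * σ ≤ ℓ := by rw [hℓd]; nlinarith
  have hησ : η ≤ σ := by rw [hηd]; nlinarith
  set xc := faceCentre M x₀ e ℓ with hxc
  have hμσ : 64 * M * ℓ ^ 2 ≤ η := by
    rw [hℓd, hηd]
    calc 64 * M * (L * σ) ^ 2 = 64 * M * L ^ 2 * σ * σ := by ring
      _ ≤ ε * σ := by gcongr
  set p' := p + (64 * M * ℓ ^ 2) • e with hp'd
  obtain ⟨hp'n, hp'0⟩ : ‖p' - xc‖ ≤ 50 * σ ∧ 0 ≤ inner ℝ e (p' - xc) :=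
    h.chart.shift_mem_halfBall h.hM hσ hσℓ hℓr (by linarith) hp hpσ
  set b := inner ℝ e (p' - xc) with hb
  obtain ⟨hm0, hmn, hbn, hmi⟩ := projection_props (p := p') (xc := xc) he
  rw [← hb] at hm0 hmn hbn hmi
  rw [abs_of_nonneg hp'0] at hbn
  set m := p' - b • e with hm
  have hin : ∀ y, ‖y - m‖ ≤ ℓ → 0 ≤ inner ℝ e (y - m) → y ∈ D ∧ ‖y - x₀‖ ≤ 5 * ℓ :=
    fun y h1 h2 => by
      refine h.chart.mem_of_halfBall h.hM hℓ hℓM hℓr ?_ ((hmi y).symm ▸ h2 :)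
      have := norm_add_le (y - m) (m - xc)
      rw [sub_add_sub_cancel] at this
      exact this.trans (by linarith)
  have hx₀ := h.hx₀
  have hητ : ∀ s : ℝ, s ∈ Icc 0 (η ^ 2) → |s| ^ (γ / 2) ≤ η ^ γ := fun s hs => by
    rw [abs_of_nonneg hs.1]
    refine (Real.rpow_le_rpow hs.1 hs.2 (by positivity)).trans (le_of_eq ?_)
    rw [← Real.rpow_natCast, ← Real.rpow_mul hη.le]
    congr 1
    push_cast
    ring
  have e5 := h.rpow_five_le hℓ.le
  have hcl : ∀ x : ℝ, c * x ≤ |x| := fun x => by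
    refine (le_abs_self _).trans ?_
    rw [abs_mul, hc, one_mul]
  have hη2 : 0 < η ^ 2 := by positivity
  have hmain := halfBall_window (a := a) (t₁ := t₁) (κ := η ^ 2 * ((ν * d * S + W) * η ^ γ))
    (B₀ := η ^ 2 * (5 * (ν * d * S₀ + W) * ℓ ^ γ + K * (S + W) * η ^ γ))
    (Z := η ^ 2 * (5 * (ν * d * S + W) * ℓ ^ γ))
    (G := 2 * (W * ℓ ^ γ)) (n := e) (xc := m)
    (z := fun s y => c * (u (s + η ^ 2) y - u s y))
    hν hℓ h.ht₁ (by positivity) (by positivity) (by positivity) (by positivity) he ?_ ?_ ?_ ?_ ?_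
    (b := b) hp'0 (by linarith)
  · have hmb : m + b • e = p' := by rw [hm]; abel
    have hpm : ‖p' - m‖ ≤ ℓ := by
      rw [hm, sub_sub_cancel, norm_smul, he, Real.norm_eq_abs, abs_of_nonneg hp'0]; linarith
    have hpi : 0 ≤ inner ℝ e (p' - m) := by rw [hmi]; exact hp'0
    rw [hmb] at hmain
    obtain ⟨hpD, hpx⟩ := hin p' hpm hpi
    obtain ⟨s', hs', e1⟩ := h.ctrl.sol.exists_time_diff_eq h.ht₁ hη2 (subset_closure hpD)
    simp only [e1] at hmain
    have hpp : ‖p - p'‖ ≤ η := by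
      rw [hp'd, sub_add_cancel_left, norm_neg, norm_smul, he, Real.norm_eq_abs,
        abs_of_nonneg (by positivity)]
      linarith
    have d1 := h.ctrl.dtt_space hν h.ht₁ (h.ctrl.hol2 t₁ h.ht₁) (subset_closure hp)
      (subset_closure hpD)
    have d2 := h.ctrl.dtt_time t₁ h.ht₁ s' (h.ht₁.trans hs'.1) p' (subset_closure hpD)
    rw [abs_sub_comm t₁] at d2
    have k1 : (ν * d * S + W) * ‖p - p'‖ ^ γ ≤ (ν * d * S + W) * η ^ γ :=
      mul_le_mul_of_nonneg_left (Real.rpow_le_rpow (norm_nonneg _) hpp hγ.le) (by positivity)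
    have k2 : K * (S + W) * |s' - t₁| ^ (γ / 2) ≤ K * (S + W) * η ^ γ :=
      mul_le_mul_of_nonneg_left (hητ _ ⟨by linarith [hs'.1], by linarith [hs'.2]⟩) (by positivity)
    have k3 := hcl (dtt u t₁ p - dtt u t₁ p')
    have k4 := hcl (dtt u t₁ p' - dtt u s' p')
    have eη : η ^ γ = ε ^ γ * σ ^ γ := Real.mul_rpow hε.le hσ.le
    have eℓ : ℓ ^ γ = L ^ γ * σ ^ γ := Real.mul_rpow (by linarith) hσ.le
    have hLγ : 0 < L ^ γ := by positivity
    have hm2 := window_algebra (X := c * dtt u s' p') (κ := 0) (P := 5 * (ν * d * S + W)) (Q := W)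
      (P₀ := ((ν * d * S + W) * ε ^ γ +
      5 * (ν * d * S₀ + W) * L ^ γ + K * (S + W) * ε ^ γ) / L ^ γ) (m := d + 1) (b := b)
      hγ.le h.hγ.2.le hν hσ (by nlinarith [h.hr2]) (by positivity : 0 < L) hε le_rfl (by positivity)
      (by positivity) (by positivity) (by linarith) (by
        refine (le_of_eq (by ring)).trans (hmain.trans (le_of_eq ?_))
        rw [← hℓd, ← hηd, eη, eℓ]
        field_simp
        ring)
    rw [div_mul_cancel₀ _ hLγ.ne'] at hm2
    rw [eη] at k1 k2
    have hm3 : c * dtt u t₁ p ≤ c * dtt u s' p' + (ν * d * S + W) * (ε ^ γ * σ ^ γ) +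
        K * (S + W) * (ε ^ γ * σ ^ γ) := by
      have : c * dtt u t₁ p = c * dtt u s' p' + c * (dtt u t₁ p - dtt u t₁ p') +
        c * (dtt u t₁ p' - dtt u s' p') := by ring
      linarith
    refine hm3.trans ((add_le_add (add_le_add hm2 le_rfl) le_rfl).trans (le_of_eq ?_))
    ring
  · have h1 := h.ctrl.sol.cont.comp_shift (H := {x : Euc d | ‖x - m‖ ≤ ℓ ∧ 0 ≤ inner ℝ e (x - m)})
      hη2.le continuous_id (fun y hy => subset_closure (hin y hy.1 hy.2).1)
    have h2 := h.ctrl.sol.cont.comp_shift (H := {x : Euc d | ‖x - m‖ ≤ ℓ ∧ 0 ≤ inner ℝ e (x - m)})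
      le_rfl continuous_id (fun y hy => subset_closure (hin y hy.1 hy.2).1)
    simp only [add_zero] at h2
    exact continuousOn_const.mul (h1.sub h2)
  · intro s hs _ y hy hy0
    obtain ⟨hyD, -⟩ := hin y hy.le hy0.le
    have hs2 : a ≤ s + η ^ 2 := by linarith
    have H1 := h.ctrl.heatAt hγ h.open_ hs2 hyD
    rw [← add_zero y] at H1
    have H1' := H1.translate
    simp only [add_zero] at H1'
    refine ⟨_, ?_, (H1'.sub (h.ctrl.heatAt hγ h.open_ hs hyD)).const_mul c⟩
    refine (hcl _).trans ((h.ctrl.f_time _ hs2 s hs y (subset_closure hyD)).trans ?_)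
    rw [add_sub_cancel_left]
    have := hητ (η ^ 2) ⟨hη2.le, le_rfl⟩
    have h3 : η ^ γ ≤ ℓ ^ γ := Real.rpow_le_rpow hη.le (by linarith) hγ.le
    have h4 : W * |η ^ 2| ^ (γ / 2) ≤ W * ℓ ^ γ := by gcongr; linarith
    have : 0 < W * ℓ ^ γ := by positivity
    linarith
  · intro s hs _ y hy hy0
    obtain ⟨hyD, hyx⟩ := hin y hy hy0
    obtain ⟨s', hs', e1⟩ := h.ctrl.sol.exists_time_diff_eq hs hη2 (subset_closure hyD)
    simp only [e1]
    refine (hcl _).trans ?_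
    rw [abs_mul, abs_of_pos hη2]
    refine mul_le_mul_of_nonneg_left ?_ hη2.le
    refine (h.abs_dtt_le (hs.trans hs'.1) hS.le (h.ctrl.hol2 s' (hs.trans hs'.1))
      (subset_closure hyD) hx₀ hyx).trans ?_
    calc _ ≤ (ν * d * S + W) * (5 * ℓ ^ γ) := mul_le_mul_of_nonneg_left e5 (by positivity)
      _ = _ := by ring
  · intro s hs _ y hy hy0
    obtain ⟨hyD, hyx⟩ := hin y hy hy0.ge
    obtain ⟨s', hs', e1⟩ := h.ctrl.sol.exists_time_diff_eq hs hη2 (subset_closure hyD)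
    simp only [e1]
    refine (hcl _).trans ?_
    rw [abs_mul, abs_of_pos hη2]
    refine mul_le_mul_of_nonneg_left ?_ hη2.le
    obtain ⟨hy'D, hy'n⟩ := h.chart.notMem_of_face (p := y) h.hM hℓ hℓM hℓr (by
      have := norm_add_le (y - m) (m - xc)
      rw [sub_add_sub_cancel] at this
      exact this.trans (by linarith)) ((hmi y).symm.trans hy0)
    obtain ⟨y₀, hy₀, hd, -⟩ := exists_frontier_dist_le h.open_ hyD hy'D
    refine h.abs_dtt_le (hs.trans hs'.1) hS.le (h.ctrl.hol2 s' (hs.trans hs'.1))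
      (subset_closure hyD) hy₀ (hd.trans ?_)
    rw [sub_sub_cancel, norm_smul, he, Real.norm_eq_abs, abs_of_pos (by positivity)]
    linarith
  · refine hinit.imp_right fun hh _ y hy hy0 => ?_
    obtain ⟨hyD, hyx⟩ := hin y hy hy0
    obtain ⟨s', hs', e1⟩ := h.ctrl.sol.exists_time_diff_eq le_rfl hη2 (subset_closure hyD)
    simp only [e1]
    refine (hcl _).trans ?_
    rw [abs_mul, abs_of_pos hη2]
    refine mul_le_mul_of_nonneg_left ?_ hη2.le
    have d1 := h.abs_dtt_le le_rfl hS₀ hh (subset_closure hyD) hx₀ hyx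
    have d2 := h.ctrl.dtt_time s' hs'.1 a le_rfl y (subset_closure hyD)
    have k2 : K * (S + W) * |s' - a| ^ (γ / 2) ≤ K * (S + W) * η ^ γ :=
      mul_le_mul_of_nonneg_left (hητ _ ⟨by linarith [hs'.1], by linarith [hs'.2]⟩) (by positivity)
    have k3 : (ν * d * S₀ + W) * (5 * ℓ) ^ γ ≤ (ν * d * S₀ + W) * (5 * ℓ ^ γ) :=
      mul_le_mul_of_nonneg_left e5 (by positivity)
    have k4 : |dtt u s' y| ≤ |dtt u s' y - dtt u a y| + |dtt u a y| := by
      simpa using abs_add_le (dtt u s' y - dtt u a y) (dtt u a y)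
    linarith

end BdrySetup

end

section
variable {d : ℕ}

lemma exists_small_params {γ : ℝ} (hγ : γ ∈ Ioo (0:ℝ) 1) {θ : ℝ} (hθ : 0 < θ) :
    ∃ ε, 0 < ε ∧ ε ≤ 1 ∧ (3 * ε) ^ γ ≤ θ ∧ ∃ L, 50 ≤ L ∧ L ^ γ * (50 / L) ≤ θ := by
  have h1 : Tendsto (fun ε : ℝ => (3 * ε) ^ γ) (𝓝[>] 0) (𝓝 0) := by
    have : ContinuousAt (fun ε : ℝ => (3 * ε) ^ γ) 0 :=
      ContinuousAt.rpow_const (by fun_prop) (Or.inr hγ.1.le)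
    have h := this.tendsto
    simp only [mul_zero, Real.zero_rpow hγ.1.ne'] at h
    exact h.mono_left nhdsWithin_le_nhds
  have h2 : Tendsto (fun L : ℝ => L ^ γ * (50 / L)) atTop (𝓝 0) := by
    have h := (tendsto_rpow_neg_atTop (y := 1 - γ) (by linarith [hγ.2])).const_mul 50
    rw [mul_zero] at h
    refine h.congr' ?_
    filter_upwards [eventually_gt_atTop 0] with L hL
    rw [neg_sub, Real.rpow_sub_one hL.ne']
    ring
  obtain ⟨ε, h5, h3, h4⟩ := ((h1.eventually (ge_mem_nhds hθ)).and
    (Ioo_mem_nhdsGT (zero_lt_one' ℝ) : ∀ᶠ ε in 𝓝[>] (0:ℝ), ε ∈ Ioo (0:ℝ) 1)).exists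
  obtain ⟨L, h6, h7⟩ := ((h2.eventually (ge_mem_nhds hθ)).and (eventually_ge_atTop 50)).exists
  exact ⟨ε, h3, h4.le, h5, L, h7, h6⟩

/-- The bounds of the tangential second differentials and of the time derivative near a boundary
point, with small constant in front of the top-order quantity. -/
theorem exists_tangential_bound (d : ℕ) {γ ν K M r : ℝ} (hγ : γ ∈ Ioo (0:ℝ) 1) (hν : 0 < ν)
    (hK : 0 ≤ K) (hM : 1 ≤ M) (hr : 0 < r) {θ : ℝ} (hθ : 0 < θ) :
    ∃ C ≥ 0, ∃ σ₀ > 0, σ₀ ≤ 1 ∧ ∀ (D : Set (Euc d)) (a : ℝ) (u f : ℝ → Euc d → ℝ) (S W t₁ : ℝ)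
      (x₀ : Euc d) (ψ : Euc d → ℝ) (e : Euc d) (q : ℝ), BdrySetup γ ν K D r M a u f S W t₁ x₀ ψ e q →
      ∀ S₀ ≥ 0, ∀ δ, 0 < δ → δ ≤ 1 → ∀ σ, 0 < σ → σ ≤ σ₀ * δ →
      (a + δ ^ 2 ≤ t₁ ∨ HolAt γ D (u a) S₀) → ∀ p ∈ D, ‖p - x₀‖ ≤ 40 * σ →
      (∀ v w, ‖v‖ = 1 → ‖w‖ = 1 → inner ℝ e v = 0 → inner ℝ e w = 0 →
        |flatten2 q ψ u t₁ p w v| ≤ (θ * S + C * (W + S₀)) * σ ^ γ) ∧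
      |dtt u t₁ p| ≤ (θ * S + C * (W + S₀)) * σ ^ γ := by
  set Q : ℝ := 1 + 6 * (d + 1) + (2 * K + 2 * ν * d + (d + 1) * (5 * ν * d)) with hQ
  have hQ0 : 0 < Q := by positivity
  obtain ⟨ε, hε, hε1, hεθ, L, hL, hLθ⟩ := exists_small_params hγ (θ := θ / Q) (by positivity)
  have hL0 : 0 < L := by linarith
  have hg : 0 < BdrySetup.gradConst ν M := by unfold BdrySetup.gradConst; positivity
  have hT : 0 < BdrySetup.tangConst ν M := by unfold BdrySetup.tangConst; positivity
  have hM0 : 0 < M := by linarith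
  set T := BdrySetup.tangConst ν M
  set g := BdrySetup.gradConst ν M
  set C₁ : ℝ := M * (3 * ε) ^ γ + 256 * M * g * L ^ 3 / ε ^ 2 + T * L ^ γ +
    (d + 1) * (T * L ^ γ + 2 * (1 + ν * d * M) * L ^ γ * L ^ 2 / (ν * ε ^ 2)) * (50 / L) + 6 * L ^ γ
    with hC₁
  set C₂ : ℝ := (2 * K + 2) * ε ^ γ + 5 * L ^ γ + 5 * (ν * d) * L ^ γ +
    (d + 1) * (5 * L ^ γ + 2 * L ^ γ * L ^ 2 / (ν * ε ^ 2)) * (50 / L) with hC₂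
  have hC₁0 : 0 ≤ C₁ := by positivity
  have hC₂0 : 0 ≤ C₂ := by positivity
  set σ₀ : ℝ := min 1 (min (√ν / L) (min (1 / (32 * M * L)) (min (r / (7 * L)) (ε / (64 * M * L ^ 2)))))
    with hσ₀
  refine ⟨C₁ + C₂, by positivity, σ₀, by positivity, min_le_left _ _, ?_⟩
  intro D a u f S W t₁ x₀ ψ e q h S₀ hS₀ δ hδ hδ1 σ hσ hσδ hinit p hp hpσ
  have hS := h.ctrl.S_pos
  have hW := h.ctrl.W_pos
  have hσ₀0 : 0 < σ₀ := by positivity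
  have hσσ : σ ≤ σ₀ := hσδ.trans (mul_le_of_le_one_right hσ₀0.le hδ1)
  have b1 : σ₀ ≤ √ν / L := (min_le_right _ _).trans (min_le_left _ _)
  have b2 : σ₀ ≤ 1 / (32 * M * L) :=
    (min_le_right _ _).trans ((min_le_right _ _).trans (min_le_left _ _))
  have b3 : σ₀ ≤ r / (7 * L) := (min_le_right _ _).trans
    ((min_le_right _ _).trans ((min_le_right _ _).trans (min_le_left _ _)))
  have b4 : σ₀ ≤ ε / (64 * M * L ^ 2) := (min_le_right _ _).trans
    ((min_le_right _ _).trans ((min_le_right _ _).trans (min_le_right _ _)))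
  have hinit' : a + (L * σ) ^ 2 / ν ≤ t₁ ∨ HolAt γ D (u a) S₀ := by
    refine hinit.imp_left fun hi => ?_
    have e1 : L * σ ≤ √ν * δ := by
      have : σ ≤ √ν / L * δ := hσδ.trans (by gcongr)
      calc L * σ ≤ L * (√ν / L * δ) := by gcongr
        _ = √ν * δ := by field_simp
    have e2 : (L * σ) ^ 2 ≤ ν * δ ^ 2 := by
      calc (L * σ) ^ 2 ≤ (√ν * δ) ^ 2 := by gcongr
        _ = ν * δ ^ 2 := by rw [mul_pow, Real.sq_sqrt hν.le]
    have e3 : (L * σ) ^ 2 / ν ≤ δ ^ 2 := by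
      rw [div_le_iff₀ hν]; linarith
    linarith
  have hℓM : 32 * M * (L * σ) ≤ 1 := by
    have := hσσ.trans b2
    rw [le_div_iff₀ (by positivity)] at this
    linarith
  have hℓr : 6 * (L * σ) < r := by
    have := hσσ.trans b3
    rw [le_div_iff₀ (by positivity)] at this
    have : 0 < L * σ := by positivity
    linarith
  have hμ : 64 * M * L ^ 2 * σ ≤ ε := by
    have := hσσ.trans b4
    rw [le_div_iff₀ (by positivity)] at this
    linarith
  have hεθ' : ε ^ γ ≤ θ / Q :=
    (Real.rpow_le_rpow hε.le (by linarith) hγ.1.le).trans hεθ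
  have hQθ : Q * (θ / Q) = θ := by field_simp
  set τ := θ / Q
  have hτ : 0 < τ := by positivity
  have hd : (0:ℝ) ≤ d := Nat.cast_nonneg d
  have hσγ : 0 ≤ σ ^ γ := by positivity
  constructor
  · intro v w hv hw hve hwe
    have hX : (S + M * W) * (3 * ε) ^ γ + 256 * M * g * W * L ^ 3 / ε ^ 2 + (6 * S₀ + T * W) * L ^ γ +
      (d + 1) * ((6 * S + T * W) * L ^ γ + 2 * ((1 + ν * d * M) * W) * L ^ γ * L ^ 2 / (ν * ε ^ 2)) *
        (50 / L) ≤ θ * S + (C₁ + C₂) * (W + S₀) := by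
      have e1 : (S + M * W) * (3 * ε) ^ γ + 256 * M * g * W * L ^ 3 / ε ^ 2 +
        (6 * S₀ + T * W) * L ^ γ + (d + 1) * ((6 * S + T * W) * L ^ γ +
          2 * ((1 + ν * d * M) * W) * L ^ γ * L ^ 2 / (ν * ε ^ 2)) * (50 / L) =
        S * ((3 * ε) ^ γ) + 6 * (d + 1) * S * (L ^ γ * (50 / L)) + C₁ * W + 6 * L ^ γ * S₀ -
          6 * L ^ γ * W := by
        rw [hC₁]; ring
      have e2 : S * (3 * ε) ^ γ ≤ S * τ := by gcongr
      have e3 : 6 * (d + 1) * S * (L ^ γ * (50 / L)) ≤ 6 * (d + 1) * S * τ := by gcongr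
      have e4 : 6 * L ^ γ * S₀ ≤ C₁ * S₀ := by
        gcongr
        have : C₁ - 6 * L ^ γ = M * (3 * ε) ^ γ + 256 * M * g * L ^ 3 / ε ^ 2 + T * L ^ γ +
          (d + 1) * (T * L ^ γ + 2 * (1 + ν * d * M) * L ^ γ * L ^ 2 / (ν * ε ^ 2)) * (50 / L) := by
          rw [hC₁]; ring
        have : 0 ≤ C₁ - 6 * L ^ γ := by rw [this]; positivity
        linarith
      have e5 : 0 ≤ 6 * L ^ γ * W := by positivity
      have e6 : 0 ≤ C₂ * (W + S₀) := by positivity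
      have e7 : S * τ + 6 * (d + 1) * S * τ ≤ θ * S := by
        have : (1 + 6 * (d + 1)) * τ ≤ Q * τ := by
          gcongr
          rw [hQ]
          have : 0 ≤ 2 * K + 2 * ν * d + (d + 1) * (5 * ν * d) := by positivity
          linarith
        have := mul_le_mul_of_nonneg_left this hS.le
        rw [hQθ] at this
        linarith
      rw [e1]
      linarith
    have key : ∀ w, ‖w‖ = 1 → inner ℝ e w = 0 →
        flatten2 q ψ u t₁ p w v ≤ (θ * S + (C₁ + C₂) * (W + S₀)) * σ ^ γ := fun w hw hwe =>
      (h.flatten2_tangential_le hσ hL hε hε1 hℓM hℓr hμ hS₀ hinit' hv hw hve hwe hp hpσ).trans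
        (mul_le_mul_of_nonneg_right hX hσγ)
    refine abs_le.2 ⟨?_, key w hw hwe⟩
    have := key (-w) (by rwa [norm_neg]) (by rw [inner_neg_right, hwe, neg_zero])
    rw [map_neg, neg_apply] at this
    linarith
  · have hX : (K * (S + W) + (ν * d * S + W)) * ε ^ γ + (((ν * d * S + W) * ε ^ γ +
        5 * (ν * d * S₀ + W) * L ^ γ + K * (S + W) * ε ^ γ) + (d + 1) * ((5 * (ν * d * S + W)) * L ^ γ +
        2 * W * L ^ γ * L ^ 2 / (ν * ε ^ 2)) * (50 / L)) ≤ θ * S + (C₁ + C₂) * (W + S₀) := by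
      have e1 : (K * (S + W) + (ν * d * S + W)) * ε ^ γ + (((ν * d * S + W) * ε ^ γ +
        5 * (ν * d * S₀ + W) * L ^ γ + K * (S + W) * ε ^ γ) + (d + 1) * ((5 * (ν * d * S + W)) * L ^ γ +
        2 * W * L ^ γ * L ^ 2 / (ν * ε ^ 2)) * (50 / L)) =
        (2 * K + 2 * ν * d) * S * ε ^ γ + (d + 1) * (5 * ν * d) * S * (L ^ γ * (50 / L)) + C₂ * W +
          5 * (ν * d) * L ^ γ * S₀ - 5 * (ν * d) * L ^ γ * W := by
        rw [hC₂]; ring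
      have e2 : (2 * K + 2 * ν * d) * S * ε ^ γ ≤ (2 * K + 2 * ν * d) * S * τ := by gcongr
      have e3 : (d + 1) * (5 * ν * d) * S * (L ^ γ * (50 / L)) ≤ (d + 1) * (5 * ν * d) * S * τ := by
        gcongr
      have e4 : 5 * (ν * d) * L ^ γ * S₀ ≤ C₂ * S₀ := by
        gcongr
        have : C₂ - 5 * (ν * d) * L ^ γ = (2 * K + 2) * ε ^ γ + 5 * L ^ γ +
          (d + 1) * (5 * L ^ γ + 2 * L ^ γ * L ^ 2 / (ν * ε ^ 2)) * (50 / L) := by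
          rw [hC₂]; ring
        have : 0 ≤ C₂ - 5 * (ν * d) * L ^ γ := by rw [this]; positivity
        linarith
      have e5 : 0 ≤ 5 * (ν * d) * L ^ γ * W := by positivity
      have e6 : 0 ≤ C₁ * (W + S₀) := by positivity
      have e7 : (2 * K + 2 * ν * d) * S * τ + (d + 1) * (5 * ν * d) * S * τ ≤ θ * S := by
        have : (2 * K + 2 * ν * d + (d + 1) * (5 * ν * d)) * τ ≤ Q * τ := by
          gcongr
          rw [hQ]
          linarith
        have := mul_le_mul_of_nonneg_left this hS.le
        rw [hQθ] at this
        linarith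
      rw [e1]
      linarith
    have key : ∀ c : ℝ, |c| = 1 → c * dtt u t₁ p ≤ (θ * S + (C₁ + C₂) * (W + S₀)) * σ ^ γ := fun c hc =>
      (h.dtt_le hK hσ hL hε hε1 hℓM hℓr hμ hS₀ hinit' hc hp hpσ).trans
        (mul_le_mul_of_nonneg_right hX hσγ)
    have k1 := key 1 (by simp)
    have k2 := key (-1) (by simp)
    exact abs_le.2 ⟨by linarith, by linarith⟩

/-- Interior oscillation of the second differential, with small constant in front of the
top-order quantity. -/
theorem exists_interior_bound (d : ℕ) {γ ν K : ℝ} (hγ : γ ∈ Ioo (0:ℝ) 1) (hν : 0 < ν)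
    {θ : ℝ} (hθ : 0 < θ) :
    ∃ C ≥ 0, ∃ ρ₀ > 0, ∃ Λ ≥ 1, ∀ (D : Set (Euc d)) (a : ℝ) (u f : ℝ → Euc d → ℝ) (S W t : ℝ),
      Ctrl γ ν K D a u f S W → IsOpen D → a ≤ t →
      ∀ S₀ ≥ 0, ∀ δ, 0 < δ → δ ≤ 1 → (a + δ ^ 2 ≤ t ∨ HolAt γ D (u a) S₀) →
      ∀ x y, x ≠ y → ‖x - y‖ ≤ ρ₀ * δ → (∀ p, ‖p - x‖ ≤ Λ * ‖x - y‖ → p ∈ D) →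
      ∀ v w, |dx2 (u t) x v w - dx2 (u t) y v w| ≤
        (θ * S + C * (W + S₀)) * ‖x - y‖ ^ γ * ‖v‖ * ‖w‖ := by
  set Q : ℝ := 2 + 3 * (d + 1) with hQ
  have hQ0 : 0 < Q := by positivity
  obtain ⟨ε, hε, hε1, hεθ, L, hL, hLθ⟩ := exists_small_params hγ (θ := θ / Q) (by positivity)
  have hL0 : 0 < L := by linarith
  set C : ℝ := (3 * L) ^ γ + (d + 1) * (4 * (2 * L) ^ γ * L ^ 2 / (ν * ε ^ 2)) * (1 / (2 * L)) with hC
  have hC0 : 0 ≤ C := by positivity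
  refine ⟨C, hC0, √ν / L, by positivity, 2 * L + 1, by linarith, ?_⟩
  intro D a u f S W t h hD ht S₀ hS₀ δ hδ hδ1 hinit x y hxy hρδ hball v w
  have hS := h.S_pos
  have hW := h.W_pos
  set ρ := ‖x - y‖ with hρdef
  have hρ : 0 < ρ := norm_pos_iff.2 (sub_ne_zero.2 hxy)
  have hQθ : Q * (θ / Q) = θ := by field_simp
  set τ := θ / Q
  have hτ : 0 < τ := by positivity
  have hinit' : a + (L * ρ) ^ 2 / ν ≤ t ∨ HolAt γ D (u a) S₀ := by
    refine hinit.imp_left fun hi => ?_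
    have e1 : L * ρ ≤ √ν * δ := by
      calc L * ρ ≤ L * (√ν / L * δ) := by gcongr
        _ = √ν * δ := by field_simp
    have e2 : (L * ρ) ^ 2 ≤ ν * δ ^ 2 := by
      calc (L * ρ) ^ 2 ≤ (√ν * δ) ^ 2 := by gcongr
        _ = ν * δ ^ 2 := by rw [mul_pow, Real.sq_sqrt hν.le]
    have e3 : (L * ρ) ^ 2 / ν ≤ δ ^ 2 := by
      rw [div_le_iff₀ hν]; linarith
    linarith
  have hX : S * (2 * (2 * ε) ^ γ) + S₀ * (3 * L) ^ γ +
        (d + 1) * (S * (3 * L) ^ γ + 4 * W * (2 * L) ^ γ * L ^ 2 / (ν * ε ^ 2)) * (1 / (2 * L)) ≤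
      θ * S + C * (W + S₀) := by
    have e1 : S * (2 * (2 * ε) ^ γ) + S₀ * (3 * L) ^ γ +
        (d + 1) * (S * (3 * L) ^ γ + 4 * W * (2 * L) ^ γ * L ^ 2 / (ν * ε ^ 2)) * (1 / (2 * L)) =
      2 * S * (2 * ε) ^ γ + (d + 1) * S * ((3 * L) ^ γ * (1 / (2 * L))) + C * W + (3 * L) ^ γ * S₀ -
        (3 * L) ^ γ * W := by
      rw [hC]; ring
    have e2 : 2 * S * (2 * ε) ^ γ ≤ 2 * S * τ := by
      gcongr
      exact (Real.rpow_le_rpow (by positivity) (by linarith) hγ.1.le).trans hεθ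
    have e3 : (3 * L) ^ γ * (1 / (2 * L)) ≤ 3 * τ := by
      have : (3:ℝ) ^ γ ≤ 3 := by
        simpa using Real.rpow_le_rpow_of_exponent_le (x := 3) (by norm_num) hγ.2.le
      rw [Real.mul_rpow (by norm_num) hL0.le]
      calc 3 ^ γ * L ^ γ * (1 / (2 * L)) ≤ 3 * L ^ γ * (1 / (2 * L)) := by gcongr
        _ = 3 / 100 * (L ^ γ * (50 / L)) := by field_simp; norm_num
        _ ≤ 3 / 100 * τ := by gcongr
        _ ≤ 3 * τ := by linarith
    have e4 : (d + 1) * S * ((3 * L) ^ γ * (1 / (2 * L))) ≤ (d + 1) * S * (3 * τ) := by gcongr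
    have e5 : (3 * L) ^ γ * S₀ ≤ C * S₀ := by
      gcongr
      rw [hC]
      have : 0 ≤ (d + 1) * (4 * (2 * L) ^ γ * L ^ 2 / (ν * ε ^ 2)) * (1 / (2 * L)) := by positivity
      linarith
    have e6 : 0 ≤ (3 * L) ^ γ * W := by positivity
    have e7 : 2 * S * τ + (d + 1) * S * (3 * τ) = θ * S := by
      rw [← hQθ, hQ]; ring
    rw [e1]
    linarith
  have hb : ∀ p, ‖p - (1 / 2 : ℝ) • (x + y)‖ ≤ 2 * (L * ρ) → p ∈ D := fun p hp => by
    refine hball p ?_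
    have e1 : p - x = (p - (1 / 2 : ℝ) • (x + y)) + (-(1 / 2) : ℝ) • (x - y) := by module
    rw [e1]
    refine (norm_add_le _ _).trans ?_
    rw [norm_smul, ← hρdef]
    rw [Real.norm_eq_abs, show |(-(1 / 2) : ℝ)| = 1 / 2 by norm_num]
    linarith
  have hn : ‖ρ⁻¹ • (x - y)‖ = 1 := by
    rw [norm_smul, norm_inv, norm_norm, ← hρdef, inv_mul_cancel₀ hρ.ne']
  have hxe : (1 / 2 : ℝ) • (x + y) + (ρ / 2) • ρ⁻¹ • (x - y) = x := by
    rw [smul_smul, show ρ / 2 * ρ⁻¹ = 1 / 2 by field_simp]; module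
  have hye : (1 / 2 : ℝ) • (x + y) - (ρ / 2) • ρ⁻¹ • (x - y) = y := by
    rw [smul_smul, show ρ / 2 * ρ⁻¹ = 1 / 2 by field_simp]; module
  have key : ∀ v w, ‖v‖ = 1 → ‖w‖ = 1 → dx2 (u t) x v w - dx2 (u t) y v w ≤
      (θ * S + C * (W + S₀)) * ρ ^ γ := fun v w hv hw => by
    have := h.interior_diff_le hγ hν hD ht hn hρ (by linarith : 4 ≤ L) hε hε1 hb hS₀ hinit' hw hv
    rw [hxe, hye] at this
    exact this.trans (mul_le_mul_of_nonneg_right hX (by positivity))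
  have := abs_bilin_le_of_unit (B := dx2 (u t) x - dx2 (u t) y) (K := (θ * S + C * (W + S₀)) * ρ ^ γ)
    (fun v w hv hw => ?_) v w
  · simpa using this
  · simp only [sub_apply]
    refine abs_le.2 ⟨?_, key v w hv hw⟩
    have := key (-v) w (by rwa [norm_neg]) hw
    simp only [map_neg, neg_apply] at this
    linarith

end

section
variable {d : ℕ}

lemma exists_isometry_map_ebasis {e : Euc d} (he : ‖e‖ = 1) (j : Fin d) :
    ∃ R : Euc d ≃ₗᵢ[ℝ] Euc d, R (ebasis d j) = e :=
  ⟨(ℝ ∙ (ebasis d j - e))ᗮ.reflection, Submodule.reflection_sub (by rw [norm_ebasis, he])⟩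

lemma abs_apply_self_le {B : Euc d →L[ℝ] Euc d →L[ℝ] ℝ} {e : Euc d} {K : ℝ} (he : ‖e‖ = 1)
    (hK : 0 ≤ K) (h : ∀ v, ‖v‖ = 1 → inner ℝ e v = 0 → |B v v| ≤ K) :
    |B e e| ≤ |∑ j, B (ebasis d j) (ebasis d j)| + d * K := by
  obtain ⟨j⟩ : Nonempty (Fin d) := by
    by_contra hj
    rw [not_nonempty_iff] at hj
    rw [Subsingleton.elim e 0, norm_zero] at he
    exact zero_ne_one he
  obtain ⟨R, hR⟩ := exists_isometry_map_ebasis he j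
  have h1 := HeatAt.trace_isometry R B
  rw [← Finset.add_sum_erase _ _ (Finset.mem_univ j), hR] at h1
  have h2 : |∑ i ∈ Finset.univ.erase j, B (R (ebasis d i)) (R (ebasis d i))| ≤ d * K := by
    refine (Finset.abs_sum_le_sum_abs _ _).trans ((Finset.sum_le_card_nsmul _ _ K ?_).trans ?_)
    · intro i hi
      refine h _ (by rw [R.norm_map, norm_ebasis]) ?_
      rw [← hR, R.inner_map_map]
      have hij : i ≠ j := Finset.ne_of_mem_erase hi
      simp [ebasis, EuclideanSpace.inner_single_left, hij.symm]
    · rw [nsmul_eq_mul]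
      gcongr
      exact (Finset.card_le_univ _).trans (by simp)
  have h3 : B e e = ∑ i, B (ebasis d i) (ebasis d i) -
    ∑ i ∈ Finset.univ.erase j, B (R (ebasis d i)) (R (ebasis d i)) := by linarith
  rw [h3]
  exact (abs_sub _ _).trans (by linarith)

lemma abs_le_of_split {L : Euc d →L[ℝ] ℝ} {e : Euc d} {K : ℝ} (he : ‖e‖ = 1) (h1 : |L e| ≤ K)
    (h2 : ∀ v, ‖v‖ = 1 → inner ℝ e v = 0 → |L v| ≤ K) (v : Euc d) : |L v| ≤ 2 * K * ‖v‖ := by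
  refine abs_le_of_unit (fun v hv => ?_) v
  set w := v - (inner ℝ e v) • e with hw
  have hwe : inner ℝ e w = 0 := by
    rw [hw, inner_sub_right, inner_smul_right, real_inner_self_eq_norm_sq, he]; ring
  have hK : 0 ≤ K := (abs_nonneg _).trans h1
  have hin : |inner ℝ e v| ≤ 1 := by
    have := abs_real_inner_le_norm e v
    rwa [he, hv, one_mul] at this
  have hwn : ‖w‖ ≤ 1 := by
    have e1 : ‖v‖ ^ 2 = ‖w‖ ^ 2 + (inner ℝ e v) ^ 2 := by
      have : v = w + (inner ℝ e v) • e := by rw [hw]; abel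
      conv_lhs => rw [this]
      rw [norm_add_sq_real, inner_smul_right, real_inner_comm e w, hwe, norm_smul, he, mul_one,
        Real.norm_eq_abs, sq_abs]
      ring
    rw [hv] at e1
    nlinarith [norm_nonneg w, sq_nonneg (inner ℝ e v : ℝ)]
  have h3 : |L w| ≤ K := by
    rcases eq_or_ne w 0 with h0 | h0
    · rw [h0]; simpa using hK
    · have hn : ‖w‖ ≠ 0 := norm_ne_zero_iff.2 h0
      have := h2 (‖w‖⁻¹ • w) (by rw [norm_smul, norm_inv, norm_norm, inv_mul_cancel₀ hn])
        (by rw [inner_smul_right, hwe, mul_zero])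
      rw [map_smul, smul_eq_mul, abs_mul, abs_inv, abs_norm, inv_mul_le_iff₀ (by positivity)] at this
      exact this.trans (mul_le_of_le_one_left hK hwn)
  have h4 : L v = L w + inner ℝ e v * L e := by
    rw [hw, map_sub, map_smul, smul_eq_mul]; ring
  rw [h4]
  refine (abs_add_le _ _).trans ?_
  rw [abs_mul]
  have := mul_le_mul hin h1 (abs_nonneg _) zero_le_one
  linarith

lemma abs_bilin_le_of_split {B : Euc d →L[ℝ] Euc d →L[ℝ] ℝ} {e : Euc d} {K : ℝ} (he : ‖e‖ = 1)
    (h1 : |B e e| ≤ K) (h2 : ∀ v, ‖v‖ = 1 → inner ℝ e v = 0 → |B e v| ≤ K)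
    (h3 : ∀ v, ‖v‖ = 1 → inner ℝ e v = 0 → |B v e| ≤ K)
    (h4 : ∀ v w, ‖v‖ = 1 → ‖w‖ = 1 → inner ℝ e v = 0 → inner ℝ e w = 0 → |B v w| ≤ K)
    (v w : Euc d) : |B v w| ≤ 4 * K * ‖v‖ * ‖w‖ := by
  have := abs_le_of_split (L := B.flip w) (e := e) (K := 2 * K * ‖w‖) he
    (abs_le_of_split (L := B e) he h1 h2 w)
    (fun v hv hve => abs_le_of_split (L := B v) he (h3 v hv hve)
      (fun w hw hwe => h4 v w hv hw hve hwe) w) v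
  rw [ContinuousLinearMap.flip_apply] at this
  linarith

lemma HasFDerivAt.apply_const {g1 : Euc d → Euc d →L[ℝ] ℝ} {B : Euc d →L[ℝ] Euc d →L[ℝ] ℝ}
    {y : Euc d} (h : HasFDerivAt g1 B y) (c : Euc d) :
    HasFDerivAt (fun y => g1 y c) (B.flip c) y := by
  simpa using h.clm_apply (hasFDerivAt_const c _)

/-- Comparing the increment of the gradient over a parallelogram along both sides. -/
lemma abs_bilin_diff_le {g1 : Euc d → Euc d →L[ℝ] ℝ} {g2 : Euc d → Euc d →L[ℝ] Euc d →L[ℝ] ℝ}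
    {x l k c : Euc d} {ω H : ℝ}
    (h : ∀ s ∈ Icc (0:ℝ) 1, ∀ r ∈ Icc (0:ℝ) 1,
      HasFDerivAt g1 (g2 (x + s • l + r • k)) (x + s • l + r • k))
    (hω : ∀ s ∈ Icc (0:ℝ) 1, |g2 (x + s • l + k) l c - g2 (x + s • l) l c| ≤ ω)
    (hH : ∀ s ∈ Icc (0:ℝ) 1, ∀ r ∈ Icc (0:ℝ) 1,
      |g2 (x + s • l + r • k) k c - g2 (x + s • l) k c| ≤ H) :
    |g2 (x + l) k c - g2 x k c| ≤ ω + 2 * H := by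
  have i0 : (0:ℝ) ∈ Icc (0:ℝ) 1 := by simp
  have i1 : (1:ℝ) ∈ Icc (0:ℝ) 1 := by simp
  have hk : ∀ s ∈ Icc (0:ℝ) 1, |g1 (x + s • l + k) c - g1 (x + s • l) c - g2 (x + s • l) k c| ≤ H :=
    fun s hs => by
      obtain ⟨r, hr, he⟩ := exists_diff_eq_fderiv (g := fun y => g1 y c)
        (g1 := fun y => (g2 y).flip c) (x := x + s • l) (h := k)
        (fun r hr => HasFDerivAt.apply_const (h s hs r hr) c)
      have he' : g1 (x + s • l + k) c - g1 (x + s • l) c = g2 (x + s • l + r • k) k c := he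
      rw [he']
      exact hH s hs r hr
  have hl : |(g1 (x + l + k) c - g1 (x + l) c) - (g1 (x + k) c - g1 x c)| ≤ ω := by
    obtain ⟨s, hs, he⟩ := exists_diff_eq_fderiv (g := fun y => g1 (y + k) c - g1 y c)
        (g1 := fun y => (g2 (y + k)).flip c - (g2 y).flip c) (x := x) (h := l)
        (fun s hs => by
          have a1 := h s hs 1 i1
          have a0 := h s hs 0 i0
          rw [one_smul] at a1
          rw [zero_smul, add_zero] at a0
          exact (HasFDerivAt.apply_const ((hasFDerivAt_comp_add_right k).2 a1) c).sub
            (HasFDerivAt.apply_const a0 c))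
    have he' : (g1 (x + l + k) c - g1 (x + l) c) - (g1 (x + k) c - g1 x c) =
      g2 (x + s • l + k) l c - g2 (x + s • l) l c := he
    rw [he']
    exact hω s hs
  have a1 := hk 1 i1
  have a0 := hk 0 i0
  rw [one_smul] at a1
  rw [zero_smul, add_zero] at a0
  have e1 : g2 (x + l) k c - g2 x k c = ((g1 (x + l + k) c - g1 (x + l) c) - (g1 (x + k) c - g1 x c))
    - (g1 (x + l + k) c - g1 (x + l) c - g2 (x + l) k c) +
      (g1 (x + k) c - g1 x c - g2 x k c) := by ring
  rw [e1]
  refine (abs_add_le _ _).trans ?_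
  have := abs_sub ((g1 (x + l + k) c - g1 (x + l) c) - (g1 (x + k) c - g1 x c))
    (g1 (x + l + k) c - g1 (x + l) c - g2 (x + l) k c)
  linarith

end

section
variable {d : ℕ}

namespace BdrySetup

variable {γ ν K : ℝ} {D : Set (Euc d)} {r M a : ℝ} {u f : ℝ → Euc d → ℝ} {S W t₁ : ℝ}
  {x₀ : Euc d} {ψ : Euc d → ℝ} {e : Euc d} {q : ℝ}

lemma flatten2_symm (h : BdrySetup γ ν K D r M a u f S W t₁ x₀ ψ e q) {p : Euc d} (hp : p ∈ D)
    (v w : Euc d) : flatten2 q ψ u t₁ p v w = flatten2 q ψ u t₁ p w v := by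
  refine second_derivative_symmetric_of_eventually (f := flatten q ψ u t₁)
    (f' := flatten1 q ψ u t₁) ?_ (h.hasFDerivAt₂ h.ht₁ (subset_closure hp)) v w
  filter_upwards [h.open_.mem_nhds hp] with y hy using h.hasFDerivAt h.ht₁ (subset_closure hy)

lemma sum_flatten2 (p : Euc d) : ∑ j, flatten2 q ψ u t₁ p (ebasis d j) (ebasis d j) =
    lapl (u t₁) p - q * lapl ψ p := by
  simp only [flatten2_apply, lapl, Finset.sum_sub_distrib, Finset.mul_sum]

/-- The equation controls the oscillation of the second normal differential. -/
lemma abs_flatten2_normal_sub_le (h : BdrySetup γ ν K D r M a u f S W t₁ x₀ ψ e q) {σ X : ℝ}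
    (hσr : 40 * σ < r) (hX : 0 ≤ X)
    (hTT : ∀ p ∈ D, ‖p - x₀‖ ≤ 40 * σ → ∀ v w, ‖v‖ = 1 → ‖w‖ = 1 → inner ℝ e v = 0 →
      inner ℝ e w = 0 → |flatten2 q ψ u t₁ p w v| ≤ X)
    (hdt : ∀ p ∈ D, ‖p - x₀‖ ≤ 40 * σ → |dtt u t₁ p| ≤ X)
    {p p' : Euc d} (hp : p ∈ D) (hp' : p' ∈ D) (hpσ : ‖p - x₀‖ ≤ 40 * σ)
    (hpσ' : ‖p' - x₀‖ ≤ 40 * σ) :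
    |flatten2 q ψ u t₁ p e e - flatten2 q ψ u t₁ p' e e| ≤
      (2 * X + W * (80 * σ) ^ γ) / ν + W * (d * (M * (80 * σ))) + d * (2 * X) := by
  have hW := h.ctrl.W_pos
  have hν := h.hν
  have hM := h.hM
  have hpp : ‖p - p'‖ ≤ 80 * σ := by
    have := norm_sub_le (p - x₀) (p' - x₀)
    rw [sub_sub_sub_cancel_right] at this
    linarith
  have hb : p ∈ Metric.ball x₀ r := by rw [Metric.mem_ball, dist_eq_norm]; linarith
  have hb' : p' ∈ Metric.ball x₀ r := by rw [Metric.mem_ball, dist_eq_norm]; linarith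
  have h1 := abs_apply_self_le (B := flatten2 q ψ u t₁ p - flatten2 q ψ u t₁ p') (e := e)
    (K := 2 * X) h.chart.norm_e (by positivity) (fun v hv hve => by
      rw [sub_apply, sub_apply]
      have := abs_sub (flatten2 q ψ u t₁ p v v) (flatten2 q ψ u t₁ p' v v)
      linarith [hTT p hp hpσ v v hv hv hve hve, hTT p' hp' hpσ' v v hv hv hve hve])
  simp only [sub_apply, Finset.sum_sub_distrib, sum_flatten2] at h1
  have h2 : |lapl ψ p - lapl ψ p'| ≤ d * (M * (80 * σ)) := by
    unfold lapl
    rw [← Finset.sum_sub_distrib]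
    refine (Finset.abs_sum_le_sum_abs _ _).trans ?_
    refine (Finset.sum_le_card_nsmul _ _ (M * (80 * σ)) fun j _ => ?_).trans (by simp)
    have := h.chart.lip₂ p hb p' hb' (ebasis d j) (ebasis d j)
    rw [norm_ebasis, mul_one, mul_one] at this
    exact this.trans (by gcongr)
  have h3 : |lapl (u t₁) p - lapl (u t₁) p'| ≤ (2 * X + W * (80 * σ) ^ γ) / ν := by
    rw [le_div_iff₀ hν]
    have e1 : (lapl (u t₁) p - lapl (u t₁) p') * ν =
        (dtt u t₁ p - dtt u t₁ p') - (f t₁ p - f t₁ p') := by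
      rw [← h.ctrl.sol.pde t₁ h.ht₁ p (subset_closure hp),
        ← h.ctrl.sol.pde t₁ h.ht₁ p' (subset_closure hp')]
      ring
    have e2 : |lapl (u t₁) p - lapl (u t₁) p'| * ν = |(lapl (u t₁) p - lapl (u t₁) p') * ν| := by
      rw [abs_mul, abs_of_pos hν]
    rw [e2, e1]
    have a1 := abs_sub (dtt u t₁ p - dtt u t₁ p') (f t₁ p - f t₁ p')
    have a2 := abs_sub (dtt u t₁ p) (dtt u t₁ p')
    have a3 := h.ctrl.f_space t₁ h.ht₁ p (subset_closure hp) p' (subset_closure hp')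
    have a4 : W * ‖p - p'‖ ^ γ ≤ W * (80 * σ) ^ γ := by
      gcongr
      exact h.hγ.1.le
    linarith [hdt p hp hpσ, hdt p' hp' hpσ']
  have h4 : |q * (lapl ψ p - lapl ψ p')| ≤ W * (d * (M * (80 * σ))) := by
    rw [abs_mul]
    exact mul_le_mul h.abs_q_le h2 (abs_nonneg _) hW.le
  have h5 : lapl (u t₁) p - q * lapl ψ p - (lapl (u t₁) p' - q * lapl ψ p') =
    (lapl (u t₁) p - lapl (u t₁) p') - q * (lapl ψ p - lapl ψ p') := by ring
  rw [h5] at h1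
  have := abs_sub (lapl (u t₁) p - lapl (u t₁) p') (q * (lapl ψ p - lapl ψ p'))
  linarith

set_option maxHeartbeats 1000000 in
/-- Smallness of the tangential second differentials and of the time derivative yields
smallness of the oscillation of the whole second differential. -/
lemma abs_flatten2_osc_le (h : BdrySetup γ ν K D r M a u f S W t₁ x₀ ψ e q) {σ X Y η : ℝ}
    (hσ : 0 < σ) (hσr : 40 * σ < r) (hη : 0 < η) (hη1 : η ≤ 1) (hση : 3000 * M * σ ≤ η) (hX : 0 ≤ X)
    (hTT : ∀ p ∈ D, ‖p - x₀‖ ≤ 40 * σ → ∀ v w, ‖v‖ = 1 → ‖w‖ = 1 → inner ℝ e v = 0 →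
      inner ℝ e w = 0 → |flatten2 q ψ u t₁ p w v| ≤ X)
    (hee : ∀ p ∈ D, ∀ p' ∈ D, ‖p - x₀‖ ≤ 40 * σ → ‖p' - x₀‖ ≤ 40 * σ →
      |flatten2 q ψ u t₁ p e e - flatten2 q ψ u t₁ p' e e| ≤ Y)
    {x y : Euc d} (hx : x ∈ D) (hy : y ∈ D) (hxσ : ‖x - x₀‖ ≤ σ) (hyσ : ‖y - x₀‖ ≤ σ)
    (v w : Euc d) :
    |flatten2 q ψ u t₁ x v w - flatten2 q ψ u t₁ y v w| ≤
      (32 * X / η + 8 * Y / η + 18 * ((S + M * W) * (η * σ) ^ γ)) * ‖v‖ * ‖w‖ := by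
  have hW := h.ctrl.W_pos
  have hS := h.ctrl.S_pos
  have hM := h.hM
  have hM0 : 0 < M := by linarith
  have he := h.chart.norm_e
  have hY : 0 ≤ Y := (abs_nonneg _).trans (hee x hx x hx (by linarith) (by linarith))
  have hee1 : inner ℝ e e = (1:ℝ) := by rw [real_inner_self_eq_norm_sq, he]; norm_num
  set g2 := flatten2 q ψ u t₁ with hg2
  set μ := 3000 * M * σ ^ 2 with hμ
  have hμ0 : 0 < μ := by positivity
  have hμη : μ ≤ η * σ := by
    rw [hμ]; nlinarith
  have hμσ : μ ≤ σ := hμη.trans (mul_le_of_le_one_left hσ.le hη1)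
  set H := (S + M * W) * (η * σ) ^ γ with hH
  have hH0 : 0 ≤ H := by positivity
  have hησ0 : 0 < η * σ := by positivity
  have hησ : η * σ ≤ σ := mul_le_of_le_one_left hσ.le hη1
  have hball : ∀ p, ‖p - x₀‖ ≤ 32 * σ → p ∈ Metric.ball x₀ r := fun p hp => by
    rw [Metric.mem_ball, dist_eq_norm]; linarith
  have hmem : ∀ p, ‖p - x₀‖ ≤ 32 * σ → 2000 * M * σ ^ 2 ≤ inner ℝ e (p - x₀) → p ∈ D :=
    fun p hp hpe => by
      refine h.chart.mem_of_lt hM0.le (hball p hp) ?_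
      have : M * ‖p - x₀‖ ^ 2 ≤ M * (32 * σ) ^ 2 := by gcongr
      have : 0 < M * σ ^ 2 := by positivity
      nlinarith
  have hhol : ∀ p ∈ D, ∀ p' ∈ D, ‖p - x₀‖ ≤ 32 * σ → ‖p' - x₀‖ ≤ 32 * σ → ‖p - p'‖ ≤ η * σ →
      ∀ v w, |g2 p v w - g2 p' v w| ≤ H * ‖v‖ * ‖w‖ := fun p hp p' hp' h1 h2 h3 v w => by
    refine (h.abs_flatten2_sub_le (h.ctrl.hol2 t₁ h.ht₁) (subset_closure hp) (subset_closure hp')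
      (hball p h1) (hball p' h2) v w).trans ?_
    rw [hH]
    gcongr
    exact h.hγ.1.le
  have hinD : ∀ p ∈ D, ‖p - x₀‖ ≤ σ → -(M * σ ^ 2) ≤ inner ℝ e (p - x₀) := fun p hp hpσ => by
    by_contra! hlt
    refine h.chart.notMem_of_le hM0.le (hball p (by linarith)) ?_ hp
    have : M * ‖p - x₀‖ ^ 2 ≤ M * σ ^ 2 := by gcongr
    linarith
  have hMσ : 0 < M * σ ^ 2 := by positivity
  have hx'e : 2000 * M * σ ^ 2 ≤ inner ℝ e (x + μ • e - x₀) := by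
    rw [show x + μ • e - x₀ = (x - x₀) + μ • e by abel, inner_add_right, inner_smul_right, hee1]
    linarith [hinD x hx hxσ]
  have hy'e : 2000 * M * σ ^ 2 ≤ inner ℝ e (y + μ • e - x₀) := by
    rw [show y + μ • e - x₀ = (y - x₀) + μ • e by abel, inner_add_right, inner_smul_right, hee1]
    linarith [hinD y hy hyσ]
  have hshift : ∀ z, ‖z - x₀‖ ≤ σ → ‖z + μ • e - x₀‖ ≤ 2 * σ := fun z hz => by
    rw [show z + μ • e - x₀ = (z - x₀) + μ • e by abel]
    refine (norm_add_le _ _).trans ?_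
    rw [norm_smul, he, Real.norm_eq_abs, abs_of_pos hμ0]
    linarith
  set x' := x + μ • e with hx'
  set y' := y + μ • e with hy'
  have hx'n := hshift x hxσ
  have hy'n := hshift y hyσ
  have hx'D : x' ∈ D := hmem x' (by linarith) hx'e
  have hy'D : y' ∈ D := hmem y' (by linarith) hy'e
  set s := (inner ℝ e (y - x) : ℝ) with hs
  set l := (y - x) - s • e with hl
  have hle : inner ℝ e l = 0 := by
    rw [hl, inner_sub_right, inner_smul_right, hee1, ← hs]; ring
  have hyx : ‖y - x‖ ≤ 2 * σ := by
    have := norm_sub_le (y - x₀) (x - x₀)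
    rw [sub_sub_sub_cancel_right] at this
    linarith
  have hsσ : |s| ≤ 2 * σ := by
    have := abs_real_inner_le_norm e (y - x)
    rw [he, one_mul] at this
    exact this.trans hyx
  have hlσ : ‖l‖ ≤ 4 * σ := by
    refine (norm_sub_le _ _).trans ?_
    rw [norm_smul, he, mul_one, Real.norm_eq_abs]
    linarith
  have hxl : x' + l + s • e = y' := by rw [hx', hl, hy']; abel
  have hs' : inner ℝ e (y' - x₀) = inner ℝ e (x' - x₀) + s := by
    rw [← hxl, show x' + l + s • e - x₀ = (x' - x₀) + l + s • e by abel, inner_add_right,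
      inner_add_right, hle, inner_smul_right, hee1]; ring
  have hTl : ∀ p ∈ D, ‖p - x₀‖ ≤ 40 * σ → ∀ c, ‖c‖ = 1 → inner ℝ e c = 0 →
      |g2 p l c| ≤ X * (4 * σ) := fun p hp hpσ c hc hce => by
    rcases eq_or_ne l 0 with h0 | h0
    · rw [h0, map_zero, zero_apply, abs_zero]; positivity
    · have hn : ‖l‖ ≠ 0 := norm_ne_zero_iff.2 h0
      have := hTT p hp hpσ c (‖l‖⁻¹ • l) hc
        (by rw [norm_smul, norm_inv, norm_norm, inv_mul_cancel₀ hn]) hce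
        (by rw [inner_smul_right, hle, mul_zero])
      rw [map_smul, smul_apply, smul_eq_mul, abs_mul, abs_inv, abs_norm,
        inv_mul_le_iff₀ (by positivity)] at this
      rw [mul_comm] at this
      exact this.trans (by gcongr)
  -- points of the two stencils
  have hnrm : ∀ s₁ ∈ Icc (0:ℝ) 1, ∀ s₂ ∈ Icc (0:ℝ) 1, ∀ k : Euc d, ‖k‖ ≤ σ →
      ∀ r₁ ∈ Icc (0:ℝ) 1, ‖x' + s₁ • l + s₂ • (s • e) + r₁ • k - x₀‖ ≤ 32 * σ :=
    fun s₁ hs₁ s₂ hs₂ k hk r₁ hr₁ => by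
      have sm : ∀ c ∈ Icc (0:ℝ) 1, ∀ z : Euc d, ‖c • z‖ ≤ ‖z‖ := fun c hc z => by
        rw [norm_smul, Real.norm_eq_abs, abs_of_nonneg hc.1]
        exact mul_le_of_le_one_left (norm_nonneg _) hc.2
      have e1 : x' + s₁ • l + s₂ • (s • e) + r₁ • k - x₀ =
        (x' - x₀) + s₁ • l + s₂ • (s • e) + r₁ • k := by abel
      rw [e1]
      have i1 := norm_add_le ((x' - x₀) + s₁ • l + s₂ • (s • e)) (r₁ • k)
      have i2 := norm_add_le ((x' - x₀) + s₁ • l) (s₂ • (s • e))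
      have i3 := norm_add_le (x' - x₀) (s₁ • l)
      have j1 := sm r₁ hr₁ k
      have j2 := sm s₂ hs₂ (s • e)
      have j3 := sm s₁ hs₁ l
      have j4 : ‖s • e‖ = |s| := by rw [norm_smul, he, mul_one, Real.norm_eq_abs]
      linarith
  have hinn : ∀ s₁ : ℝ, ∀ s₂ ∈ Icc (0:ℝ) 1, ∀ k : Euc d, 0 ≤ inner ℝ e k → ∀ r₁ ∈ Icc (0:ℝ) 1,
      2000 * M * σ ^ 2 ≤ inner ℝ e (x' + s₁ • l + s₂ • (s • e) + r₁ • k - x₀) :=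
    fun s₁ s₂ hs₂ k hk r₁ hr₁ => by
      have e1 : x' + s₁ • l + s₂ • (s • e) + r₁ • k - x₀ =
        (x' - x₀) + s₁ • l + s₂ • (s • e) + r₁ • k := by abel
      rw [e1, inner_add_right, inner_add_right, inner_add_right, inner_smul_right, inner_smul_right,
        inner_smul_right, inner_smul_right, hle, hee1]
      have : 0 ≤ r₁ * inner ℝ e k := mul_nonneg hr₁.1 hk
      have e2 : (1 - s₂) * (2000 * M * σ ^ 2) ≤ (1 - s₂) * inner ℝ e (x' - x₀) :=
        mul_le_mul_of_nonneg_left hx'e (by linarith [hs₂.2])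
      have e3 : s₂ * (2000 * M * σ ^ 2) ≤ s₂ * inner ℝ e (y' - x₀) :=
        mul_le_mul_of_nonneg_left hy'e hs₂.1
      rw [hs'] at e3
      linarith
  have i0 : (0:ℝ) ∈ Icc (0:ℝ) 1 := by simp
  have i1 : (1:ℝ) ∈ Icc (0:ℝ) 1 := by simp
  have hke : ‖(η * σ) • e‖ = η * σ := by
    rw [norm_smul, he, mul_one, Real.norm_eq_abs, abs_of_pos hησ0]
  have hkn : ∀ c : Euc d, ‖c‖ = 1 → ‖(η * σ) • c‖ = η * σ := fun c hc => by
    rw [norm_smul, hc, mul_one, Real.norm_eq_abs, abs_of_pos hησ0]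
  have hnn : ∀ (p k : Euc d) (r₁ : ℝ), r₁ ∈ Icc (0:ℝ) 1 → ‖k‖ = η * σ → ‖p + r₁ • k - p‖ ≤ η * σ :=
    fun p k r₁ hr₁ hk => by
      rw [add_sub_cancel_left, norm_smul, hk, Real.norm_eq_abs, abs_of_nonneg hr₁.1]
      exact mul_le_of_le_one_left hησ0.le hr₁.2
  have step1 : ∀ c, ‖c‖ = 1 → inner ℝ e c = 0 →
      |g2 (x' + l) e c - g2 x' e c| ≤ 8 * X / η + 2 * H := fun c hc hce => by
    have hke0 : 0 ≤ inner ℝ e ((η * σ) • e) := by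
      rw [inner_smul_right, hee1]; positivity
    have hP : ∀ s₁ ∈ Icc (0:ℝ) 1, ∀ r₁ ∈ Icc (0:ℝ) 1, x' + s₁ • l + r₁ • ((η * σ) • e) ∈ D ∧
        ‖x' + s₁ • l + r₁ • ((η * σ) • e) - x₀‖ ≤ 32 * σ := fun s₁ hs₁ r₁ hr₁ => by
      have a1 := hnrm s₁ hs₁ 0 i0 ((η * σ) • e) (by rw [hke]; exact hησ) r₁ hr₁
      have a2 := hinn s₁ 0 i0 ((η * σ) • e) hke0 r₁ hr₁
      rw [zero_smul, add_zero] at a1 a2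
      exact ⟨hmem _ a1 a2, a1⟩
    have hP0 : ∀ s₁ ∈ Icc (0:ℝ) 1, x' + s₁ • l ∈ D ∧ ‖x' + s₁ • l - x₀‖ ≤ 32 * σ := fun s₁ hs₁ => by
      have := hP s₁ hs₁ 0 i0
      rwa [zero_smul, add_zero] at this
    have hP1 : ∀ s₁ ∈ Icc (0:ℝ) 1, x' + s₁ • l + (η * σ) • e ∈ D ∧
        ‖x' + s₁ • l + (η * σ) • e - x₀‖ ≤ 32 * σ := fun s₁ hs₁ => by
      have := hP s₁ hs₁ 1 i1
      rwa [one_smul] at this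
    have key := abs_bilin_diff_le (g1 := flatten1 q ψ u t₁) (g2 := g2) (x := x') (l := l)
      (k := (η * σ) • e) (c := c) (ω := 8 * X * σ) (H := H * (η * σ))
      (fun s₁ hs₁ r₁ hr₁ => h.hasFDerivAt₂ h.ht₁ (subset_closure (hP s₁ hs₁ r₁ hr₁).1))
      (fun s₁ hs₁ => by
        have a1 := hTl _ (hP1 s₁ hs₁).1 (by linarith [(hP1 s₁ hs₁).2]) c hc hce
        have a2 := hTl _ (hP0 s₁ hs₁).1 (by linarith [(hP0 s₁ hs₁).2]) c hc hce
        have := abs_sub (g2 (x' + s₁ • l + (η * σ) • e) l c) (g2 (x' + s₁ • l) l c)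
        linarith)
      (fun s₁ hs₁ r₁ hr₁ => by
        have := hhol _ (hP s₁ hs₁ r₁ hr₁).1 _ (hP0 s₁ hs₁).1 (hP s₁ hs₁ r₁ hr₁).2 (hP0 s₁ hs₁).2
          (hnn _ _ r₁ hr₁ hke) ((η * σ) • e) c
        rwa [hke, hc, mul_one] at this)
    simp only [map_smul, smul_apply, smul_eq_mul] at key
    rw [← mul_sub, abs_mul, abs_of_pos hησ0] at key
    have e1 : 8 * X * σ + 2 * (H * (η * σ)) = (η * σ) * (8 * X / η + 2 * H) := by
      field_simp
    rw [e1] at key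
    exact le_of_mul_le_mul_left key hησ0
  have step2 : ∀ c, ‖c‖ = 1 → inner ℝ e c = 0 →
      |g2 y' c e - g2 (x' + l) c e| ≤ 2 * Y / η + 2 * H := fun c hc hce => by
    have hke0 : 0 ≤ inner ℝ e ((η * σ) • c) := by
      rw [inner_smul_right, hce, mul_zero]
    have hk := hkn c hc
    have hP : ∀ s₁ ∈ Icc (0:ℝ) 1, ∀ r₁ ∈ Icc (0:ℝ) 1, x' + l + s₁ • (s • e) + r₁ • ((η * σ) • c) ∈ D ∧
        ‖x' + l + s₁ • (s • e) + r₁ • ((η * σ) • c) - x₀‖ ≤ 32 * σ := fun s₁ hs₁ r₁ hr₁ => by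
      have a1 := hnrm 1 i1 s₁ hs₁ ((η * σ) • c) (by rw [hk]; exact hησ) r₁ hr₁
      have a2 := hinn 1 s₁ hs₁ ((η * σ) • c) hke0 r₁ hr₁
      rw [one_smul] at a1 a2
      exact ⟨hmem _ a1 a2, a1⟩
    have hP0 : ∀ s₁ ∈ Icc (0:ℝ) 1, x' + l + s₁ • (s • e) ∈ D ∧
        ‖x' + l + s₁ • (s • e) - x₀‖ ≤ 32 * σ := fun s₁ hs₁ => by
      have := hP s₁ hs₁ 0 i0
      rwa [zero_smul, add_zero] at this
    have hP1 : ∀ s₁ ∈ Icc (0:ℝ) 1, x' + l + s₁ • (s • e) + (η * σ) • c ∈ D ∧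
        ‖x' + l + s₁ • (s • e) + (η * σ) • c - x₀‖ ≤ 32 * σ := fun s₁ hs₁ => by
      have := hP s₁ hs₁ 1 i1
      rwa [one_smul] at this
    have key := abs_bilin_diff_le (g1 := flatten1 q ψ u t₁) (g2 := g2) (x := x' + l) (l := s • e)
      (k := (η * σ) • c) (c := e) (ω := 2 * σ * Y) (H := H * (η * σ))
      (fun s₁ hs₁ r₁ hr₁ => h.hasFDerivAt₂ h.ht₁ (subset_closure (hP s₁ hs₁ r₁ hr₁).1))
      (fun s₁ hs₁ => by
        have a1 := hee _ (hP1 s₁ hs₁).1 _ (hP0 s₁ hs₁).1 (by linarith [(hP1 s₁ hs₁).2])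
          (by linarith [(hP0 s₁ hs₁).2])
        simp only [map_smul, smul_apply, smul_eq_mul] at a1 ⊢
        rw [← mul_sub, abs_mul]
        exact mul_le_mul hsσ a1 (abs_nonneg _) (by positivity))
      (fun s₁ hs₁ r₁ hr₁ => by
        have := hhol _ (hP s₁ hs₁ r₁ hr₁).1 _ (hP0 s₁ hs₁).1 (hP s₁ hs₁ r₁ hr₁).2 (hP0 s₁ hs₁).2
          (hnn _ _ r₁ hr₁ hk) ((η * σ) • c) e
        rwa [hk, he, mul_one] at this)
    rw [hxl] at key
    simp only [map_smul, smul_apply, smul_eq_mul] at key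
    rw [← mul_sub, abs_mul, abs_of_pos hησ0] at key
    have e1 : 2 * σ * Y + 2 * (H * (η * σ)) = (η * σ) * (2 * Y / η + 2 * H) := by
      field_simp
    rw [e1] at key
    exact le_of_mul_le_mul_left key hησ0
  have hzD : x' + l ∈ D ∧ ‖x' + l - x₀‖ ≤ 32 * σ := by
    have a1 := hnrm 1 i1 0 i0 0 (by simpa using hσ.le) 0 i0
    have a2 := hinn 1 0 i0 0 (by simp) 0 i0
    simp only [one_smul, zero_smul, add_zero] at a1 a2
    exact ⟨hmem _ a1 a2, a1⟩
  have hXη : X ≤ X / η := by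
    rw [le_div_iff₀ hη]; nlinarith
  have hYη : Y ≤ Y / η := by
    rw [le_div_iff₀ hη]; nlinarith
  have hXη0 : 0 ≤ X / η := by positivity
  have hYη0 : 0 ≤ Y / η := by positivity
  set N := 8 * X / η + 2 * Y / η + 4 * H with hN
  have hN' : N = 8 * (X / η) + 2 * (Y / η) + 4 * H := by rw [hN]; ring
  have mixed : ∀ c, ‖c‖ = 1 → inner ℝ e c = 0 → |g2 y' e c - g2 x' e c| ≤ N := fun c hc hce => by
    have a1 := step1 c hc hce
    have a2 := step2 c hc hce
    have s1 : g2 y' c e = g2 y' e c := h.flatten2_symm hy'D c e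
    have s2 : g2 (x' + l) c e = g2 (x' + l) e c := h.flatten2_symm hzD.1 c e
    rw [s1, s2] at a2
    have := abs_sub_le (g2 y' e c) (g2 (x' + l) e c) (g2 x' e c)
    rw [hN]
    linarith
  have core := abs_bilin_le_of_split (B := g2 y' - g2 x') (e := e) (K := N) he
    (by
      rw [sub_apply, sub_apply]
      refine (hee y' hy'D x' hx'D (by linarith) (by linarith)).trans ?_
      rw [hN']; linarith)
    (fun c hc hce => by rw [sub_apply, sub_apply]; exact mixed c hc hce)
    (fun c hc hce => by
      rw [sub_apply, sub_apply]
      have s1 : g2 y' c e = g2 y' e c := h.flatten2_symm hy'D c e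
      have s2 : g2 x' c e = g2 x' e c := h.flatten2_symm hx'D c e
      rw [s1, s2]
      exact mixed c hc hce)
    (fun c c' hc hc' hce hce' => by
      rw [sub_apply, sub_apply]
      have := abs_sub (g2 y' c c') (g2 x' c c')
      have a1 := hTT y' hy'D (by linarith) c' c hc' hc hce' hce
      have a2 := hTT x' hx'D (by linarith) c' c hc' hc hce' hce
      rw [hN']; linarith) v w
  rw [sub_apply, sub_apply] at core
  have hsh : ∀ z : Euc d, ‖z - (z + μ • e)‖ ≤ η * σ := fun z => by
    rw [sub_add_cancel_left, norm_neg, norm_smul, he, mul_one, Real.norm_eq_abs, abs_of_pos hμ0]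
    exact hμη
  have c1 := hhol x hx x' hx'D (by linarith) (by linarith) (hsh x) v w
  have c2 := hhol y hy y' hy'D (by linarith) (by linarith) (hsh y) v w
  have t1 := abs_sub_le (g2 x v w) (g2 x' v w) (g2 y v w)
  have t2 := abs_sub_le (g2 x' v w) (g2 y' v w) (g2 y v w)
  rw [abs_sub_comm (g2 x' v w) (g2 y' v w), abs_sub_comm (g2 y' v w) (g2 y v w)] at t2
  have e1 : (32 * X / η + 8 * Y / η + 18 * H) * ‖v‖ * ‖w‖ = 4 * N * ‖v‖ * ‖w‖ +
      2 * (H * ‖v‖ * ‖w‖) := by rw [hN]; ring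
  linarith

end BdrySetup

end

section
variable {d : ℕ}

set_option maxHeartbeats 1000000 in
/-- Oscillation of the second differential near a boundary point. -/
theorem exists_boundary_bound (d : ℕ) {γ ν K M r : ℝ} (hγ : γ ∈ Ioo (0:ℝ) 1) (hν : 0 < ν)
    (hK : 0 ≤ K) (hM : 1 ≤ M) (hr : 0 < r) {θ : ℝ} (hθ : 0 < θ) :
    ∃ C ≥ 0, ∃ σ₀ > 0, σ₀ ≤ 1 ∧ ∀ (D : Set (Euc d)) (a : ℝ) (u f : ℝ → Euc d → ℝ) (S W t₁ : ℝ)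
      (x₀ : Euc d) (ψ : Euc d → ℝ) (e : Euc d) (q : ℝ), BdrySetup γ ν K D r M a u f S W t₁ x₀ ψ e q →
      ∀ S₀ ≥ 0, ∀ δ, 0 < δ → δ ≤ 1 → ∀ σ, 0 < σ → σ ≤ σ₀ * δ →
      (a + δ ^ 2 ≤ t₁ ∨ HolAt γ D (u a) S₀) → ∀ x ∈ D, ∀ y ∈ D, ‖x - x₀‖ ≤ σ → ‖y - x₀‖ ≤ σ →
      ∀ v w, |dx2 (u t₁) x v w - dx2 (u t₁) y v w| ≤
        (θ * S + C * (W + S₀)) * σ ^ γ * ‖v‖ * ‖w‖ := by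
  obtain ⟨η, hη, hη1, hηγ, -⟩ := exists_small_params hγ (θ := θ / 36) (by positivity)
  have hη' : 18 * η ^ γ ≤ θ / 2 := by
    have : η ^ γ ≤ (3 * η) ^ γ := Real.rpow_le_rpow hη.le (by linarith) hγ.1.le
    linarith
  set c := (32 + 8 * (2 / ν + 2 * d)) / η with hc
  have hcpos : 0 < c := by positivity
  obtain ⟨C₁, hC₁, σ₁, hσ₁, hσ₁1, H⟩ :=
    exists_tangential_bound d hγ hν hK hM hr (θ := θ / 2 / c) (by positivity)
  refine ⟨C₁ * c + 8 * (80 / ν + 80 * d * M) / η + 20 * M, by positivity,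
    min σ₁ (min (η / (3000 * M)) (r / 41)), by positivity, (min_le_left _ _).trans hσ₁1, ?_⟩
  intro D a u f S W t₁ x₀ ψ e q h S₀ hS₀ δ hδ hδ1 σ hσ hσδ halt x hx y hy hxσ hyσ v w
  have hW := h.ctrl.W_pos
  have hS := h.ctrl.S_pos
  have hmin : 0 ≤ min σ₁ (min (η / (3000 * M)) (r / 41)) := by positivity
  have hσm : σ ≤ min σ₁ (min (η / (3000 * M)) (r / 41)) :=
    hσδ.trans (mul_le_of_le_one_right hmin hδ1)
  have hσ1 : σ ≤ σ₁ * δ := hσδ.trans (by gcongr; exact min_le_left _ _)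
  have hση : 3000 * M * σ ≤ η := by
    have := hσm.trans ((min_le_right _ _).trans (min_le_left _ _))
    rw [le_div_iff₀ (by positivity)] at this
    linarith
  have hσr : 40 * σ < r := by
    have := hσm.trans ((min_le_right _ _).trans (min_le_right _ _))
    linarith
  have hσle1 : σ ≤ 1 := hσm.trans ((min_le_left _ _).trans hσ₁1)
  have hσγ : σ ≤ σ ^ γ := h.le_rpow hσ.le hσle1
  set X := (θ / 2 / c * S + C₁ * (W + S₀)) * σ ^ γ with hX
  have hX0 : 0 ≤ X := by positivity
  have HH := H D a u f S W t₁ x₀ ψ e q h S₀ hS₀ δ hδ hδ1 σ hσ hσ1 halt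
  have key := h.abs_flatten2_osc_le hσ hσr hη hη1 hση hX0
    (fun p hp hpσ => (HH p hp hpσ).1)
    (fun p hp p' hp' hpσ hpσ' => h.abs_flatten2_normal_sub_le hσr hX0
      (fun p hp hpσ => (HH p hp hpσ).1) (fun p hp hpσ => (HH p hp hpσ).2) hp hp' hpσ hpσ')
    hx hy hxσ hyσ v w
  have hb : x ∈ Metric.ball x₀ r := by rw [Metric.mem_ball, dist_eq_norm]; linarith
  have hb' : y ∈ Metric.ball x₀ r := by rw [Metric.mem_ball, dist_eq_norm]; linarith
  have hxy : ‖x - y‖ ≤ 2 * σ := by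
    have := norm_sub_le (x - x₀) (y - x₀)
    rw [sub_sub_sub_cancel_right] at this
    linarith
  have e1 : dx2 (u t₁) x v w - dx2 (u t₁) y v w =
      (flatten2 q ψ u t₁ x v w - flatten2 q ψ u t₁ y v w) +
        q * (dx2 ψ x v w - dx2 ψ y v w) := by
    rw [flatten2_apply, flatten2_apply]; ring
  have e2 : |q * (dx2 ψ x v w - dx2 ψ y v w)| ≤ W * (M * (2 * σ ^ γ) * ‖v‖ * ‖w‖) := by
    rw [abs_mul]
    refine mul_le_mul h.abs_q_le ((h.chart.lip₂ x hb y hb' v w).trans ?_) (abs_nonneg _) hW.le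
    gcongr
    linarith
  rw [e1]
  refine (abs_add_le _ _).trans ((add_le_add key e2).trans ?_)
  have e3 : (80 * σ) ^ γ ≤ 80 * σ ^ γ := by
    rw [Real.mul_rpow (by norm_num) hσ.le]
    gcongr
    exact (Real.rpow_le_rpow_of_exponent_le (by norm_num) hγ.2.le).trans (by rw [Real.rpow_one])
  have e4 : (η * σ) ^ γ = η ^ γ * σ ^ γ := Real.mul_rpow hη.le hσ.le
  have hησ : η ^ γ ≤ 1 := Real.rpow_le_one hη.le hη1 hγ.1.le
  have e5 : W * (80 * σ) ^ γ / ν ≤ W * (80 * σ ^ γ) / ν := by gcongr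
  have e6 : W * (d * (M * (80 * σ))) ≤ W * (d * (M * (80 * σ ^ γ))) := by gcongr
  have e7 : 18 * ((S + M * W) * (η * σ) ^ γ) ≤ (θ / 2 * S + 18 * M * W) * σ ^ γ := by
    rw [e4]
    have a1 : 18 * η ^ γ * S ≤ θ / 2 * S := by gcongr
    have a2 : η ^ γ * (18 * M * W) ≤ 1 * (18 * M * W) := by gcongr
    calc 18 * ((S + M * W) * (η ^ γ * σ ^ γ)) =
        (18 * η ^ γ * S + η ^ γ * (18 * M * W)) * σ ^ γ := by ring
      _ ≤ _ := mul_le_mul_of_nonneg_right (by linarith) (by positivity)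
  have e8 : c * X = (θ / 2 * S + C₁ * c * (W + S₀)) * σ ^ γ := by
    rw [hX]; field_simp
  have e9 : 32 * X / η + 8 * ((2 * X + W * (80 * σ) ^ γ) / ν + W * (d * (M * (80 * σ))) +
      d * (2 * X)) / η ≤ c * X + 8 * (80 / ν + 80 * d * M) / η * W * σ ^ γ := by
    have : 32 * X / η + 8 * ((2 * X + W * (80 * σ) ^ γ) / ν + W * (d * (M * (80 * σ))) +
      d * (2 * X)) / η = c * X + 8 * (W * (80 * σ) ^ γ / ν + W * (d * (M * (80 * σ)))) / η := by
      rw [hc]; field_simp; ring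
    rw [this]
    have a3 : 8 * (80 / ν + 80 * d * M) / η * W * σ ^ γ =
        8 * (W * (80 * σ ^ γ) / ν + W * (d * (M * (80 * σ ^ γ)))) / η := by
      field_simp
    rw [a3]
    gcongr
  have e10 : 0 ≤ (8 * (80 / ν + 80 * d * M) / η + 20 * M) * S₀ * σ ^ γ := by positivity
  rw [show W * (M * (2 * σ ^ γ) * ‖v‖ * ‖w‖) = (W * (M * (2 * σ ^ γ))) * ‖v‖ * ‖w‖ by ring,
    ← add_mul, ← add_mul]
  refine mul_le_mul_of_nonneg_right (mul_le_mul_of_nonneg_right ?_ (norm_nonneg _))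
    (norm_nonneg _)
  rw [e8] at e9
  refine (add_le_add (add_le_add e9 e7) le_rfl).trans (le_of_sub_nonneg ?_)
  refine e10.trans (le_of_eq ?_)
  ring

end

section
variable {d : ℕ}

/-- Inequalities between continuous functions of two points pass to the closure. -/
lemma le_on_closure_pair {E : Type*} [TopologicalSpace E] {D : Set E} {F G : E → E → ℝ}
    (hF : ContinuousOn (fun p : E × E => F p.1 p.2) (closure D ×ˢ closure D))
    (hG : ContinuousOn (fun p : E × E => G p.1 p.2) (closure D ×ˢ closure D))
    (h : ∀ x ∈ D, ∀ y ∈ D, F x y ≤ G x y) : ∀ x ∈ closure D, ∀ y ∈ closure D, F x y ≤ G x y := by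
  intro x hx y hy
  rw [← closure_prod_eq] at hF hG
  exact le_on_closure (s := D ×ˢ D) (f := fun p : E × E => F p.1 p.2)
    (g := fun p : E × E => G p.1 p.2) (fun p hp => h p.1 hp.1 p.2 hp.2) hF hG
    (by rw [closure_prod_eq]; exact ⟨hx, hy⟩ : (x, y) ∈ closure (D ×ˢ D))

lemma continuousOn_of_dist_rpow {E : Type*} [NormedAddCommGroup E] {D : Set E} {γ C : ℝ}
    (hγ : 0 < γ) {g : E → ℝ} (h : ∀ x ∈ D, ∀ y ∈ D, |g x - g y| ≤ C * ‖x - y‖ ^ γ) :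
    ContinuousOn g D := by
  intro x hx
  rw [ContinuousWithinAt, tendsto_iff_dist_tendsto_zero]
  refine squeeze_zero' (g := fun y => C * ‖y - x‖ ^ γ) (Eventually.of_forall fun y => dist_nonneg)
    ?_ ?_
  · filter_upwards [self_mem_nhdsWithin] with y hy
    rw [Real.dist_eq]
    exact h y hy x hx
  · have : ContinuousAt (fun y => C * ‖y - x‖ ^ γ) x :=
      continuousAt_const.mul (ContinuousAt.rpow_const (by fun_prop) (Or.inr hγ.le))
    have := this.tendsto.mono_left (nhdsWithin_le_nhds (s := D))
    simpa [Real.zero_rpow hγ.ne'] using this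

lemma HolAt.continuousOn_apply {γ S : ℝ} {D : Set (Euc d)} {g : Euc d → ℝ} (hγ : 0 < γ)
    (h : HolAt γ D g S) (v w : Euc d) : ContinuousOn (fun x => dx2 g x v w) (closure D) :=
  continuousOn_of_dist_rpow (C := S * ‖v‖ * ‖w‖) hγ fun x hx y hy => by
    refine (h x hx y hy v w).trans (le_of_eq ?_)
    ring

/-- A Hölder bound on `D` extends to the closure. -/
lemma HolAt.of_mem {γ S S' : ℝ} {D : Set (Euc d)} {g : Euc d → ℝ} (hγ : 0 < γ)
    (h : HolAt γ D g S) (h' : ∀ x ∈ D, ∀ y ∈ D, ∀ v w,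
      |dx2 g x v w - dx2 g y v w| ≤ S' * ‖x - y‖ ^ γ * ‖v‖ * ‖w‖) : HolAt γ D g S' := by
  intro x hx y hy v w
  have hc := h.continuousOn_apply hγ v w
  refine le_on_closure_pair (F := fun x y => |dx2 g x v w - dx2 g y v w|)
    (G := fun x y => S' * ‖x - y‖ ^ γ * ‖v‖ * ‖w‖) ?_ ?_ (fun x hx y hy => h' x hx y hy v w) x hx y hy
  · exact ((hc.comp continuousOn_fst fun p hp => hp.1).sub
      (hc.comp continuousOn_snd fun p hp => hp.2)).abs
  · refine Continuous.continuousOn ?_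
    refine (((continuous_const.mul (Continuous.rpow_const (by fun_prop) fun _ => Or.inr hγ.le)).mul
      continuous_const).mul continuous_const)

set_option maxHeartbeats 1000000 in
/-- The Schauder-type estimate: the Hölder constant of the second differential is controlled by a
small multiple of itself and by lower order quantities. -/
theorem exists_holAt_bound {γ ν K M r : ℝ} (hγ : γ ∈ Ioo (0:ℝ) 1) (hν : 0 < ν)
    (hK : 0 ≤ K) (hM : 1 ≤ M) (hr : 0 < r) (hr2 : r ≤ 1 / 2) {D : Set (Euc d)} (hD : IsOpen D)
    (hch : HasCharts D r M) {θ : ℝ} (hθ : 0 < θ) :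
    ∃ C > 0, ∀ (a : ℝ) (u f : ℝ → Euc d → ℝ) (S W t : ℝ),
      Ctrl γ ν K D a u f S W → a ≤ t →
      (∀ x ∈ D, ∀ v w, |dx2 (u t) x v w| ≤ W * ‖v‖ * ‖w‖) →
      ∀ S₀ ≥ 0, ∀ δ, 0 < δ → δ ≤ 1 → (a + δ ^ 2 ≤ t ∨ HolAt γ D (u a) S₀) →
      HolAt γ D (u t) (θ * S + C / δ * (W + S₀)) := by
  obtain ⟨C₁, hC₁, ρ₁, hρ₁, Λ, hΛ, H₁⟩ := exists_interior_bound d (K := K) hγ hν hθ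
  have hL : 0 < (2 * Λ) ^ γ := by positivity
  obtain ⟨C₂, hC₂, σ₀, hσ₀, hσ₀1, H₂⟩ :=
    exists_boundary_bound d hγ hν hK hM hr (θ := θ / (2 * Λ) ^ γ) (by positivity)
  set ρ₀ := min (min ρ₁ (σ₀ / (2 * Λ))) 1 with hρ₀
  have hρ₀pos : 0 < ρ₀ := by positivity
  have hρ₀1 : ρ₀ ≤ 1 := min_le_right _ _
  refine ⟨C₁ + C₂ * (2 * Λ) ^ γ + 2 / ρ₀, by positivity, ?_⟩
  intro a u f S W t h hat hW2 S₀ hS₀ δ hδ hδ1 halt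
  refine (h.hol2 t hat).of_mem hγ.1 fun x hx y hy v w => ?_
  have hW := h.W_pos
  have hS := h.S_pos
  rcases eq_or_ne x y with rfl | hxy
  · simp [Real.zero_rpow hγ.1.ne']
  have hρ : 0 < ‖x - y‖ := norm_pos_iff.2 (sub_ne_zero.2 hxy)
  set ρ := ‖x - y‖ with hρdef
  have hδi : 1 ≤ 1 / δ := by rw [le_div_iff₀ hδ]; linarith
  have hWS : 0 ≤ W + S₀ := by positivity
  suffices hs : |dx2 (u t) x v w - dx2 (u t) y v w| ≤
      (θ * S + C₁ * (W + S₀)) * ρ ^ γ * ‖v‖ * ‖w‖ ∨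
      |dx2 (u t) x v w - dx2 (u t) y v w| ≤
      (θ * S + C₂ * (2 * Λ) ^ γ * (W + S₀)) * ρ ^ γ * ‖v‖ * ‖w‖ ∨
      |dx2 (u t) x v w - dx2 (u t) y v w| ≤
      (θ * S + 2 / ρ₀ * (1 / δ) * (W + S₀)) * ρ ^ γ * ‖v‖ * ‖w‖ by
    have k1 : C₁ * (W + S₀) ≤ (C₁ + C₂ * (2 * Λ) ^ γ + 2 / ρ₀) / δ * (W + S₀) := by
      rw [div_eq_mul_one_div]
      refine mul_le_mul_of_nonneg_right ?_ hWS
      have p1 : 0 ≤ C₂ * (2 * Λ) ^ γ := by positivity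
      have p2 : 0 ≤ 2 / ρ₀ := by positivity
      calc C₁ = C₁ * 1 := by ring
        _ ≤ _ := mul_le_mul (by linarith) hδi (by norm_num) (by positivity)
    have k2 : C₂ * (2 * Λ) ^ γ * (W + S₀) ≤
        (C₁ + C₂ * (2 * Λ) ^ γ + 2 / ρ₀) / δ * (W + S₀) := by
      rw [div_eq_mul_one_div]
      refine mul_le_mul_of_nonneg_right ?_ hWS
      have p1 : 0 ≤ C₂ * (2 * Λ) ^ γ := by positivity
      have p2 : 0 ≤ 2 / ρ₀ := by positivity
      calc C₂ * (2 * Λ) ^ γ = C₂ * (2 * Λ) ^ γ * 1 := by ring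
        _ ≤ _ := mul_le_mul (by linarith) hδi (by norm_num) (by positivity)
    have k3 : 2 / ρ₀ * (1 / δ) * (W + S₀) ≤
        (C₁ + C₂ * (2 * Λ) ^ γ + 2 / ρ₀) / δ * (W + S₀) := by
      rw [div_eq_mul_one_div (C₁ + C₂ * (2 * Λ) ^ γ + 2 / ρ₀)]
      refine mul_le_mul_of_nonneg_right ?_ hWS
      have p1 : 0 ≤ C₂ * (2 * Λ) ^ γ := by positivity
      exact mul_le_mul_of_nonneg_right (by linarith) (by positivity)
    have k0 : ∀ Z Z', Z ≤ Z' → (θ * S + Z) * ρ ^ γ * ‖v‖ * ‖w‖ ≤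
        (θ * S + Z') * ρ ^ γ * ‖v‖ * ‖w‖ := fun Z Z' hZ => by gcongr
    rcases hs with hs | hs | hs
    · exact hs.trans (k0 _ _ k1)
    · exact hs.trans (k0 _ _ k2)
    · exact hs.trans (k0 _ _ k3)
  by_cases hsmall : ρ ≤ ρ₀ * δ
  · by_cases hin : ∀ p, ‖p - x‖ ≤ Λ * ρ → p ∈ D
    · left
      refine H₁ D a u f S W t h hD hat S₀ hS₀ δ hδ hδ1 halt x y hxy (hsmall.trans ?_) hin v w
      gcongr
      exact (min_le_left _ _).trans (min_le_left _ _)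
    · right; left
      push Not at hin
      obtain ⟨p, hp, hpD⟩ := hin
      obtain ⟨z, hz, hxz, -⟩ := exists_frontier_dist_le hD hx hpD
      obtain ⟨ψ, e, hψ⟩ := hch z hz
      have hxz' : ‖x - z‖ ≤ Λ * ρ := hxz.trans (by rwa [norm_sub_rev])
      have hΛρ : ρ ≤ Λ * ρ := le_mul_of_one_le_left hρ.le hΛ
      have hyz : ‖y - z‖ ≤ 2 * Λ * ρ := by
        have := norm_sub_le_norm_sub_add_norm_sub y x z
        rw [norm_sub_rev y x, ← hρdef] at this
        linarith
      have hsetup : BdrySetup γ ν K D r M a u f S W t z ψ e (-dx1 (u t) z e) :=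
        ⟨h, hγ, hν, hD, hψ, hM, hr, hr2, hz, hat, rfl⟩
      have hσ : 2 * Λ * ρ ≤ σ₀ * δ := by
        have : ρ ≤ σ₀ / (2 * Λ) * δ := hsmall.trans (by
          gcongr
          exact (min_le_left _ _).trans (min_le_right _ _))
        rw [div_mul_eq_mul_div, le_div_iff₀ (by positivity)] at this
        linarith
      have := H₂ D a u f S W t z ψ e _ hsetup S₀ hS₀ δ hδ hδ1 (2 * Λ * ρ) (by positivity) hσ halt
        x hx y hy (by linarith) hyz v w
      refine this.trans (le_of_eq ?_)
      rw [Real.mul_rpow (by positivity) hρ.le]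
      field_simp
  · right; right
    push Not at hsmall
    have b1 := hW2 x hx v w
    have b2 := hW2 y hy v w
    have b3 := abs_sub (dx2 (u t) x v w) (dx2 (u t) y v w)
    have hρδ : ρ₀ * δ ≤ 1 := mul_le_one₀ hρ₀1 hδ.le hδ1
    have b4 : ρ₀ * δ ≤ ρ ^ γ :=
      calc ρ₀ * δ ≤ (ρ₀ * δ) ^ γ := by
            simpa using Real.rpow_le_rpow_of_exponent_ge' (by positivity : 0 ≤ ρ₀ * δ) hρδ hγ.1.le
              hγ.2.le
        _ ≤ _ := Real.rpow_le_rpow (by positivity) hsmall.le hγ.1.le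
    have b5 : 1 ≤ 1 / (ρ₀ * δ) * ρ ^ γ := by
      rw [one_div_mul_eq_div, le_div_iff₀ (by positivity)]; linarith
    calc |dx2 (u t) x v w - dx2 (u t) y v w| ≤ 2 * W * ‖v‖ * ‖w‖ * 1 := by linarith
      _ ≤ 2 * W * ‖v‖ * ‖w‖ * (1 / (ρ₀ * δ) * ρ ^ γ) := by gcongr
      _ = (0 + 2 / ρ₀ * (1 / δ) * (W + 0)) * ρ ^ γ * ‖v‖ * ‖w‖ := by field_simp; ring
      _ ≤ _ := by gcongr; positivity

end

section
variable {d : ℕ}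

/-- The lower order part of the equation, moved to the right-hand side. -/
def source (A : ℝ → Fin d → ℝ) (h u : ℝ → Euc d → ℝ) (t : ℝ) (x : Euc d) : ℝ :=
  h t x - ∑ j, deriv (fun v => A v j) (u t x) * dx1 (u t) x (ebasis d j)

/-- A bounded solution of the equation on `[a, ∞)` with quantitative bounds on the data. -/
structure BddSol (γ ν r N M α : ℝ) (A : ℝ → Fin d → ℝ) (D : Set (Euc d)) (a : ℝ)
    (u h : ℝ → Euc d → ℝ) (S b : ℝ) : Prop where
  hγ : γ ∈ Ioo (0:ℝ) 1
  hν : 0 < ν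
  cone : ConeCond D r
  r_pos : 0 < r
  r_le : r ≤ 1
  N_nonneg : 0 ≤ N
  M_nonneg : 0 ≤ M
  α_nonneg : 0 ≤ α
  S_pos : 0 < S
  one_le : 1 ≤ b
  sol : IsSol ν D a u (source A h u)
  bdd : ∀ t ≥ a, ∀ x ∈ closure D, |u t x| ≤ M
  h_bdd : ∀ t ≥ a, ∀ x ∈ closure D, |h t x| ≤ N
  h_space : ∀ t ≥ a, ∀ x ∈ closure D, ∀ y ∈ closure D, |h t x - h t y| ≤ N * ‖x - y‖ ^ γ
  h_time : ∀ t ≥ a, ∀ s ≥ a, ∀ x ∈ closure D, |h t x - h s x| ≤ N * |t - s| ^ (γ / 2)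
  hol2 : ∀ t ≥ a, HolAt γ D (u t) S
  bd2 : ∀ t ≥ a, ∀ x ∈ closure D, ∀ v w, |dx2 (u t) x v w| ≤ b ^ 2 * ‖v‖ * ‖w‖
  A1 : ∀ v, |v| ≤ M → ∀ j, |deriv (fun v => A v j) v| ≤ α
  A2 : ∀ v w, |v| ≤ M → |w| ≤ M → ∀ j,
    |deriv (fun v => A v j) v - deriv (fun v => A v j) w| ≤ α * |v - w|

lemma le_rpow_of_le_of_le {γ ρ F P Q : ℝ} (hγ : γ ∈ Ioo (0:ℝ) 1) (hρ : 0 ≤ ρ) (hP : 0 ≤ P)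
    (hQ : 0 ≤ Q) (h1 : F ≤ P * ρ) (h2 : F ≤ Q) : F ≤ (P + Q) * ρ ^ γ := by
  rcases le_total ρ 1 with h | h
  · have : ρ ≤ ρ ^ γ := by
      simpa using Real.rpow_le_rpow_of_exponent_ge' hρ h hγ.1.le hγ.2.le
    have h3 : P * ρ ≤ P * ρ ^ γ := by gcongr
    have h4 : 0 ≤ Q * ρ ^ γ := by positivity
    linarith
  · have h3 : 1 ≤ ρ ^ γ := Real.one_le_rpow h hγ.1.le
    have h4 : Q * 1 ≤ Q * ρ ^ γ := by gcongr
    have h5 : 0 ≤ P * ρ ^ γ := by positivity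
    linarith

namespace BddSol

variable {γ ν r N M α : ℝ} {A : ℝ → Fin d → ℝ} {D : Set (Euc d)} {a : ℝ}
  {u h : ℝ → Euc d → ℝ} {S b : ℝ}

lemma continuousOn_dx1 (H : BddSol γ ν r N M α A D a u h S b) {t : ℝ} (ht : a ≤ t) (v : Euc d) :
    ContinuousOn (fun x => dx1 (u t) x v) (closure D) := fun x hx =>
  ((H.sol.d2 t ht x hx).continuousAt.clm_apply continuousAt_const).continuousWithinAt

lemma continuousOn_u (H : BddSol γ ν r N M α A D a u h S b) {t : ℝ} (ht : a ≤ t) :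
    ContinuousOn (u t) (closure D) := fun x hx =>
  (H.sol.d1 t ht x hx).continuousAt.continuousWithinAt

lemma abs_dx1_le (H : BddSol γ ν r N M α A D a u h S b) {t : ℝ} (ht : a ≤ t) {x : Euc d}
    (hx : x ∈ closure D) (v : Euc d) : |dx1 (u t) x v| ≤ 4 * (3 * r + 2 * M / r) * b * ‖v‖ := by
  have hr := H.r_pos
  have hb := H.one_le
  refine le_on_closure (f := fun x => |dx1 (u t) x v|)
    (g := fun _ => 4 * (3 * r + 2 * M / r) * b * ‖v‖) (fun x hx => ?_)
    (H.continuousOn_dx1 ht v).abs continuousOn_const hx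
  have := H.cone.abs_fderiv_le (g := u t) (g1 := dx1 (u t)) (g2 := dx2 (u t)) (K := b ^ 2)
    (ω := 2 * M) (ρ := r / b) (fun y hy => H.sol.d1 t ht y (subset_closure hy))
    (fun y hy => H.sol.d2 t ht y (subset_closure hy)) (by positivity)
    (fun y hy => H.bd2 t ht y (subset_closure hy)) hx (by positivity)
    (div_le_self hr.le hb) (fun p hp _ => by
      have h1 := H.bdd t ht p (subset_closure hp)
      have h2 := H.bdd t ht x (subset_closure hx)
      have := abs_sub (u t p) (u t x)
      linarith) v
  refine this.trans (le_of_eq ?_)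
  field_simp

lemma abs_dx1_sub_le (H : BddSol γ ν r N M α A D a u h S b) {C₁ : ℝ} (hC₁ : 0 ≤ C₁)
    (h1 : ∀ t ≥ a, ∀ x ∈ closure D, ∀ v, |dx1 (u t) x v| ≤ C₁ * b * ‖v‖) {t : ℝ} (ht : a ≤ t)
    {x y : Euc d} (hx : x ∈ closure D) (hy : y ∈ closure D) (v : Euc d) :
    |dx1 (u t) x v - dx1 (u t) y v| ≤ (5 + 4 * C₁ / r) * b ^ 2 * ‖x - y‖ * ‖v‖ := by
  have hr := H.r_pos
  have hb := H.one_le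
  have hc := H.continuousOn_dx1 ht v
  refine le_on_closure_pair (F := fun x y => |dx1 (u t) x v - dx1 (u t) y v|)
    (G := fun x y => (5 + 4 * C₁ / r) * b ^ 2 * ‖x - y‖ * ‖v‖)
    ((hc.comp continuousOn_fst fun p hp => hp.1).sub
      (hc.comp continuousOn_snd fun p hp => hp.2)).abs (Continuous.continuousOn (by fun_prop))
    (fun x hx y hy => ?_) x hx y hy
  have hp : 0 ≤ 4 * C₁ / r := by positivity
  rcases le_or_gt ‖x - y‖ (r / 2) with hxy | hxy
  · have := H.cone.abs_sub_le (g := fun x => dx1 (u t) x v)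
      (g1 := fun x => (dx2 (u t) x).flip v) (K := b ^ 2 * ‖v‖)
      (fun y hy => (H.sol.d2 t ht y (subset_closure hy)).apply_const v) (fun y hy w => by
        have := H.bd2 t ht y (subset_closure hy) w v
        simp only [ContinuousLinearMap.flip_apply]
        linarith) hx hy hxy
    refine this.trans ?_
    calc 5 * (b ^ 2 * ‖v‖) * ‖x - y‖ = 5 * b ^ 2 * ‖x - y‖ * ‖v‖ := by ring
      _ ≤ _ := by gcongr; linarith
  · have h2 := h1 t ht x (subset_closure hx) v
    have h3 := h1 t ht y (subset_closure hy) v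
    have := abs_sub (dx1 (u t) x v) (dx1 (u t) y v)
    have h4 : 1 ≤ 2 / r * ‖x - y‖ := by
      rw [div_mul_eq_mul_div, le_div_iff₀ hr]; linarith
    have hbb : b ≤ b ^ 2 := by nlinarith
    calc |dx1 (u t) x v - dx1 (u t) y v| ≤ 2 * C₁ * b * ‖v‖ * 1 := by linarith
      _ ≤ 2 * C₁ * b ^ 2 * ‖v‖ * (2 / r * ‖x - y‖) := by gcongr
      _ = (0 + 4 * C₁ / r) * b ^ 2 * ‖x - y‖ * ‖v‖ := by ring
      _ ≤ _ := by gcongr; norm_num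

lemma abs_sub_le (H : BddSol γ ν r N M α A D a u h S b) {C₁ : ℝ} (hC₁ : 0 ≤ C₁)
    (h1 : ∀ t ≥ a, ∀ x ∈ closure D, ∀ v, |dx1 (u t) x v| ≤ C₁ * b * ‖v‖) {t : ℝ} (ht : a ≤ t)
    {x y : Euc d} (hx : x ∈ closure D) (hy : y ∈ closure D) :
    |u t x - u t y| ≤ (5 * C₁ + 4 * M / r) * b * ‖x - y‖ := by
  have hr := H.r_pos
  have hb := H.one_le
  have hM := H.M_nonneg
  have hc := H.continuousOn_u ht
  refine le_on_closure_pair (F := fun x y => |u t x - u t y|)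
    (G := fun x y => (5 * C₁ + 4 * M / r) * b * ‖x - y‖)
    ((hc.comp continuousOn_fst fun p hp => hp.1).sub
      (hc.comp continuousOn_snd fun p hp => hp.2)).abs (Continuous.continuousOn (by fun_prop))
    (fun x hx y hy => ?_) x hx y hy
  have hp : 0 ≤ 4 * M / r := by positivity
  rcases le_or_gt ‖x - y‖ (r / 2) with hxy | hxy
  · have := H.cone.abs_sub_le (g := u t) (g1 := dx1 (u t)) (K := C₁ * b)
      (fun y hy => H.sol.d1 t ht y (subset_closure hy)) (fun y hy w =>
        h1 t ht y (subset_closure hy) w) hx hy hxy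
    refine this.trans ?_
    calc 5 * (C₁ * b) * ‖x - y‖ = (5 * C₁ + 0) * b * ‖x - y‖ := by ring
      _ ≤ _ := by gcongr
  · have h2 := H.bdd t ht x (subset_closure hx)
    have h3 := H.bdd t ht y (subset_closure hy)
    have := abs_sub (u t x) (u t y)
    have h4 : 1 ≤ 2 / r * ‖x - y‖ := by
      rw [div_mul_eq_mul_div, le_div_iff₀ hr]; linarith
    calc |u t x - u t y| ≤ 2 * M * 1 * 1 := by linarith
      _ ≤ 2 * M * b * (2 / r * ‖x - y‖) := by gcongr
      _ = (0 + 4 * M / r) * b * ‖x - y‖ := by ring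
      _ ≤ _ := by gcongr; positivity

lemma abs_source_le (H : BddSol γ ν r N M α A D a u h S b) {C₁ : ℝ}
    (h1 : ∀ t ≥ a, ∀ x ∈ closure D, ∀ v, |dx1 (u t) x v| ≤ C₁ * b * ‖v‖) {t : ℝ} (ht : a ≤ t)
    {x : Euc d} (hx : x ∈ closure D) : |source A h u t x| ≤ (N + d * (α * C₁)) * b := by
  have hb := H.one_le
  have hN := H.N_nonneg
  unfold source
  refine (abs_sub _ _).trans ?_
  have h2 : |∑ j, deriv (fun v => A v j) (u t x) * dx1 (u t) x (ebasis d j)| ≤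
      d * (α * (C₁ * b)) := by
    refine (Finset.abs_sum_le_sum_abs _ _).trans ?_
    refine (Finset.sum_le_card_nsmul _ _ (α * (C₁ * b)) fun j _ => ?_).trans (by simp)
    rw [abs_mul]
    have h3 := h1 t ht x hx (ebasis d j)
    rw [norm_ebasis, mul_one] at h3
    exact mul_le_mul (H.A1 _ (H.bdd t ht x hx) j) h3 (abs_nonneg _) H.α_nonneg
  have h4 := H.h_bdd t ht x hx
  have h5 : N * 1 ≤ N * b := by gcongr
  linarith

/-- Differences of the source term. -/
lemma abs_source_sub_le (H : BddSol γ ν r N M α A D a u h S b) {C₁ X Y Z : ℝ}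
    (h1 : ∀ t ≥ a, ∀ x ∈ closure D, ∀ v, |dx1 (u t) x v| ≤ C₁ * b * ‖v‖) {t s : ℝ} (ht : a ≤ t)
    (hs : a ≤ s) {x y : Euc d} (hx : x ∈ closure D) (hy : y ∈ closure D)
    (hX : |h t x - h s y| ≤ X) (hY : |u t x - u s y| ≤ Y)
    (hZ : ∀ v, |dx1 (u t) x v - dx1 (u s) y v| ≤ Z * ‖v‖) :
    |source A h u t x - source A h u s y| ≤ X + d * (α * Y * (C₁ * b) + α * Z) := by
  have hα := H.α_nonneg
  have e : source A h u t x - source A h u s y = (h t x - h s y) -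
      ∑ j, ((deriv (fun v => A v j) (u t x) - deriv (fun v => A v j) (u s y)) *
        dx1 (u t) x (ebasis d j) + deriv (fun v => A v j) (u s y) *
        (dx1 (u t) x (ebasis d j) - dx1 (u s) y (ebasis d j))) := by
    unfold source
    have : ∀ j, (deriv (fun v => A v j) (u t x) - deriv (fun v => A v j) (u s y)) *
        dx1 (u t) x (ebasis d j) + deriv (fun v => A v j) (u s y) *
        (dx1 (u t) x (ebasis d j) - dx1 (u s) y (ebasis d j)) =
        deriv (fun v => A v j) (u t x) * dx1 (u t) x (ebasis d j) -
        deriv (fun v => A v j) (u s y) * dx1 (u s) y (ebasis d j) := fun j => by ring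
    simp only [this, Finset.sum_sub_distrib]
    ring
  rw [e]
  refine (abs_sub _ _).trans (add_le_add hX ?_)
  refine (Finset.abs_sum_le_sum_abs _ _).trans ?_
  refine (Finset.sum_le_card_nsmul _ _ (α * Y * (C₁ * b) + α * Z) fun j _ => ?_).trans
    (by simp [mul_add])
  refine (abs_add_le _ _).trans ?_
  rw [abs_mul, abs_mul]
  have h3 := h1 t ht x hx (ebasis d j)
  have h4 := hZ (ebasis d j)
  rw [norm_ebasis, mul_one] at h3 h4
  have h5 := H.A2 _ _ (H.bdd t ht x hx) (H.bdd s hs y hy) j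
  have h6 := H.A1 _ (H.bdd s hs y hy) j
  have h7 : α * |u t x - u s y| ≤ α * Y := by gcongr
  exact add_le_add (mul_le_mul (h5.trans h7) h3 (abs_nonneg _)
    (mul_nonneg hα ((abs_nonneg _).trans hY))) (mul_le_mul h6 h4 (abs_nonneg _) hα)

lemma abs_dtt_le (H : BddSol γ ν r N M α A D a u h S b) {C₄ : ℝ} (hC₄ : 0 ≤ C₄)
    (h4 : ∀ t ≥ a, ∀ x ∈ closure D, |source A h u t x| ≤ C₄ * b) {t : ℝ} (ht : a ≤ t)
    {x : Euc d} (hx : x ∈ closure D) : |dtt u t x| ≤ (ν * d + C₄) * b ^ 2 := by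
  have hb := H.one_le
  have h1 : |lapl (u t) x| ≤ d * b ^ 2 := by
    unfold lapl
    refine (Finset.abs_sum_le_sum_abs _ _).trans ?_
    refine (Finset.sum_le_card_nsmul _ _ (b ^ 2) fun j _ => ?_).trans (by simp)
    simpa [norm_ebasis] using H.bd2 t ht x hx (ebasis d j) (ebasis d j)
  have h2 := H.sol.pde t ht x hx
  have h3 : dtt u t x = ν * lapl (u t) x + source A h u t x := by linarith
  rw [h3]
  refine (abs_add_le _ _).trans ?_
  rw [abs_mul, abs_of_pos H.hν]
  have h5 : ν * |lapl (u t) x| ≤ ν * (d * b ^ 2) := by have := H.hν; gcongr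
  have h6 := h4 t ht x hx
  have h7 : C₄ * b ≤ C₄ * b ^ 2 := by gcongr; nlinarith
  linarith

lemma abs_time_sub_le (H : BddSol γ ν r N M α A D a u h S b) {x y : Euc d} (hx : x ∈ closure D)
    (hy : y ∈ closure D) {B : ℝ} (hB : ∀ t ≥ a, |dtt u t x - dtt u t y| ≤ B) {t s : ℝ}
    (ht : a ≤ t) (hs : a ≤ s) :
    |(u t x - u s x) - (u t y - u s y)| ≤ B * |t - s| := by
  have := Convex.norm_image_sub_le_of_norm_hasDerivWithin_le (f := fun τ => u τ x - u τ y)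
    (f' := fun τ => dtt u τ x - dtt u τ y) (s := Ici a) (x := s) (y := t) (C := B)
    (fun τ hτ => ((H.sol.dt τ hτ x hx).sub (H.sol.dt τ hτ y hy)).hasDerivWithinAt)
    (fun τ hτ => hB τ hτ) (convex_Ici a) hs ht
  rw [Real.norm_eq_abs, Real.norm_eq_abs] at this
  convert this using 2
  ring

lemma abs_time_le (H : BddSol γ ν r N M α A D a u h S b) {x : Euc d} (hx : x ∈ closure D)
    {B : ℝ} (hB : ∀ t ≥ a, |dtt u t x| ≤ B) {t s : ℝ} (ht : a ≤ t) (hs : a ≤ s) :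
    |u t x - u s x| ≤ B * |t - s| := by
  simpa using Convex.norm_image_sub_le_of_norm_hasDerivWithin_le (f := fun τ => u τ x)
    (f' := fun τ => dtt u τ x) (s := Ici a) (x := s) (y := t) (C := B)
    (fun τ hτ => (H.sol.dt τ hτ x hx).hasDerivWithinAt)
    (fun τ hτ => hB τ hτ) (convex_Ici a) hs ht

lemma abs_time_le_sqrt (H : BddSol γ ν r N M α A D a u h S b) {x : Euc d} (hx : x ∈ closure D)
    {C₅ : ℝ} (hC₅ : 0 ≤ C₅) (hB : ∀ t ≥ a, |dtt u t x| ≤ C₅ * b ^ 2) {t s : ℝ} (ht : a ≤ t)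
    (hs : a ≤ s) : |u t x - u s x| ≤ (C₅ + 2 * M) * b * √|t - s| := by
  have hb := H.one_le
  have hM := H.M_nonneg
  have h1 := H.abs_time_le hx hB ht hs
  have h2 := abs_sub (u t x) (u s x)
  have h3 := H.bdd t ht x hx
  have h4 := H.bdd s hs x hx
  have h5 := Real.sq_sqrt (abs_nonneg (t - s))
  have h6 := Real.sqrt_nonneg |t - s|
  set z := √|t - s|
  rw [← h5] at h1
  rcases le_total (b * z) 1 with hz | hz
  · have : C₅ * b ^ 2 * z ^ 2 = C₅ * (b * z) * (b * z) := by ring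
    have h7 : C₅ * (b * z) * (b * z) ≤ C₅ * (b * z) * 1 := by gcongr
    have h8 : 0 ≤ 2 * M * (b * z) := by positivity
    linarith
  · have h7 : 2 * M * 1 ≤ 2 * M * (b * z) := by gcongr
    have h8 : 0 ≤ C₅ * (b * z) := by positivity
    linarith

lemma abs_dx1_time_le (H : BddSol γ ν r N M α A D a u h S b) {C₁ C₅ : ℝ} (hC₁ : 0 ≤ C₁)
    (hC₅ : 0 ≤ C₅) (h1 : ∀ t ≥ a, ∀ x ∈ closure D, ∀ v, |dx1 (u t) x v| ≤ C₁ * b * ‖v‖)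
    (h5 : ∀ t ≥ a, ∀ x ∈ closure D, |dtt u t x| ≤ C₅ * b ^ 2) {t s : ℝ} (ht : a ≤ t)
    (hs : a ≤ s) {x : Euc d} (hx : x ∈ closure D) (v : Euc d) :
    |dx1 (u t) x v - dx1 (u s) x v| ≤
      (4 * (6 + 2 * C₅) + 2 * C₁ / r) * b ^ 2 * √|t - s| * ‖v‖ := by
  have hr := H.r_pos
  have hb := H.one_le
  rcases eq_or_ne t s with rfl | hts
  · simp
  have hz : 0 < √|t - s| := Real.sqrt_pos.2 (abs_pos.2 (sub_ne_zero.2 hts))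
  have hz2 := Real.sq_sqrt (abs_nonneg (t - s))
  refine le_on_closure (f := fun x => |dx1 (u t) x v - dx1 (u s) x v|)
    (g := fun _ => (4 * (6 + 2 * C₅) + 2 * C₁ / r) * b ^ 2 * √|t - s| * ‖v‖) (fun x hx => ?_)
    ((H.continuousOn_dx1 ht v).sub (H.continuousOn_dx1 hs v)).abs continuousOn_const hx
  set z := √|t - s|
  have hp : 0 ≤ 2 * C₁ / r := by positivity
  rcases le_or_gt z r with hzr | hzr
  · have := H.cone.abs_fderiv_le (g := fun x => u t x - u s x)
      (g1 := fun x => dx1 (u t) x - dx1 (u s) x) (g2 := fun x => dx2 (u t) x - dx2 (u s) x)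
      (K := 2 * b ^ 2) (ω := 2 * C₅ * b ^ 2 * z ^ 2) (ρ := z)
      (fun y hy => (H.sol.d1 t ht y (subset_closure hy)).sub (H.sol.d1 s hs y (subset_closure hy)))
      (fun y hy => (H.sol.d2 t ht y (subset_closure hy)).sub (H.sol.d2 s hs y (subset_closure hy)))
      (by positivity)
      (fun y hy v w => by
        have k1 := H.bd2 t ht y (subset_closure hy) v w
        have k2 := H.bd2 s hs y (subset_closure hy) v w
        have := abs_sub (dx2 (u t) y v w) (dx2 (u s) y v w)
        simp only [sub_apply]
        linarith) hx hz hzr (fun p hp _ => by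
        have k1 := H.abs_time_le (subset_closure hp) (fun t ht => h5 t ht p (subset_closure hp))
          ht hs
        have k2 := H.abs_time_le (subset_closure hx) (fun t ht => h5 t ht x (subset_closure hx))
          ht hs
        have := abs_sub (u t p - u s p) (u t x - u s x)
        rw [hz2]
        linarith) v
    simp only [sub_apply] at this
    refine this.trans ?_
    calc 4 * (3 * (2 * b ^ 2) * z + 2 * C₅ * b ^ 2 * z ^ 2 / z) * ‖v‖ =
        (4 * (6 + 2 * C₅) + 0) * b ^ 2 * z * ‖v‖ := by field_simp; ring
      _ ≤ _ := by gcongr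
  · have h2 := h1 t ht x (subset_closure hx) v
    have h3 := h1 s hs x (subset_closure hx) v
    have := abs_sub (dx1 (u t) x v) (dx1 (u s) x v)
    have h4 : 1 ≤ 1 / r * z := by
      rw [div_mul_eq_mul_div, le_div_iff₀ hr]; linarith
    have hbb : b ≤ b ^ 2 := by nlinarith
    calc |dx1 (u t) x v - dx1 (u s) x v| ≤ 2 * C₁ * b * ‖v‖ * 1 := by linarith
      _ ≤ 2 * C₁ * b ^ 2 * ‖v‖ * (1 / r * z) := by gcongr
      _ = (0 + 2 * C₁ / r) * b ^ 2 * z * ‖v‖ := by ring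
      _ ≤ _ := by gcongr; positivity

end BddSol

end

section
variable {d : ℕ}

lemma sqrt_rpow_eq {τ γ : ℝ} (hτ : 0 ≤ τ) : √τ ^ γ = τ ^ (γ / 2) := by
  rw [Real.sqrt_eq_rpow, ← Real.rpow_mul hτ]
  congr 1
  ring

namespace BddSol

variable {γ ν r N M α : ℝ} {A : ℝ → Fin d → ℝ} {D : Set (Euc d)} {a : ℝ}
  {u h : ℝ → Euc d → ℝ} {S b : ℝ}

lemma abs_dtt_sub_le (H : BddSol γ ν r N M α A D a u h S b) {C₈ : ℝ}
    (h8 : ∀ t ≥ a, ∀ x ∈ closure D, ∀ y ∈ closure D,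
      |source A h u t x - source A h u t y| ≤ C₈ * ‖x - y‖ ^ γ) {t : ℝ} (ht : a ≤ t)
    {x y : Euc d} (hx : x ∈ closure D) (hy : y ∈ closure D) :
    |dtt u t x - dtt u t y| ≤ (ν * d * S + C₈) * ‖x - y‖ ^ γ := by
  have h1 := H.sol.pde t ht x hx
  have h2 := H.sol.pde t ht y hy
  have e : dtt u t x - dtt u t y = ν * (lapl (u t) x - lapl (u t) y) +
      (source A h u t x - source A h u t y) := by linarith
  rw [e]
  refine (abs_add_le _ _).trans ?_
  rw [abs_mul, abs_of_pos H.hν]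
  have h3 : ν * |lapl (u t) x - lapl (u t) y| ≤ ν * (d * (S * ‖x - y‖ ^ γ)) := by
    have := H.hν
    gcongr
    exact (H.hol2 t ht).abs_lapl_sub_le hx hy
  have h4 := h8 t ht x hx y hy
  linarith

lemma abs_dx2_time_le (H : BddSol γ ν r N M α A D a u h S b) {Q : ℝ} (hQ : 0 ≤ Q)
    (hdt : ∀ t ≥ a, ∀ x ∈ closure D, ∀ y ∈ closure D,
      |dtt u t x - dtt u t y| ≤ Q * ‖x - y‖ ^ γ) {t s : ℝ} (ht : a ≤ t) (hs : a ≤ s)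
    {x : Euc d} (hx : x ∈ closure D) (v w : Euc d) :
    |dx2 (u t) x v w - dx2 (u s) x v w| ≤
      (128 * (2 * S + 3 * Q) + 4 / r * b ^ 2) * |t - s| ^ (γ / 2) * ‖v‖ * ‖w‖ := by
  have hr := H.r_pos
  have hb := H.one_le
  have hS := H.S_pos
  have hγ := H.hγ
  rcases eq_or_ne t s with rfl | hts
  · simp only [sub_self, abs_zero]; positivity
  have hz : 0 < √|t - s| := Real.sqrt_pos.2 (abs_pos.2 (sub_ne_zero.2 hts))
  have hz2 := Real.sq_sqrt (abs_nonneg (t - s))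
  rw [← sqrt_rpow_eq (abs_nonneg (t - s))]
  refine le_on_closure (f := fun x => |dx2 (u t) x v w - dx2 (u s) x v w|)
    (g := fun _ => (128 * (2 * S + 3 * Q) + 4 / r * b ^ 2) * √|t - s| ^ γ * ‖v‖ * ‖w‖)
    (fun x hx => ?_) (((H.hol2 t ht).continuousOn_apply hγ.1 v w).sub
      ((H.hol2 s hs).continuousOn_apply hγ.1 v w)).abs continuousOn_const hx
  set z := √|t - s|
  rcases le_or_gt (2 * z) r with hzr | hzr
  · have := H.cone.abs_fderiv₂_le (g := fun x => u t x - u s x)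
      (g1 := fun x => dx1 (u t) x - dx1 (u s) x) (g2 := fun x => dx2 (u t) x - dx2 (u s) x)
      (S := 2 * S) (ω := Q * (3 * z) ^ γ * z ^ 2) (ρ := z) hγ (by positivity)
      (fun y hy => (H.sol.d1 t ht y (subset_closure hy)).sub (H.sol.d1 s hs y (subset_closure hy)))
      (fun y hy => (H.sol.d2 t ht y (subset_closure hy)).sub (H.sol.d2 s hs y (subset_closure hy)))
      (fun y hy y' hy' v w => by
        have k1 := H.hol2 t ht y (subset_closure hy) y' (subset_closure hy') v w
        have k2 := H.hol2 s hs y (subset_closure hy) y' (subset_closure hy') v w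
        have := abs_sub (dx2 (u t) y v w - dx2 (u t) y' v w) (dx2 (u s) y v w - dx2 (u s) y' v w)
        simp only [sub_apply]
        rw [sub_sub_sub_comm]
        linarith) hx hz hzr (fun p hp hpx => by
        rw [hz2]
        refine H.abs_time_sub_le (subset_closure hp) (subset_closure hx) (fun t ht => ?_) ht hs
        refine (hdt t ht p (subset_closure hp) x (subset_closure hx)).trans ?_
        gcongr
        exact hγ.1.le) v w
    simp only [sub_apply] at this
    refine this.trans ?_
    have h3 : (3 * z) ^ γ ≤ 3 * z ^ γ := by
      rw [Real.mul_rpow (by norm_num) hz.le]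
      refine mul_le_mul_of_nonneg_right ?_ (by positivity)
      exact (Real.rpow_le_rpow_of_exponent_le (by norm_num) hγ.2.le).trans (by rw [Real.rpow_one])
    have h4 : Q * (3 * z) ^ γ * z ^ 2 / z ^ 2 ≤ Q * (3 * z ^ γ) := by
      rw [mul_div_assoc, div_self (by positivity), mul_one]
      gcongr
    calc 128 * (2 * S * z ^ γ + Q * (3 * z) ^ γ * z ^ 2 / z ^ 2) * ‖v‖ * ‖w‖ ≤
        128 * (2 * S * z ^ γ + Q * (3 * z ^ γ)) * ‖v‖ * ‖w‖ := by gcongr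
      _ = (128 * (2 * S + 3 * Q) + 0) * z ^ γ * ‖v‖ * ‖w‖ := by ring
      _ ≤ _ := by gcongr; positivity
  · have h2 := H.bd2 t ht x (subset_closure hx) v w
    have h3 := H.bd2 s hs x (subset_closure hx) v w
    have := abs_sub (dx2 (u t) x v w) (dx2 (u s) x v w)
    have h4 : 1 ≤ 2 / r * z ^ γ := by
      rw [div_mul_eq_mul_div, le_div_iff₀ hr]
      rcases le_total z 1 with h1 | h1
      · have : z ≤ z ^ γ := by
          simpa using Real.rpow_le_rpow_of_exponent_ge' hz.le h1 hγ.1.le hγ.2.le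
        linarith
      · have := Real.one_le_rpow h1 hγ.1.le
        linarith [H.r_le]
    calc |dx2 (u t) x v w - dx2 (u s) x v w| ≤ 2 * b ^ 2 * ‖v‖ * ‖w‖ * 1 := by linarith
      _ ≤ 2 * b ^ 2 * ‖v‖ * ‖w‖ * (2 / r * z ^ γ) := by gcongr
      _ = (0 + 4 / r * b ^ 2) * z ^ γ * ‖v‖ * ‖w‖ := by ring
      _ ≤ _ := by gcongr; positivity

end BddSol

set_option maxHeartbeats 1000000 in
/-- A bounded solution is controlled by the size of its second differential. -/
theorem exists_ctrl (d : ℕ) {γ ν r N M α : ℝ} (hν : 0 < ν) (hr : 0 < r) (hN : 0 ≤ N)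
    (hM : 0 ≤ M) (hα : 0 ≤ α) :
    ∃ K ≥ 0, ∃ C ≥ 1, ∀ (A : ℝ → Fin d → ℝ) (D : Set (Euc d)) (a : ℝ) (u h : ℝ → Euc d → ℝ)
      (S b : ℝ), BddSol γ ν r N M α A D a u h S b →
      Ctrl γ ν K D a u (source A h u) S (C * b ^ 2) := by
  set C₁ := 4 * (3 * r + 2 * M / r) with hC₁
  set C₂ := 5 + 4 * C₁ / r with hC₂
  set C₃ := 5 * C₁ + 4 * M / r with hC₃
  set C₄ := N + d * (α * C₁) with hC₄
  set C₅ := ν * d + C₄ with hC₅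
  set C₆ := C₅ + 2 * M with hC₆
  set C₇ := 4 * (6 + 2 * C₅) + 2 * C₁ / r with hC₇
  set C₈ := N + (d * (α * C₃ * C₁ + α * C₂) + 2 * C₄) with hC₈
  set C₉ := N + (d * (α * C₆ * C₁ + α * C₇) + 2 * C₄) with hC₉
  have p1 : 0 ≤ C₁ := by positivity
  have p2 : 0 ≤ C₂ := by positivity
  have p3 : 0 ≤ C₃ := by positivity
  have p4 : 0 ≤ C₄ := by positivity
  have p5 : 0 ≤ C₅ := by positivity
  have p6 : 0 ≤ C₆ := by positivity
  have p7 : 0 ≤ C₇ := by positivity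
  have p8 : 0 ≤ C₈ := by positivity
  have p9 : 0 ≤ C₉ := by positivity
  refine ⟨ν * d * (128 * (2 + 3 * (ν * d + 1)) + 4 / r) + 1, by positivity,
    1 + C₁ + C₂ + C₇ + C₈ + C₉, by linarith, ?_⟩
  intro A D a u h S b H
  have hb := H.one_le
  have hS := H.S_pos
  have hγ := H.hγ
  have hb2 : 1 ≤ b ^ 2 := one_le_pow₀ hb
  have hbb : b ≤ b ^ 2 := by nlinarith
  set W := (1 + C₁ + C₂ + C₇ + C₈ + C₉) * b ^ 2 with hW
  have hle : ∀ Z, Z ≤ 1 + C₁ + C₂ + C₇ + C₈ + C₉ → Z * b ^ 2 ≤ W := fun Z hZ => by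
    rw [hW]; gcongr
  have w0 : b ^ 2 ≤ W := by simpa using hle 1 (by linarith)
  have w1 : C₁ * b ^ 2 ≤ W := hle _ (by linarith)
  have w2 : C₂ * b ^ 2 ≤ W := hle _ (by linarith)
  have w7 : C₇ * b ^ 2 ≤ W := hle _ (by linarith)
  have w8 : C₈ * b ^ 2 ≤ W := hle _ (by linarith)
  have w9 : C₉ * b ^ 2 ≤ W := hle _ (by linarith)
  have hWpos : 0 < W := by linarith
  have h1 : ∀ t ≥ a, ∀ x ∈ closure D, ∀ v, |dx1 (u t) x v| ≤ C₁ * b * ‖v‖ :=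
    fun t ht x hx v => H.abs_dx1_le ht hx v
  have h2 : ∀ t ≥ a, ∀ x ∈ closure D, ∀ y ∈ closure D, ∀ v,
      |dx1 (u t) x v - dx1 (u t) y v| ≤ C₂ * b ^ 2 * ‖x - y‖ * ‖v‖ :=
    fun t ht x hx y hy v => H.abs_dx1_sub_le p1 h1 ht hx hy v
  have h3 : ∀ t ≥ a, ∀ x ∈ closure D, ∀ y ∈ closure D, |u t x - u t y| ≤ C₃ * b * ‖x - y‖ :=
    fun t ht x hx y hy => H.abs_sub_le p1 h1 ht hx hy
  have h4 : ∀ t ≥ a, ∀ x ∈ closure D, |source A h u t x| ≤ C₄ * b :=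
    fun t ht x hx => H.abs_source_le h1 ht hx
  have h5 : ∀ t ≥ a, ∀ x ∈ closure D, |dtt u t x| ≤ C₅ * b ^ 2 :=
    fun t ht x hx => H.abs_dtt_le p4 h4 ht hx
  have h6 : ∀ t ≥ a, ∀ s ≥ a, ∀ x ∈ closure D, |u t x - u s x| ≤ C₆ * b * √|t - s| :=
    fun t ht s hs x hx => H.abs_time_le_sqrt hx p5 (fun t ht => h5 t ht x hx) ht hs
  have h7 : ∀ t ≥ a, ∀ s ≥ a, ∀ x ∈ closure D, ∀ v,
      |dx1 (u t) x v - dx1 (u s) x v| ≤ C₇ * b ^ 2 * √|t - s| * ‖v‖ :=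
    fun t ht s hs x hx v => H.abs_dx1_time_le p1 p5 h1 h5 ht hs hx v
  have hF : ∀ t ≥ a, ∀ s ≥ a, ∀ x ∈ closure D, ∀ y ∈ closure D,
      |source A h u t x - source A h u s y| ≤ 2 * C₄ * b ^ 2 := fun t ht s hs x hx y hy => by
    have k1 := h4 t ht x hx
    have k2 := h4 s hs y hy
    have k3 := abs_sub (source A h u t x) (source A h u s y)
    have k4 : C₄ * b ≤ C₄ * b ^ 2 := by gcongr
    linarith
  have h8 : ∀ t ≥ a, ∀ x ∈ closure D, ∀ y ∈ closure D,
      |source A h u t x - source A h u t y| ≤ C₈ * b ^ 2 * ‖x - y‖ ^ γ := by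
    intro t ht x hx y hy
    have k1 := H.abs_source_sub_le (X := N * ‖x - y‖ ^ γ) (Y := C₃ * b * ‖x - y‖)
      (Z := C₂ * b ^ 2 * ‖x - y‖) h1 ht ht hx hy (H.h_space t ht x hx y hy) (h3 t ht x hx y hy)
      (h2 t ht x hx y hy)
    have k2 := le_rpow_of_le_of_le (ρ := ‖x - y‖)
      (F := |source A h u t x - source A h u t y| - N * ‖x - y‖ ^ γ)
      (P := d * (α * C₃ * C₁ + α * C₂) * b ^ 2) (Q := 2 * C₄ * b ^ 2) hγ (norm_nonneg _)
      (by positivity) (by positivity) (by linarith)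
      (by
        have : 0 ≤ N * ‖x - y‖ ^ γ := by positivity
        linarith [hF t ht t ht x hx y hy])
    have k3 : N * ‖x - y‖ ^ γ * 1 ≤ N * ‖x - y‖ ^ γ * b ^ 2 := by gcongr
    rw [hC₈]
    linarith
  have h9 : ∀ t ≥ a, ∀ s ≥ a, ∀ x ∈ closure D,
      |source A h u t x - source A h u s x| ≤ C₉ * b ^ 2 * |t - s| ^ (γ / 2) := by
    intro t ht s hs x hx
    have k1 := H.abs_source_sub_le (X := N * |t - s| ^ (γ / 2)) (Y := C₆ * b * √|t - s|)
      (Z := C₇ * b ^ 2 * √|t - s|) h1 ht hs hx hx (H.h_time t ht s hs x hx) (h6 t ht s hs x hx)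
      (h7 t ht s hs x hx)
    have k2 := le_rpow_of_le_of_le (ρ := √|t - s|)
      (F := |source A h u t x - source A h u s x| - N * |t - s| ^ (γ / 2))
      (P := d * (α * C₆ * C₁ + α * C₇) * b ^ 2) (Q := 2 * C₄ * b ^ 2) hγ (Real.sqrt_nonneg _)
      (by positivity) (by positivity) (by linarith)
      (by
        have : 0 ≤ N * |t - s| ^ (γ / 2) := by positivity
        linarith [hF t ht s hs x hx x hx])
    rw [sqrt_rpow_eq (abs_nonneg _)] at k2
    have k3 : N * |t - s| ^ (γ / 2) * 1 ≤ N * |t - s| ^ (γ / 2) * b ^ 2 := by gcongr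
    rw [hC₉]
    linarith
  have h10 : ∀ t ≥ a, ∀ x ∈ closure D, ∀ y ∈ closure D,
      |dtt u t x - dtt u t y| ≤ (ν * d * S + W) * ‖x - y‖ ^ γ := fun t ht x hx y hy => by
    refine (H.abs_dtt_sub_le h8 ht hx hy).trans ?_
    gcongr
  have h11 : ∀ t ≥ a, ∀ s ≥ a, ∀ x ∈ closure D, |lapl (u t) x - lapl (u s) x| ≤
      d * ((128 * (2 + 3 * (ν * d + 1)) + 4 / r) * (S + W) * |t - s| ^ (γ / 2)) := by
    intro t ht s hs x hx
    unfold lapl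
    rw [← Finset.sum_sub_distrib]
    refine (Finset.abs_sum_le_sum_abs _ _).trans ?_
    refine (Finset.sum_le_card_nsmul _ _ ((128 * (2 + 3 * (ν * d + 1)) + 4 / r) * (S + W) *
      |t - s| ^ (γ / 2)) fun j _ => ?_).trans (by simp)
    have k := H.abs_dx2_time_le (Q := ν * d * S + W) (by positivity) h10 ht hs hx
      (ebasis d j) (ebasis d j)
    rw [norm_ebasis, mul_one, mul_one] at k
    refine k.trans (mul_le_mul_of_nonneg_right ?_ (by positivity))
    have k1 : 4 / r * b ^ 2 ≤ 4 / r * (S + W) := by gcongr; linarith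
    have k2 : 0 ≤ ν * d * W := by positivity
    nlinarith
  refine ⟨H.sol, hS, hWpos, H.hol2, fun t ht x hx v => (h1 t ht x hx v).trans ?_,
    fun t ht x hx y hy v => (h2 t ht x hx y hy v).trans (by gcongr),
    fun t ht s hs x hx v => (h7 t ht s hs x hx v).trans (by gcongr),
    fun t ht x hx y hy => (h8 t ht x hx y hy).trans (by gcongr),
    fun t ht s hs x hx => (h9 t ht s hs x hx).trans (by gcongr), fun t ht s hs x hx => ?_⟩
  · gcongr
    refine le_trans ?_ w1
    gcongr
  · have k1 := H.sol.pde t ht x hx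
    have k2 := H.sol.pde s hs x hx
    have e : dtt u t x - dtt u s x = ν * (lapl (u t) x - lapl (u s) x) +
      (source A h u t x - source A h u s x) := by linarith
    rw [e]
    refine (abs_add_le _ _).trans ?_
    rw [abs_mul, abs_of_pos hν]
    have k3 : ν * |lapl (u t) x - lapl (u s) x| ≤ ν * (d * ((128 * (2 + 3 * (ν * d + 1)) + 4 / r) *
      (S + W) * |t - s| ^ (γ / 2))) := by
      gcongr
      exact h11 t ht s hs x hx
    have k4 := h9 t ht s hs x hx
    have k5 : C₉ * b ^ 2 * |t - s| ^ (γ / 2) ≤ (S + W) * |t - s| ^ (γ / 2) := by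
      gcongr
      linarith
    linarith

end

section
variable {d : ℕ}

lemma HolAt.mono {γ S S' : ℝ} {D : Set (Euc d)} {g : Euc d → ℝ} (h : HolAt γ D g S)
    (hS : S ≤ S') : HolAt γ D g S' := fun x hx y hy v w => (h x hx y hy v w).trans (by gcongr)

/-- A bounded solution of the equation on `[a, ∞)` with quantitative bounds on the data, the
second differential being Hölder continuous uniformly in time. -/
structure BaseSol (γ ν r N M α : ℝ) (A : ℝ → Fin d → ℝ) (D : Set (Euc d)) (a : ℝ)
    (u h : ℝ → Euc d → ℝ) : Prop where
  hγ : γ ∈ Ioo (0:ℝ) 1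
  hν : 0 < ν
  cone : ConeCond D r
  r_pos : 0 < r
  r_le : r ≤ 1
  N_nonneg : 0 ≤ N
  M_nonneg : 0 ≤ M
  α_nonneg : 0 ≤ α
  sol : IsSol ν D a u (source A h u)
  bdd : ∀ t ≥ a, ∀ x ∈ closure D, |u t x| ≤ M
  h_bdd : ∀ t ≥ a, ∀ x ∈ closure D, |h t x| ≤ N
  h_space : ∀ t ≥ a, ∀ x ∈ closure D, ∀ y ∈ closure D, |h t x - h t y| ≤ N * ‖x - y‖ ^ γ
  h_time : ∀ t ≥ a, ∀ s ≥ a, ∀ x ∈ closure D, |h t x - h s x| ≤ N * |t - s| ^ (γ / 2)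
  A1 : ∀ v, |v| ≤ M → ∀ j, |deriv (fun v => A v j) v| ≤ α
  A2 : ∀ v w, |v| ≤ M → |w| ≤ M → ∀ j,
    |deriv (fun v => A v j) v - deriv (fun v => A v j) w| ≤ α * |v - w|

namespace BaseSol

variable {γ ν r N M α : ℝ} {A : ℝ → Fin d → ℝ} {D : Set (Euc d)} {a : ℝ}
  {u h : ℝ → Euc d → ℝ}

lemma mono (H : BaseSol γ ν r N M α A D a u h) {a' : ℝ} (ha : a ≤ a') :
    BaseSol γ ν r N M α A D a' u h where
  hγ := H.hγ
  hν := H.hν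
  cone := H.cone
  r_pos := H.r_pos
  r_le := H.r_le
  N_nonneg := H.N_nonneg
  M_nonneg := H.M_nonneg
  α_nonneg := H.α_nonneg
  sol := ⟨fun t ht => H.sol.d1 t (ha.trans ht), fun t ht => H.sol.d2 t (ha.trans ht),
    fun t ht => H.sol.dt t (ha.trans ht),
    H.sol.cont.mono (prod_mono (Ici_subset_Ici.2 ha) subset_rfl),
    fun t ht => H.sol.pde t (ha.trans ht), fun t ht => H.sol.bc t (ha.trans ht)⟩
  bdd t ht := H.bdd t (ha.trans ht)
  h_bdd t ht := H.h_bdd t (ha.trans ht)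
  h_space t ht := H.h_space t (ha.trans ht)
  h_time t ht s hs := H.h_time t (ha.trans ht) s (ha.trans hs)
  A1 := H.A1
  A2 := H.A2

/-- Interpolation of the second differential. -/
lemma abs_dx2_le (H : BaseSol γ ν r N M α A D a u h) {S : ℝ} (hS : 0 < S) {t : ℝ} (ht : a ≤ t)
    (hol : HolAt γ D (u t) S) {ρ : ℝ} (hρ : 0 < ρ) (hρr : 2 * ρ ≤ r) {x : Euc d}
    (hx : x ∈ closure D) (v w : Euc d) :
    |dx2 (u t) x v w| ≤ 128 * (S * ρ ^ γ + 2 * M / ρ ^ 2) * ‖v‖ * ‖w‖ := by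
  refine le_on_closure (f := fun x => |dx2 (u t) x v w|)
    (g := fun _ => 128 * (S * ρ ^ γ + 2 * M / ρ ^ 2) * ‖v‖ * ‖w‖) (fun x hx => ?_)
    (hol.continuousOn_apply H.hγ.1 v w).abs continuousOn_const hx
  exact H.cone.abs_fderiv₂_le (g := u t) (g1 := dx1 (u t)) (g2 := dx2 (u t)) H.hγ hS.le
    (fun y hy => H.sol.d1 t ht y (subset_closure hy))
    (fun y hy => H.sol.d2 t ht y (subset_closure hy))
    (fun y hy y' hy' => hol y (subset_closure hy) y' (subset_closure hy')) hx hρ hρr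
    (fun p hp _ => by
      have h1 := H.bdd t ht p (subset_closure hp)
      have h2 := H.bdd t ht x (subset_closure hx)
      have := abs_sub (u t p) (u t x)
      linarith) v w

lemma bddSol (H : BaseSol γ ν r N M α A D a u h) {S : ℝ} (hS : 0 < S)
    (hol : ∀ t ≥ a, HolAt γ D (u t) S) {ρ : ℝ} (hρ : 0 < ρ) (hρr : 2 * ρ ≤ r) :
    BddSol γ ν r N M α A D a u h S √(1 + 128 * (S * ρ ^ γ + 2 * M / ρ ^ 2)) := by
  have hM := H.M_nonneg
  have hp : 0 ≤ 128 * (S * ρ ^ γ + 2 * M / ρ ^ 2) := by positivity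
  refine ⟨H.hγ, H.hν, H.cone, H.r_pos, H.r_le, H.N_nonneg, H.M_nonneg, H.α_nonneg, hS, ?_, H.sol,
    H.bdd, H.h_bdd, H.h_space, H.h_time, hol, fun t ht x hx v w => ?_, H.A1, H.A2⟩
  · rw [Real.one_le_sqrt]; linarith
  · rw [Real.sq_sqrt (by linarith)]
    refine (H.abs_dx2_le hS ht (hol t ht) hρ hρr hx v w).trans ?_
    gcongr
    linarith

end BaseSol

set_option maxHeartbeats 1000000 in
/-- The Hölder constant of the second differential at time `t` in terms of a small multiple of its
supremum over `[a, ∞)`. -/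
theorem exists_holAt_absorb {γ ν r N M α r₁ M₁ : ℝ} (hγ : γ ∈ Ioo (0:ℝ) 1) (hν : 0 < ν)
    (hr : 0 < r) (hN : 0 ≤ N) (hM : 0 ≤ M) (hα : 0 ≤ α) (hM₁ : 1 ≤ M₁) (hr₁ : 0 < r₁)
    (hr₁2 : r₁ ≤ 1 / 2) {D : Set (Euc d)} (hD : IsOpen D) (hch : HasCharts D r₁ M₁) {θ : ℝ}
    (hθ : 0 < θ) :
    ∃ C > 0, ∀ (A : ℝ → Fin d → ℝ) (a : ℝ) (u h : ℝ → Euc d → ℝ) (S t : ℝ),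
      BaseSol γ ν r N M α A D a u h → 0 < S → (∀ t ≥ a, HolAt γ D (u t) S) → a ≤ t →
      ∀ S₀ ≥ 0, ∀ s, 0 < s → s ≤ 1 → (a + s ≤ t ∨ HolAt γ D (u a) S₀) →
      HolAt γ D (u t) (θ * S + C / s ^ (⌈1 / γ⌉₊ + 1) * (1 + S₀)) := by
  obtain ⟨K, hK, C₁, hC₁, H₁⟩ := exists_ctrl d (γ := γ) hν hr hN hM hα
  obtain ⟨C₂, hC₂, H₂⟩ := exists_holAt_bound hγ hν hK hM₁ hr₁ hr₁2 hD hch (θ := θ / 2)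
    (by positivity)
  set n := ⌈1 / γ⌉₊ with hn
  have hC₁0 : 0 < C₁ := by linarith
  obtain ⟨κ₀, hκ₀, -, hκ₀γ, -⟩ := exists_small_params hγ (θ := θ / 2 / (128 * C₂ * C₁))
    (by positivity)
  set κ := min κ₀ (r / 2) with hκ
  have hκpos : 0 < κ := by positivity
  have hκγ : 128 * C₂ * C₁ * κ ^ γ ≤ θ / 2 := by
    have h1 : κ ^ γ ≤ (3 * κ₀) ^ γ :=
      Real.rpow_le_rpow hκpos.le ((min_le_left _ _).trans (by linarith)) hγ.1.le
    have := h1.trans hκ₀γ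
    rw [le_div_iff₀ (by positivity)] at this
    linarith
  refine ⟨C₂ * (C₁ * (1 + 256 * M / κ ^ 2) + 1), by positivity, ?_⟩
  intro A a u h S t H hS hol hat S₀ hS₀ s hs hs1 halt
  set δ := √s with hδ
  have hδ0 : 0 < δ := Real.sqrt_pos.2 hs
  have hδ1 : δ ≤ 1 := Real.sqrt_le_one.2 hs1
  have hδ2 : δ ^ 2 = s := Real.sq_sqrt hs.le
  set ρ := κ * δ ^ n with hρ
  have hρ0 : 0 < ρ := by positivity
  have hρr : 2 * ρ ≤ r := by
    have h1 : δ ^ n ≤ 1 := pow_le_one₀ hδ0.le hδ1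
    have h2 : κ * δ ^ n ≤ κ * 1 := by gcongr
    have h3 : κ ≤ r / 2 := min_le_right _ _
    linarith
  have hB := H.bddSol hS hol hρ0 hρr
  have hp : 0 ≤ 128 * (S * ρ ^ γ + 2 * M / ρ ^ 2) := by positivity
  have hC := H₁ A D a u h S _ hB
  have key := H₂ a u _ S _ t hC hat (fun x hx v w => by
    refine (hB.bd2 t hat x (subset_closure hx) v w).trans ?_
    gcongr
    exact le_mul_of_one_le_left (by positivity) hC₁) S₀ hS₀ δ hδ0 hδ1 (by rwa [hδ2])
  rw [Real.sq_sqrt (by linarith)] at key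
  refine key.mono ?_
  have e1 : ρ ^ γ ≤ κ ^ γ * δ := by
    rw [hρ, Real.mul_rpow hκpos.le (by positivity)]
    gcongr
    rw [← Real.rpow_natCast, ← Real.rpow_mul hδ0.le]
    have h1 : 1 ≤ (n : ℝ) * γ := by
      have := Nat.le_ceil (1 / γ)
      rw [← hn, div_le_iff₀ hγ.1] at this
      exact this
    simpa using Real.rpow_le_rpow_of_exponent_ge hδ0 hδ1 h1
  have e2 : C₂ / δ * (C₁ * (128 * (S * ρ ^ γ))) ≤ θ / 2 * S := by
    calc C₂ / δ * (C₁ * (128 * (S * ρ ^ γ))) ≤ C₂ / δ * (C₁ * (128 * (S * (κ ^ γ * δ)))) := by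
          gcongr
      _ = (128 * C₂ * C₁ * κ ^ γ) * S := by field_simp
      _ ≤ _ := by gcongr
  have e3 : s ^ (n + 1) = δ * (δ * (δ ^ n) ^ 2) := by rw [← hδ2]; ring
  have hδn : δ * (δ ^ n) ^ 2 ≤ 1 :=
    mul_le_one₀ hδ1 (by positivity) (pow_le_one₀ (by positivity) (pow_le_one₀ hδ0.le hδ1))
  have hδn2 : δ ≤ 1 := hδ1
  have e4 : C₁ * (1 + 256 * M / ρ ^ 2) + S₀ ≤
      (C₁ * (1 + 256 * M / κ ^ 2) + 1) * (1 + S₀) / (δ * (δ ^ n) ^ 2) := by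
    rw [le_div_iff₀ (by positivity)]
    have f1 : 256 * M / ρ ^ 2 * (δ * (δ ^ n) ^ 2) = 256 * M / κ ^ 2 * δ := by
      rw [hρ]; field_simp
    have f2 : 256 * M / κ ^ 2 * δ ≤ 256 * M / κ ^ 2 * 1 := by gcongr
    have f3 : (C₁ + S₀) * (δ * (δ ^ n) ^ 2) ≤ (C₁ + S₀) * 1 := by gcongr
    have f4 : 0 ≤ (C₁ * (1 + 256 * M / κ ^ 2)) * S₀ := by positivity
    have f5 : (C₁ * (1 + 256 * M / ρ ^ 2) + S₀) * (δ * (δ ^ n) ^ 2) =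
      (C₁ + S₀) * (δ * (δ ^ n) ^ 2) + C₁ * (256 * M / ρ ^ 2 * (δ * (δ ^ n) ^ 2)) := by ring
    rw [f5, f1]
    have f6 : C₁ * (256 * M / κ ^ 2 * δ) ≤ C₁ * (256 * M / κ ^ 2 * 1) := by gcongr
    linarith
  have e5 : C₂ / δ * (C₁ * (1 + 256 * M / ρ ^ 2) + S₀) ≤
      C₂ * (C₁ * (1 + 256 * M / κ ^ 2) + 1) / s ^ (n + 1) * (1 + S₀) := by
    refine (mul_le_mul_of_nonneg_left e4 (by positivity)).trans (le_of_eq ?_)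
    rw [e3]
    field_simp
  have e6 : 2 * M / ρ ^ 2 * 128 = 256 * M / ρ ^ 2 := by ring
  have e7 : C₂ / δ * (C₁ * (1 + 128 * (S * ρ ^ γ + 2 * M / ρ ^ 2)) + S₀) =
      C₂ / δ * (C₁ * (128 * (S * ρ ^ γ))) + C₂ / δ * (C₁ * (1 + 256 * M / ρ ^ 2) + S₀) := by
    rw [← e6]; ring
  rw [e7]
  linarith

/-- Iterating `B ↦ B / 2 + C` inside an upward closed set. -/
lemma mem_of_half_iterate {V : Set ℝ} {C : ℝ} (hup : ∀ B ∈ V, ∀ B', B ≤ B' → B' ∈ V)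
    (hne : ∃ B, B ∈ V) (hV : ∀ B ∈ V, 0 < B → B / 2 + C ∈ V) (hC : 0 ≤ C) : 2 * C + 1 ∈ V := by
  obtain ⟨B, hB⟩ := hne
  have h1 : ∀ n : ℕ, 2 * C + (|B| + 1) / 2 ^ n ∈ V := by
    intro n
    induction n with
    | zero => exact hup B hB _ (by simp; linarith [le_abs_self B])
    | succ n ih =>
      have := hV _ ih (by positivity)
      convert this using 1
      rw [pow_succ]
      field_simp
      ring
  obtain ⟨n, hn⟩ := pow_unbounded_of_one_lt (|B| + 1) (one_lt_two (α := ℝ))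
  refine hup _ (h1 n) _ ?_
  have : (|B| + 1) / 2 ^ n ≤ 1 := by
    rw [div_le_iff₀ (by positivity)]; linarith
  linarith

/-- The Hölder constant of the second differential, in terms of the initial datum. -/
theorem exists_holAt_of_initial {γ ν r N M α r₁ M₁ : ℝ} (hγ : γ ∈ Ioo (0:ℝ) 1) (hν : 0 < ν)
    (hr : 0 < r) (hN : 0 ≤ N) (hM : 0 ≤ M) (hα : 0 ≤ α) (hM₁ : 1 ≤ M₁) (hr₁ : 0 < r₁)
    (hr₁2 : r₁ ≤ 1 / 2) {D : Set (Euc d)} (hD : IsOpen D) (hch : HasCharts D r₁ M₁) {S₀ : ℝ}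
    (hS₀ : 0 ≤ S₀) :
    ∃ C > 0, ∀ (A : ℝ → Fin d → ℝ) (a : ℝ) (u h : ℝ → Euc d → ℝ),
      BaseSol γ ν r N M α A D a u h → (∃ S, ∀ t ≥ a, HolAt γ D (u t) S) →
      HolAt γ D (u a) S₀ → ∀ t ≥ a, HolAt γ D (u t) C := by
  obtain ⟨C, hC, H⟩ := exists_holAt_absorb hγ hν hr hN hM hα hM₁ hr₁ hr₁2 hD hch (θ := 1 / 2)
    (by norm_num)
  refine ⟨2 * (C * (1 + S₀)) + 1, by positivity, fun A a u h hb hne h0 => ?_⟩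
  refine mem_of_half_iterate (V := {S | ∀ t ≥ a, HolAt γ D (u t) S})
    (fun B hB B' hBB t ht => (hB t ht).mono hBB) hne (fun B hB hB0 t ht => ?_) (by positivity)
  refine (H A a u h B t hb hB0 hB ht S₀ hS₀ 1 one_pos le_rfl (Or.inr h0)).mono ?_
  rw [one_pow, div_one]
  linarith

/-- The Hölder constant of the second differential after a positive time. -/
theorem exists_holAt_of_pos {γ ν r N M α r₁ M₁ : ℝ} (hγ : γ ∈ Ioo (0:ℝ) 1) (hν : 0 < ν)
    (hr : 0 < r) (hN : 0 ≤ N) (hM : 0 ≤ M) (hα : 0 ≤ α) (hM₁ : 1 ≤ M₁) (hr₁ : 0 < r₁)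
    (hr₁2 : r₁ ≤ 1 / 2) {D : Set (Euc d)} (hD : IsOpen D) (hch : HasCharts D r₁ M₁) {τ : ℝ}
    (hτ : 0 < τ) :
    ∃ C > 0, ∀ (A : ℝ → Fin d → ℝ) (a : ℝ) (u h : ℝ → Euc d → ℝ),
      BaseSol γ ν r N M α A D a u h → (∃ S, ∀ t ≥ a, HolAt γ D (u t) S) →
      ∀ t ≥ a + τ, HolAt γ D (u t) C := by
  set k := ⌈1 / γ⌉₊ + 1 with hk
  obtain ⟨C, hC, H⟩ := exists_holAt_absorb hγ hν hr hN hM hα hM₁ hr₁ hr₁2 hD hch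
    (θ := 1 / 2 / 2 ^ k) (by positivity)
  refine ⟨(2 * (C * 2 ^ k) + 1) / (min τ 1) ^ k, by positivity, fun A a u h hb hne t ht => ?_⟩
  have key : 2 * (C * 2 ^ k) + 1 ∈ {B | ∀ t > a, HolAt γ D (u t) (B / (min (t - a) 1) ^ k)} := by
    refine mem_of_half_iterate (fun B hB B' hBB t ht => (hB t ht).mono ?_) ?_
      (fun B hB hB0 t ht => ?_) (by positivity)
    · have : 0 < min (t - a) 1 := lt_min (by linarith) one_pos
      gcongr
    · obtain ⟨S, hS⟩ := hne
      refine ⟨|S|, fun t ht => (hS t ht.le).mono ((le_abs_self S).trans ?_)⟩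
      have h1 : 0 < min (t - a) 1 := lt_min (by linarith [show a < t from ht]) one_pos
      rw [le_div_iff₀ (by positivity)]
      exact mul_le_of_le_one_right (abs_nonneg _) (pow_le_one₀ h1.le (min_le_right _ _))
    · have hta : a < t := ht
      set φ := min (t - a) 1 with hφ
      have hφ0 : 0 < φ := lt_min (by linarith) one_pos
      have hφ1 : φ ≤ 1 := min_le_right _ _
      have hφt : φ ≤ t - a := min_le_left _ _
      have h2 : a ≤ (a + t) / 2 := by linarith
      refine (H A ((a + t) / 2) u h (B / (φ / 2) ^ k) t (hb.mono h2) (by positivity)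
        (fun s hs => (hB s (by linarith [show (a + t) / 2 ≤ s from hs])).mono ?_) (by linarith)
        0 le_rfl (φ / 2) (by positivity) (by linarith) (Or.inl (by linarith))).mono ?_
      · have : φ / 2 ≤ min (s - a) 1 := by
          have : (a + t) / 2 ≤ s := hs
          exact le_min (by linarith) (by linarith)
        gcongr
      · rw [← hk, div_pow]
        refine le_of_eq ?_
        field_simp
        ring
  have hta : a < t := by linarith [show a + τ ≤ t from ht]
  refine (key t hta).mono ?_
  have h1 : min τ 1 ≤ min (t - a) 1 := min_le_min_right _ (by linarith [show a + τ ≤ t from ht])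
  gcongr

end

section
variable {d : ℕ}

lemma parHolderBound_of_space_time {Y : Type*} [NormedAddCommGroup Y] {γ B : ℝ} {J : Set ℝ}
    {D : Set (Euc d)} {f : ℝ → Euc d → Y} (h0 : ∀ t ∈ J, ∀ x ∈ closure D, ‖f t x‖ ≤ B)
    (h1 : ∀ t ∈ J, ∀ x ∈ closure D, ∀ y ∈ closure D, ‖f t x - f t y‖ ≤ B * ‖x - y‖ ^ γ)
    (h2 : ∀ t ∈ J, ∀ s ∈ J, ∀ x ∈ closure D, ‖f t x - f s x‖ ≤ B * |t - s| ^ (γ / 2)) :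
    parHolderBound γ J D f B := by
  refine ⟨h0, fun t ht s hs x hx y hy => ?_⟩
  have := norm_sub_le_norm_sub_add_norm_sub (f t x) (f t y) (f s y)
  linarith [h1 t ht x hx y hy, h2 t ht s hs y hy]

lemma parHolderBound.shift {Y : Type*} [NormedAddCommGroup Y] {γ B a : ℝ}
    {D : Set (Euc d)} {f : ℝ → Euc d → Y} (h : parHolderBound γ (Ici a) D f B) :
    parHolderBound γ (Ici 0) D (fun t => f (a + t)) B := by
  have ha : ∀ t ∈ Ici (0:ℝ), a + t ∈ Ici a := fun t ht => by
    have : (0:ℝ) ≤ t := ht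
    exact mem_Ici.2 (by linarith)
  refine ⟨fun t ht => h.1 _ (ha t ht), fun t ht s hs x hx y hy => ?_⟩
  have := h.2 _ (ha t ht) _ (ha s hs) x hx y hy
  rwa [add_sub_add_left_eq_sub] at this

lemma XgammaBound.shift {γ B a : ℝ} {D : Set (Euc d)} {u : ℝ → Euc d → ℝ}
    (h : XgammaBound γ (Ici a) D u B) : XgammaBound γ (Ici 0) D (fun t x => u (a + t) x) B := by
  obtain ⟨h1, h2, h3, h4⟩ := h
  have e : (fun t x => dtt (fun t x => u (a + t) x) t x) = fun t x => dtt u (a + t) x := by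
    funext t x
    exact deriv_comp_const_add (f := fun s => u s x) a t
  refine ⟨fun t ht => h1 _ ?_, ?_, h3.shift, h4.shift⟩
  · have : (0:ℝ) ≤ t := ht
    exact mem_Ici.2 (by linarith)
  · rw [e]; exact h2.shift

set_option maxHeartbeats 1000000 in
/-- Uniform Hölder continuity of the second differential gives a full `X^γ` bound. -/
theorem exists_xgammaBound (d : ℕ) {γ ν r N M α S : ℝ} (hγ : γ ∈ Ioo (0:ℝ) 1) (hν : 0 < ν)
    (hr : 0 < r) (hN : 0 ≤ N) (hM : 0 ≤ M) (hα : 0 ≤ α) (hS : 0 < S) :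
    ∃ B > 0, ∀ (A : ℝ → Fin d → ℝ) (D : Set (Euc d)) (a : ℝ) (u h : ℝ → Euc d → ℝ),
      BaseSol γ ν r N M α A D a u h → (∀ t ≥ a, HolAt γ D (u t) S) →
      XgammaBound γ (Ici a) D u B := by
  obtain ⟨K, hK, C, hC, H⟩ := exists_ctrl d (γ := γ) hν hr hN hM hα
  set b := √(1 + 128 * (S * (r / 2) ^ γ + 2 * M / (r / 2) ^ 2)) with hb
  set W := C * b ^ 2 with hW
  set C₁ := 4 * (3 * r + 2 * M / r) with hC₁
  set C₄ := N + d * (α * C₁) with hC₄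
  have p1 : 0 ≤ C₁ := by positivity
  have p4 : 0 ≤ C₄ := by positivity
  have pW : 0 ≤ W := by positivity
  set B1 := (ν * d + C₄) * b ^ 2 with hB1
  set B2 := ν * d * S + W with hB2
  set B3 := 128 * (2 * S + 3 * B2) + 4 / r * b ^ 2 with hB3
  have pB1 : 0 ≤ B1 := by positivity
  have pB2 : 0 ≤ B2 := by positivity
  have pB3 : 0 ≤ B3 := by positivity
  have pb : 0 ≤ b ^ 2 := by positivity
  have pK : 0 ≤ K * (S + W) := by positivity
  set B := 1 + M + B1 + B2 + K * (S + W) + 3 * W + b ^ 2 + S + B3 with hB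
  refine ⟨B, by positivity, ?_⟩
  intro A D a u h hbase hol
  have HB := hbase.bddSol hS hol (ρ := r / 2) (by positivity) (by linarith)
  rw [← hb] at HB
  have HC := H A D a u h S b HB
  rw [← hW] at HC
  have pB : 0 ≤ B := by positivity
  have h4 : ∀ t ≥ a, ∀ x ∈ closure D, |source A h u t x| ≤ C₄ * b := fun t ht x hx =>
    HB.abs_source_le (fun t ht x hx v => HB.abs_dx1_le ht hx v) ht hx
  have hdt : ∀ t ≥ a, ∀ x ∈ closure D, ∀ y ∈ closure D,
      |dtt u t x - dtt u t y| ≤ B2 * ‖x - y‖ ^ γ := fun t ht x hx y hy =>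
    HC.dtt_space hν ht (hol t ht) hx hy
  have tab : ∀ t s : ℝ, √|t - s| ^ γ = |t - s| ^ (γ / 2) := fun t s => sqrt_rpow_eq (abs_nonneg _)
  have d1diff : ∀ t ≥ a, ∀ s ≥ a, ∀ x ∈ closure D, ∀ y ∈ closure D, ∀ v,
      |dx1 (u t) x v - dx1 (u s) y v| ≤ 2 * W * ‖v‖ := fun t ht s hs x hx y hy v => by
    have k1 := HC.bd1 t ht x hx v
    have k2 := HC.bd1 s hs y hy v
    have k3 := abs_sub (dx1 (u t) x v) (dx1 (u s) y v)
    linarith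
  refine ⟨fun t ht x hx => (hbase.bdd t ht x hx).trans (by linarith), ?_, ?_, ?_⟩
  · refine parHolderBound_of_space_time (fun t ht x hx => ?_) (fun t ht x hx y hy => ?_)
      fun t ht s hs x hx => ?_
    · exact (HB.abs_dtt_le p4 h4 ht hx).trans (by linarith)
    · refine (hdt t ht x hx y hy).trans ?_
      gcongr
      linarith
    · refine (HC.dtt_time t ht s hs x hx).trans ?_
      gcongr
      linarith
  · refine parHolderBound_of_space_time (fun t ht x hx => ?_) (fun t ht x hx y hy => ?_)
      fun t ht s hs x hx => ?_
    · refine ContinuousLinearMap.opNorm_le_bound _ pB fun v => ?_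
      refine (HC.bd1 t ht x hx v).trans ?_
      gcongr
      linarith
    · refine ContinuousLinearMap.opNorm_le_bound _ (by positivity) fun v => ?_
      have k := le_rpow_of_le_of_le (ρ := ‖x - y‖) (F := |dx1 (u t) x v - dx1 (u t) y v|)
        (P := W * ‖v‖) (Q := 2 * W * ‖v‖) hγ (norm_nonneg _) (by positivity) (by positivity)
        (by linarith [HC.lip1 t ht x hx y hy v]) (d1diff t ht t ht x hx y hy v)
      rw [sub_apply, Real.norm_eq_abs]
      refine k.trans ?_
      calc (W * ‖v‖ + 2 * W * ‖v‖) * ‖x - y‖ ^ γ = 3 * W * ‖x - y‖ ^ γ * ‖v‖ := by ring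
        _ ≤ _ := by gcongr; linarith
    · refine ContinuousLinearMap.opNorm_le_bound _ (by positivity) fun v => ?_
      have k := le_rpow_of_le_of_le (ρ := √|t - s|) (F := |dx1 (u t) x v - dx1 (u s) x v|)
        (P := W * ‖v‖) (Q := 2 * W * ‖v‖) hγ (Real.sqrt_nonneg _) (by positivity) (by positivity)
        (by linarith [HC.time1 t ht s hs x hx v]) (d1diff t ht s hs x hx x hx v)
      rw [sub_apply, Real.norm_eq_abs]
      rw [tab] at k
      refine k.trans ?_
      calc (W * ‖v‖ + 2 * W * ‖v‖) * |t - s| ^ (γ / 2) = 3 * W * |t - s| ^ (γ / 2) * ‖v‖ := by ring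
        _ ≤ _ := by gcongr; linarith
  · refine parHolderBound_of_space_time (fun t ht x hx => ?_) (fun t ht x hx y hy => ?_)
      fun t ht s hs x hx => ?_
    · refine ContinuousLinearMap.opNorm_le_bound₂ _ pB fun v w => ?_
      refine (HB.bd2 t ht x hx v w).trans ?_
      gcongr
      linarith
    · refine ContinuousLinearMap.opNorm_le_bound₂ _ (by positivity) fun v w => ?_
      refine (hol t ht x hx y hy v w).trans ?_
      gcongr
      linarith
    · refine ContinuousLinearMap.opNorm_le_bound₂ _ (by positivity) fun v w => ?_
      refine (HB.abs_dx2_time_le pB2 hdt ht hs hx v w).trans ?_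
      gcongr
      linarith

end

section
variable {d : ℕ}

/-- The vector with all coordinates equal to one. -/
def onesVec (d : ℕ) : Euc d := WithLp.toLp 2 fun _ => 1

lemma inner_onesVec_ebasis (j : Fin d) : inner ℝ (onesVec d) (ebasis d j) = 1 := by
  simp [onesVec, ebasis, EuclideanSpace.inner_single_right]

lemma HeatAt.mul_affine (ν : ℝ) {m : ℝ → ℝ} {m' t : ℝ} (hm : HasDerivAt m m' t) (n x : Euc d)
    (σ L : ℝ) : HeatAt ν (fun t x => m t * (σ * inner ℝ n x + L)) t x
      (m' * (σ * inner ℝ n x + L)) := by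
  refine ⟨m' * (σ * inner ℝ n x + L), 0, hm.mul_const _, fun v => ?_, by simp⟩
  refine tendsto_const_nhds.congr fun s => ?_
  simp only [inner_add_right, inner_sub_right, inner_smul_right, zero_apply]
  ring

/-- The sign condition turns an affine function, multiplied by a supersolution of the Riccati
inequality, into an upper barrier. -/
theorem IsSol.abs_le_barrier {γ ν c C N L t₀ : ℝ} (hγ : 0 < γ) (hν : 0 < ν) (hc : 0 < c)
    (hC : 0 < C) (hN : 0 ≤ N) {A : ℝ → Fin d → ℝ} (hsgn : SignCondition A c C) {D : Set (Euc d)}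
    (hD : IsOpen D) (hDb : Bornology.IsBounded D)
    (hL : ∀ x ∈ closure D, |inner ℝ (onesVec d) x| + 1 ≤ L) {u h : ℝ → Euc d → ℝ}
    (hsol : IsSol ν D t₀ u (source A h u)) (hol : ∀ t ≥ t₀, ∃ S, HolAt γ D (u t) S)
    (hh : ∀ t ≥ t₀, ∀ x ∈ closure D, |h t x| ≤ N) {m m' : ℝ → ℝ}
    (hm : ∀ t ≥ t₀, HasDerivAt m (m' t) t) (hm1 : ∀ t ≥ t₀, 1 ≤ m t)
    (hmr : ∀ t ≥ t₀, m t * (N + C) < c * m t ^ 2 + m' t)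
    (h0 : ∀ x ∈ closure D, |u t₀ x| ≤ m t₀) :
    ∀ t ≥ t₀, ∀ x ∈ closure D, |u t x| ≤ m t * (2 * L) := by
  have key : ∀ σ : ℝ, (σ = 1 ∨ σ = -1) → ∀ t ≥ t₀, ∀ x ∈ closure D,
      σ * u t x ≤ m t * (σ * inner ℝ (onesVec d) x + L) := by
    intro σ hσ t₁ ht₁ x₁ hx₁
    have hσ2 : σ * σ = 1 := by rcases hσ with rfl | rfl <;> norm_num
    have hσa : ∀ z, |σ * z| = |z| := by rcases hσ with rfl | rfl <;> simp
    have hφ : ∀ x ∈ closure D, 1 ≤ σ * inner ℝ (onesVec d) x + L := fun x hx => by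
      have k1 := hL x hx
      have k2 := neg_abs_le (σ * inner ℝ (onesVec d) x)
      rw [hσa] at k2
      linarith
    have main := nonpos_of_strict_subsolution (ν := ν) (t₀ := t₀) (t₁ := t₁) (H := closure D)
      (w := fun t x => σ * u t x - m t * (σ * inner ℝ (onesVec d) x + L)) hν.le
      hDb.isCompact_closure ?_ ?_ t₁ ⟨ht₁, le_rfl⟩ x₁ hx₁
    · linarith
    · have c1 : ContinuousOn (fun p : ℝ × Euc d => u p.1 p.2) (Icc t₀ t₁ ×ˢ closure D) :=
        hsol.cont.mono (prod_mono Icc_subset_Ici_self subset_rfl)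
      have c2 : ContinuousOn (fun p : ℝ × Euc d => m p.1) (Icc t₀ t₁ ×ˢ closure D) := fun p hp =>
        ((hm p.1 hp.1.1).continuousAt.comp continuousAt_fst).continuousWithinAt
      exact (continuousOn_const.mul c1).sub (c2.mul (Continuous.continuousOn (by fun_prop)))
    · intro t ht x hx hpos hmax
      have htt : t₀ ≤ t := ht.1
      have hmt := hm1 t htt
      have hφx := hφ x hx
      have hgt : m t * (σ * inner ℝ (onesVec d) x + L) < σ * u t x := by linarith
      have hge : m t ≤ m t * (σ * inner ℝ (onesVec d) x + L) := le_mul_of_one_le_right (by linarith) hφx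
      have hxD : x ∈ D := by
        by_contra hcon
        have hf : x ∈ frontier D := ⟨hx, by rwa [hD.interior_eq]⟩
        rw [hsol.bc t htt x hf] at hgt
        linarith
      refine ⟨?_, ?_, ?_⟩
      · refine lt_of_le_of_ne htt fun heq => ?_
        subst heq
        have k1 := h0 x hx
        have k2 := le_abs_self (σ * u t₀ x)
        rw [hσa] at k2
        linarith
      · filter_upwards [hD.mem_nhds hxD] with y hy using subset_closure hy
      · obtain ⟨S, hS⟩ := hol t htt
        have hheat : HeatAt ν u t x (source A h u t x) := by
          rw [← hsol.pde t htt x hx]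
          refine HeatAt.of_hasFDerivAt (g1 := dx1 (u t)) (hsol.dt t htt x hx) ?_ ?_
            ((hS.mono (le_abs_self S)).continuousAt hγ (abs_nonneg S) hD hxD)
          · filter_upwards [hD.mem_nhds hxD] with y hy using hsol.d1 t htt y (subset_closure hy)
          · filter_upwards [hD.mem_nhds hxD] with y hy using hsol.d2 t htt y (subset_closure hy)
        refine ⟨_, ?_, (hheat.const_mul σ).sub (HeatAt.mul_affine ν (hm t htt) (onesVec d) x σ L)⟩
        have hgrad : ∀ j, dx1 (u t) x (ebasis d j) = m t := by
          have hfd : HasFDerivAt (fun x => σ * u t x - m t * (σ * inner ℝ (onesVec d) x + L))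
              (σ • dx1 (u t) x - m t • (σ • innerSL ℝ (onesVec d))) x :=
            ((hsol.d1 t htt x hx).const_mul σ).sub
              ((((innerSL ℝ (onesVec d)).hasFDerivAt.const_mul σ).add_const L).const_mul (m t))
          have hlm : IsLocalMax (fun x => σ * u t x - m t * (σ * inner ℝ (onesVec d) x + L)) x := by
            filter_upwards [hD.mem_nhds hxD] with y hy using hmax t ht y (subset_closure hy)
          have hz := hlm.hasFDerivAt_eq_zero hfd
          intro j
          have := congrArg (fun l : Euc d →L[ℝ] ℝ => l (ebasis d j)) hz
          simp only [sub_apply, smul_apply, smul_eq_mul, innerSL_apply_apply,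
            inner_onesVec_ebasis, zero_apply] at this
          have h2 : σ * σ * dx1 (u t) x (ebasis d j) = σ * σ * m t := by linear_combination σ * this
          simpa [hσ2] using h2
        have hsg : Real.sign (u t x) = σ := by
          rcases hσ with rfl | rfl
          · exact Real.sign_of_pos (by linarith)
          · exact Real.sign_of_neg (by linarith)
        have hs := hsgn (u t x)
        rw [hsg] at hs
        have hau : m t * (σ * inner ℝ (onesVec d) x + L) ≤ |u t x| := by
          have := le_abs_self (σ * u t x)
          rw [hσa] at this
          linarith
        have hsrc : σ * source A h u t x =
            σ * h t x - m t * ((∑ j, deriv (fun v => A v j) (u t x)) * σ) := by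
          unfold source
          simp only [hgrad, ← Finset.sum_mul]
          ring
        have hhx : σ * h t x ≤ N := by
          have := le_abs_self (σ * h t x)
          rw [hσa] at this
          linarith [hh t htt x hx]
        rw [hsrc]
        set φ := σ * inner ℝ (onesVec d) x + L
        have hr := hmr t htt
        have k1 : m t * (c * (m t * φ) - C) ≤
            m t * ((∑ j, deriv (fun v => A v j) (u t x)) * σ) := by
          have := mul_le_mul_of_nonneg_left hau hc.le
          exact mul_le_mul_of_nonneg_left (by linarith) (by linarith)
        have k2 : N + m t * C ≤ m t * (N + C) * φ := by
          have e1 : N ≤ m t * N := le_mul_of_one_le_left hN hmt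
          have e2 : 0 ≤ m t * (N + C) := by positivity
          have e3 := le_mul_of_one_le_right e2 hφx
          linarith
        have k3 : m t * (N + C) * φ < (c * m t ^ 2 + m' t) * φ :=
          mul_lt_mul_of_pos_right hr (by linarith)
        nlinarith
  intro t ht x hx
  have k1 := key 1 (Or.inl rfl) t ht x hx
  have k2 := key (-1) (Or.inr rfl) t ht x hx
  have k3 := hL x hx
  have k4 := abs_le.1 (le_refl |inner ℝ (onesVec d) x|)
  have hm0 := hm1 t ht
  have k5 : m t * (1 * inner ℝ (onesVec d) x + L) ≤ m t * (2 * L) := by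
    gcongr; linarith
  have k6 : m t * (-1 * inner ℝ (onesVec d) x + L) ≤ m t * (2 * L) := by
    gcongr; linarith
  rw [abs_le]
  constructor <;> linarith

lemma IsSol.mono {ν a a' : ℝ} {D : Set (Euc d)} {u f : ℝ → Euc d → ℝ} (H : IsSol ν D a u f)
    (ha : a ≤ a') : IsSol ν D a' u f :=
  ⟨fun t ht => H.d1 t (ha.trans ht), fun t ht => H.d2 t (ha.trans ht),
    fun t ht => H.dt t (ha.trans ht), H.cont.mono (prod_mono (Ici_subset_Ici.2 ha) subset_rfl),
    fun t ht => H.pde t (ha.trans ht), fun t ht => H.bc t (ha.trans ht)⟩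

/-- The maximum principle in terms of the initial datum. -/
theorem IsSol.abs_le_of_initial {γ ν c C N L a M₀ : ℝ} (hγ : 0 < γ) (hν : 0 < ν) (hc : 0 < c)
    (hC : 0 < C) (hN : 0 ≤ N) {A : ℝ → Fin d → ℝ} (hsgn : SignCondition A c C) {D : Set (Euc d)}
    (hD : IsOpen D) (hDb : Bornology.IsBounded D)
    (hL : ∀ x ∈ closure D, |inner ℝ (onesVec d) x| + 1 ≤ L) {u h : ℝ → Euc d → ℝ}
    (hsol : IsSol ν D a u (source A h u)) (hol : ∀ t ≥ a, ∃ S, HolAt γ D (u t) S)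
    (hh : ∀ t ≥ a, ∀ x ∈ closure D, |h t x| ≤ N) (hM₀ : 0 ≤ M₀)
    (h0 : ∀ x ∈ closure D, |u a x| ≤ M₀) :
    ∀ t ≥ a, ∀ x ∈ closure D, |u t x| ≤ ((N + C) / c + 1 + M₀) * (2 * L) := by
  have hp : 0 ≤ (N + C) / c := by positivity
  refine hsol.abs_le_barrier hγ hν hc hC hN hsgn hD hDb hL hol hh (m := fun _ => (N + C) / c + 1 + M₀)
    (m' := fun _ => 0) (fun t _ => hasDerivAt_const _ _) (fun t _ => by linarith) (fun t _ => ?_)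
    (fun x hx => (h0 x hx).trans (by linarith))
  have e1 : c * ((N + C) / c) = N + C := by field_simp
  set k := (N + C) / c
  rw [← e1]
  have : 0 < c * (k + 1 + M₀) * (1 + M₀) := by positivity
  linarith

/-- The maximum principle after a positive time, independently of the initial datum. -/
theorem IsSol.abs_le_of_pos {γ ν c C N L τ M₀ : ℝ} (hγ : 0 < γ) (hν : 0 < ν) (hc : 0 < c)
    (hC : 0 < C) (hN : 0 ≤ N) {A : ℝ → Fin d → ℝ} (hsgn : SignCondition A c C) {D : Set (Euc d)}
    (hD : IsOpen D) (hDb : Bornology.IsBounded D) (hL0 : 0 ≤ L)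
    (hL : ∀ x ∈ closure D, |inner ℝ (onesVec d) x| + 1 ≤ L) {u h : ℝ → Euc d → ℝ}
    (hsol : IsSol ν D 0 u (source A h u)) (hol : ∀ t ≥ 0, ∃ S, HolAt γ D (u t) S)
    (hh : ∀ t ≥ 0, ∀ x ∈ closure D, |h t x| ≤ N) (hbdd : ∀ t ≥ 0, ∀ x ∈ closure D, |u t x| ≤ M₀)
    (hτ : 0 < τ) :
    ∀ t ≥ τ, ∀ x ∈ closure D, |u t x| ≤ ((N + C) / c + 1 + 1 / (c * τ)) * (2 * L) := by
  have hp : 0 ≤ (N + C) / c := by positivity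
  set t₀ := min τ (1 / (c * (|M₀| + 1))) with ht₀
  have ht₀pos : 0 < t₀ := by positivity
  have hpos : ∀ t ≥ t₀, 0 < t := fun t ht => ht₀pos.trans_le ht
  have h1 := (hsol.mono ht₀pos.le).abs_le_barrier hγ hν hc hC hN hsgn hD hDb hL
    (fun t ht => hol t (hpos t ht).le) (fun t ht => hh t (hpos t ht).le)
    (m := fun t => (N + C) / c + 1 + 1 / c * t⁻¹) (m' := fun t => 1 / c * (-(t ^ 2)⁻¹))
    (fun t ht => ((hasDerivAt_inv (hpos t ht).ne').const_mul _).const_add _)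
    (fun t ht => by
      have := hpos t ht
      have : 0 ≤ 1 / c * t⁻¹ := by positivity
      linarith)
    (fun t ht => by
      have h3 := hpos t ht
      have e1 : c * ((N + C) / c) = N + C := by field_simp
      set k := (N + C) / c
      set q := 1 / c * t⁻¹ with hq
      have e2 : 1 / c * (-(t ^ 2)⁻¹) = - (c * q ^ 2) := by rw [hq]; field_simp
      have hq0 : 0 < q := by positivity
      rw [e2, ← e1]
      have : 0 < c * (k + 1 + q) := by positivity
      have h5 : 0 ≤ c * q * (k + 1) := by positivity
      nlinarith)
    (fun x hx => by
      have h3 := hbdd t₀ ht₀pos.le x hx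
      have h4 : |M₀| + 1 ≤ 1 / c * t₀⁻¹ := by
        have h5 : t₀ ≤ 1 / (c * (|M₀| + 1)) := min_le_right _ _
        rw [one_div_mul_eq_div, le_div_iff₀ hc, le_inv_comm₀ (by positivity) ht₀pos]
        rwa [one_div, mul_comm] at h5
      linarith [le_abs_self M₀])
  intro t ht x hx
  refine (h1 t ((min_le_left _ _).trans ht) x hx).trans ?_
  have : 1 / c * t⁻¹ ≤ 1 / (c * τ) := by
    rw [one_div_mul_eq_div, ← one_div, div_div, mul_comm t]
    gcongr
  gcongr

end

section
variable {d : ℕ}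

lemma divA_eq {A : ℝ → Fin d → ℝ} (hA : ContDiff ℝ 2 A) {g : Euc d → ℝ} {x : Euc d}
    (hg : DifferentiableAt ℝ g x) :
    divA A g x = ∑ j, deriv (fun v => A v j) (g x) * dx1 g x (ebasis d j) := by
  unfold divA dx1
  refine Finset.sum_congr rfl fun j _ => ?_
  have h1 : DifferentiableAt ℝ (fun v => A v j) (g x) :=
    ((contDiff_pi.1 hA j).differentiable (by norm_num)) _
  have := (h1.hasDerivAt.comp_hasFDerivAt x hg.hasFDerivAt).fderiv
  rw [show (fun y => A (g y) j) = (fun v => A v j) ∘ g from rfl, this]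
  simp

lemma SolvesPDE.isSol {γ ν : ℝ} {A : ℝ → Fin d → ℝ} {D : Set (Euc d)} {h u : ℝ → Euc d → ℝ}
    (hA : ContDiff ℝ 2 A) (hpde : SolvesPDE ν A (Ioi 0) D h u)
    (hh : MemParHolder γ (Ici 0) D h) (hu : MemXgamma γ (Ici 0) D u)
    (hbc : DirichletBC (Ici 0) D u) : IsSol ν D 0 u (source A h u) := by
  obtain ⟨⟨c0, c1, c2, c3, c4, c5, c6⟩, -⟩ := hu
  refine ⟨fun t ht x hx => (c2 t ht x hx).hasFDerivAt, fun t ht x hx => (c3 t ht x hx).hasFDerivAt,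
    fun t ht x hx => (c1 x hx t ht).hasDerivAt, c0, ?_, hbc⟩
  have hcl : Ici (0:ℝ) ×ˢ closure D ⊆ closure (Ioi (0:ℝ) ×ˢ D) := by
    rw [closure_prod_eq, closure_Ioi]
  have hlap : ContinuousOn (fun p : ℝ × Euc d => lapl (u p.1) p.2) (Ici 0 ×ˢ closure D) :=
    continuousOn_finsetSum _ fun j _ =>
      (c6.clm_apply continuousOn_const).clm_apply continuousOn_const
  have hsrc : ContinuousOn (fun p : ℝ × Euc d => source A h u p.1 p.2) (Ici 0 ×ˢ closure D) :=
    hh.1.sub (continuousOn_finsetSum _ fun j _ =>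
      ((((contDiff_pi.1 hA j).continuous_deriv (by norm_num)).comp_continuousOn c0).mul
        (c5.clm_apply continuousOn_const)))
  have key : EqOn (fun p : ℝ × Euc d => dtt u p.1 p.2 - ν * lapl (u p.1) p.2)
      (fun p : ℝ × Euc d => source A h u p.1 p.2) (Ici 0 ×ˢ closure D) := by
    refine EqOn.of_subset_closure (s := Ioi (0:ℝ) ×ˢ D) ?_ (c4.sub (continuousOn_const.mul hlap))
      hsrc (prod_mono Ioi_subset_Ici_self subset_closure) hcl
    intro p hp
    have h1 := hpde p.1 hp.1 p.2 hp.2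
    rw [divA_eq hA (c2 p.1 (Ioi_subset_Ici_self hp.1) p.2 (subset_closure hp.2))] at h1
    simp only [source]
    linarith
  exact fun t ht x hx => key (show (t, x) ∈ Ici (0:ℝ) ×ˢ closure D from ⟨ht, hx⟩)

lemma exists_deriv_bounds {A : ℝ → Fin d → ℝ} (hA : ContDiff ℝ 2 A) (M : ℝ) :
    ∃ α ≥ 0, (∀ v, |v| ≤ M → ∀ j, |deriv (fun v => A v j) v| ≤ α) ∧
      ∀ v w, |v| ≤ M → |w| ≤ M → ∀ j,
        |deriv (fun v => A v j) v - deriv (fun v => A v j) w| ≤ α * |v - w| := by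
  have h1 : ∀ j, ∃ α, 0 ≤ α ∧ (∀ v, |v| ≤ M → |deriv (fun v => A v j) v| ≤ α) ∧
      ∀ v w, |v| ≤ M → |w| ≤ M →
        |deriv (fun v => A v j) v - deriv (fun v => A v j) w| ≤ α * |v - w| := by
    intro j
    have hj : ContDiff ℝ 2 (fun v => A v j) := contDiff_pi.1 hA j
    have hj1 : ContDiff ℝ 1 (deriv (fun v => A v j)) :=
      ((contDiff_succ_iff_deriv (n := 1)).1 (by norm_num; exact hj)).2.2
    obtain ⟨a, ha⟩ := isCompact_Icc.exists_bound_of_continuousOn (s := Icc (-M) M)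
      hj1.continuous.continuousOn
    obtain ⟨b, hb⟩ := isCompact_Icc.exists_bound_of_continuousOn (s := Icc (-M) M)
      (hj1.continuous_deriv le_rfl).continuousOn
    refine ⟨|a| + |b|, by positivity, fun v hv => ?_, fun v w hv hw => ?_⟩
    · have := ha v (abs_le.1 hv)
      rw [Real.norm_eq_abs] at this
      linarith [le_abs_self a, abs_nonneg b]
    · have := Convex.norm_image_sub_le_of_norm_deriv_le (f := deriv (fun v => A v j))
        (s := Icc (-M) M) (x := w) (y := v) (C := b)
        (fun z _ => hj1.differentiable (by norm_num) z) hb (convex_Icc _ _) (abs_le.1 hw)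
        (abs_le.1 hv)
      rw [Real.norm_eq_abs, Real.norm_eq_abs] at this
      refine this.trans ?_
      gcongr
      linarith [le_abs_self b, abs_nonneg a]
  choose α h0 h2 h3 using h1
  have hle : ∀ j, α j ≤ ∑ j, α j := fun j =>
    Finset.single_le_sum (f := α) (fun i _ => h0 i) (Finset.mem_univ j)
  exact ⟨∑ j, α j, Finset.sum_nonneg fun j _ => h0 j, fun v hv j => (h2 j v hv).trans (hle j),
    fun v w hv hw j => (h3 j v w hv hw).trans
      (mul_le_mul_of_nonneg_right (hle j) (abs_nonneg _))⟩

lemma SignCondition.pos {A : ℝ → Fin d → ℝ} {c C : ℝ} (hc : 0 < c) (h : SignCondition A c C) :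
    0 < d := by
  rcases Nat.eq_zero_or_pos d with rfl | hd
  · have := h ((|C| + 1) / c)
    rw [abs_of_pos (by positivity), mul_div_cancel₀ _ hc.ne'] at this
    simp only [Finset.univ_eq_empty, Finset.sum_empty, zero_mul] at this
    linarith [le_abs_self C]
  · exact hd

lemma HolAt.of_norm {γ S : ℝ} {D : Set (Euc d)} {g : Euc d → ℝ}
    (h : ∀ x ∈ closure D, ∀ y ∈ closure D, ‖dx2 g x - dx2 g y‖ ≤ S * ‖x - y‖ ^ γ) :
    HolAt γ D g S := by
  intro x hx y hy v w
  have := ContinuousLinearMap.le_opNorm₂ (dx2 g x - dx2 g y) v w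
  rw [sub_apply, sub_apply, Real.norm_eq_abs] at this
  refine this.trans ?_
  have := h x hx y hy
  gcongr

lemma XgammaBound.holAt {γ a B : ℝ} (hγ : 0 < γ) {D : Set (Euc d)} {u : ℝ → Euc d → ℝ}
    (h : XgammaBound γ (Ici a) D u B) {t : ℝ} (ht : a ≤ t) : HolAt γ D (u t) B := by
  refine HolAt.of_norm fun x hx y hy => ?_
  simpa [Real.zero_rpow (half_pos hγ).ne'] using h.2.2.2.2 t ht t ht x hx y hy

lemma C2gammaBound.holAt_of_eqOn {γ P S : ℝ} (hγ : 0 < γ) {D : Set (Euc d)} (hD : IsOpen D)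
    {u₀ g : Euc d → ℝ} (h : C2gammaBound γ D u₀ P) (hg : HolAt γ D g S)
    (heq : ∀ x ∈ closure D, g x = u₀ x) : HolAt γ D g P := by
  refine hg.of_mem hγ fun x hx y hy v w => ?_
  have e : ∀ x ∈ D, dx2 g x = dx2 u₀ x := fun x hx => by
    have h1 : g =ᶠ[𝓝 x] u₀ := by
      filter_upwards [hD.mem_nhds hx] with y hy using heq y (subset_closure hy)
    exact (h1.fderiv).fderiv_eq
  rw [e x hx, e y hy]
  exact HolAt.of_norm h.2.2.2 x (subset_closure hx) y (subset_closure hy) v w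

/-- The geometric constants of a domain. -/
lemma GoodDomain.exists_constants {D : Set (Euc d)} (hD : GoodDomain D) (hd : 0 < d) :
    ∃ r > 0, r ≤ 1 ∧ ConeCond D r ∧ ∃ r₁ > 0, r₁ ≤ 1 / 2 ∧ ∃ M₁ ≥ 1, HasCharts D r₁ M₁ := by
  obtain ⟨r₀, hr₀, M₁, hM₁, hch⟩ := exists_charts hD
  obtain ⟨r, hr, hcone⟩ := hch.coneCond hd hD.1 hr₀ hM₁
  refine ⟨min r 1, by positivity, min_le_right _ _, fun x hx => ?_, min r₀ (1 / 2), by positivity,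
    min_le_right _ _, M₁, hM₁, fun x₀ hx₀ => ?_⟩
  · obtain ⟨e, he, H⟩ := hcone x hx
    exact ⟨e, he, fun y hy hyx η hη s hs => H y hy (hyx.trans (min_le_left _ _)) η hη s
      ⟨hs.1, hs.2.trans (min_le_left _ _)⟩⟩
  · obtain ⟨ψ, e, H⟩ := hch x₀ hx₀
    exact ⟨ψ, e, H.mono (min_le_left _ _) le_rfl⟩

lemma exists_onesVec_bound {D : Set (Euc d)} (hD : Bornology.IsBounded D) :
    ∃ L ≥ 0, ∀ x ∈ closure D, |inner ℝ (onesVec d) x| + 1 ≤ L := by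
  obtain ⟨R, hR⟩ := hD.isCompact_closure.exists_bound_of_continuousOn
    (f := fun x => inner ℝ (onesVec d) x) (by fun_prop)
  exact ⟨|R| + 1, by positivity, fun x hx => by
    have := hR x hx
    rw [Real.norm_eq_abs] at this
    linarith [le_abs_self R]⟩

lemma parHolderBound.mono {Y : Type*} [NormedAddCommGroup Y] {γ N N' : ℝ} {J : Set ℝ}
    {D : Set (Euc d)} {f : ℝ → Euc d → Y} (h : parHolderBound γ J D f N) (hN : N ≤ N') :
    parHolderBound γ J D f N' :=
  ⟨fun t ht x hx => (h.1 t ht x hx).trans hN, fun t ht s hs x hx y hy =>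
    (h.2 t ht s hs x hx y hy).trans (mul_le_mul_of_nonneg_right hN (by positivity))⟩

lemma holderBoundOn.mono {X Y : Type*} [NormedAddCommGroup X] [NormedAddCommGroup Y] {γ N N' : ℝ}
    {S : Set X} {f : X → Y} (h : holderBoundOn γ S f N) (hN : N ≤ N') : holderBoundOn γ S f N' :=
  ⟨fun x hx => (h.1 x hx).trans hN, fun x hx y hy =>
    (h.2 x hx y hy).trans (mul_le_mul_of_nonneg_right hN (by positivity))⟩

lemma XgammaBound.norm_le {γ B : ℝ} {J : Set ℝ} {D : Set (Euc d)} {u : ℝ → Euc d → ℝ}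
    (h : XgammaBound γ J D u B) (hB : 0 ≤ B) : XgammaNorm γ J D u ≤ B :=
  csInf_le ⟨0, fun _ hN => hN.1⟩ ⟨hB, h⟩

lemma MemParHolder.bound {γ N : ℝ} {J : Set ℝ} {D : Set (Euc d)} {h : ℝ → Euc d → ℝ}
    (hh : MemParHolder γ J D h) (hN : parHolderNorm γ J D h < N) : parHolderBound γ J D h N := by
  obtain ⟨N₀, hN₀⟩ := hh.2
  have hne : {N : ℝ | 0 ≤ N ∧ parHolderBound γ J D h N}.Nonempty :=
    ⟨|N₀|, abs_nonneg _, hN₀.mono (le_abs_self _)⟩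
  obtain ⟨N', hN', hlt⟩ := exists_lt_of_csInf_lt hne hN
  exact hN'.2.mono hlt.le

lemma MemC2gamma.bound {γ N : ℝ} {D : Set (Euc d)} {g : Euc d → ℝ}
    (hg : MemC2gamma γ D g) (hN : C2gammaNorm γ D g < N) : C2gammaBound γ D g N := by
  have hmono : ∀ N N', C2gammaBound γ D g N → N ≤ N' → C2gammaBound γ D g N' :=
    fun N N' h hN => ⟨h.1.mono hN, h.2.1.mono hN, h.2.2.mono hN⟩
  obtain ⟨N₀, hN₀⟩ := hg.2
  have hne : {N : ℝ | 0 ≤ N ∧ C2gammaBound γ D g N}.Nonempty :=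
    ⟨|N₀|, abs_nonneg _, hmono _ _ hN₀ (le_abs_self _)⟩
  obtain ⟨N', hN', hlt⟩ := exists_lt_of_csInf_lt hne hN
  exact hmono _ _ hN'.2 hlt.le

/-- From bounds on the data, the equation and a sup bound to `BaseSol`. -/
lemma IsSol.baseSol {γ ν r N M α a : ℝ} {A : ℝ → Fin d → ℝ} {D : Set (Euc d)}
    {u h : ℝ → Euc d → ℝ} (hγ : γ ∈ Ioo (0:ℝ) 1) (hν : 0 < ν) (hcone : ConeCond D r) (hr : 0 < r)
    (hr1 : r ≤ 1) (hN : 0 ≤ N) (hM : 0 ≤ M) (hα : 0 ≤ α) (ha : 0 ≤ a)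
    (hsol : IsSol ν D a u (source A h u)) (hbdd : ∀ t ≥ a, ∀ x ∈ closure D, |u t x| ≤ M)
    (hh : parHolderBound γ (Ici 0) D h N)
    (hA1 : ∀ v, |v| ≤ M → ∀ j, |deriv (fun v => A v j) v| ≤ α)
    (hA2 : ∀ v w, |v| ≤ M → |w| ≤ M → ∀ j,
      |deriv (fun v => A v j) v - deriv (fun v => A v j) w| ≤ α * |v - w|) :
    BaseSol γ ν r N M α A D a u h where
  hγ := hγ
  hν := hν
  cone := hcone
  r_pos := hr
  r_le := hr1
  N_nonneg := hN
  M_nonneg := hM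
  α_nonneg := hα
  sol := hsol
  bdd := hbdd
  h_bdd t ht x hx := hh.1 t (ha.trans ht) x hx
  h_space t ht x hx y hy := by
    simpa [Real.zero_rpow (half_pos hγ.1).ne'] using
      hh.2 t (ha.trans ht) t (ha.trans ht) x hx y hy
  h_time t ht s hs x hx := by
    simpa [Real.zero_rpow hγ.1.ne'] using hh.2 t (ha.trans ht) s (ha.trans hs) x hx x hx
  A1 := hA1
  A2 := hA2

end

section
variable {d : ℕ}

/-- Locally bounded functions have positive continuous majorants. -/
lemma exists_continuous_majorant {X : Type*} [TopologicalSpace X] [T2Space X] [NormalSpace X]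
    [ParacompactSpace X] {F : X → ℝ} (hF : ∀ x, ∃ B, ∀ᶠ y in 𝓝 x, F y ≤ B) :
    ∃ G : X → ℝ, Continuous G ∧ ∀ x, 0 < G x ∧ F x ≤ G x := by
  obtain ⟨g, hg⟩ := exists_continuous_forall_mem_convex_of_local_const
    (t := fun x => Ioi 0 ∩ Ici (F x)) (fun x => (convex_Ioi _).inter (convex_Ici _)) fun x => by
      obtain ⟨B, hB⟩ := hF x
      refine ⟨|B| + 1, hB.mono fun y hy => ⟨?_, ?_⟩⟩
      · exact mem_Ioi.2 (by positivity)
      · exact mem_Ici.2 (by linarith [le_abs_self B])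
  exact ⟨g, g.continuous, fun x => ⟨(hg x).1, (hg x).2⟩⟩

set_option maxHeartbeats 1000000 in
/-- Bounds on the data and on the initial datum bound the solution in `X^γ`. -/
theorem exists_xgammaBound_of_initial {D : Set (Euc d)} (hD : GoodDomain D) {γ ν c C : ℝ}
    (hγ : γ ∈ Ioo (0:ℝ) 1) (hν : 0 < ν) (hc : 0 < c) (hC : 0 < C) {A : ℝ → Fin d → ℝ}
    (hA : ContDiff ℝ 2 A) (hsgn : SignCondition A c C) {N : ℝ} (hN : 0 ≤ N) :
    ∃ B > 0, ∀ (h : ℝ → Euc d → ℝ) (u₀ : Euc d → ℝ) (u : ℝ → Euc d → ℝ),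
      MemParHolder γ (Ici 0) D h → parHolderBound γ (Ici 0) D h N → C2gammaBound γ D u₀ N →
      MemXgamma γ (Ici 0) D u → SolvesPDE ν A (Ioi 0) D h u → DirichletBC (Ici 0) D u →
      (∀ x ∈ closure D, u 0 x = u₀ x) → XgammaBound γ (Ici 0) D u B := by
  obtain ⟨r, hr, hr1, hcone, r₁, hr₁, hr₁2, M₁, hM₁, hch⟩ := hD.exists_constants (hsgn.pos hc)
  obtain ⟨L, hL0, hL⟩ := exists_onesVec_bound hD.2.2.1
  set M := ((N + C) / c + 1 + N) * (2 * L) with hM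
  have hM0 : 0 ≤ M := by positivity
  obtain ⟨α, hα, hA1, hA2⟩ := exists_deriv_bounds hA M
  obtain ⟨S, hS, H₁⟩ := exists_holAt_of_initial hγ hν hr hN hM0 hα hM₁ hr₁ hr₁2 hD.1 hch
    (S₀ := N) hN
  obtain ⟨B, hB, H₂⟩ := exists_xgammaBound d hγ hν hr hN hM0 hα hS
  refine ⟨B, hB, fun h u₀ u hh hhN hu₀ hu hpde hbc hinit => ?_⟩
  have hsol := hpde.isSol hA hh hu hbc
  obtain ⟨B₀, hB₀⟩ := hu.2
  have hol : ∀ t ≥ (0:ℝ), HolAt γ D (u t) B₀ := fun t ht => hB₀.holAt hγ.1 ht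
  have hbdd := hsol.abs_le_of_initial hγ.1 hν hc hC hN hsgn hD.1 hD.2.2.1 hL
    (fun t ht => ⟨B₀, hol t ht⟩) (fun t ht x hx => hhN.1 t ht x hx) hN
    (fun x hx => by rw [hinit x hx]; exact hu₀.1.1 x hx)
  have hbase := hsol.baseSol hγ hν hcone hr hr1 hN hM0 hα le_rfl hbdd hhN hA1 hA2
  exact H₂ A D 0 u h hbase (H₁ A 0 u h hbase ⟨B₀, hol⟩
    (hu₀.holAt_of_eqOn hγ.1 hD.1 (hol 0 le_rfl) hinit))

set_option maxHeartbeats 1000000 in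
/-- After a positive time the `X^γ` bound does not depend on the initial datum. -/
theorem exists_xgammaBound_of_pos {D : Set (Euc d)} (hD : GoodDomain D) {γ ν c C : ℝ}
    (hγ : γ ∈ Ioo (0:ℝ) 1) (hν : 0 < ν) (hc : 0 < c) (hC : 0 < C) {A : ℝ → Fin d → ℝ}
    (hA : ContDiff ℝ 2 A) (hsgn : SignCondition A c C) {N τ : ℝ} (hN : 0 ≤ N) (hτ : 0 < τ) :
    ∃ B > 0, ∀ h u : ℝ → Euc d → ℝ,
      MemParHolder γ (Ici 0) D h → parHolderBound γ (Ici 0) D h N →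
      MemXgamma γ (Ici 0) D u → SolvesPDE ν A (Ioi 0) D h u → DirichletBC (Ici 0) D u →
      XgammaBound γ (Ici 0) D (fun t x => u (τ + t) x) B := by
  obtain ⟨r, hr, hr1, hcone, r₁, hr₁, hr₁2, M₁, hM₁, hch⟩ := hD.exists_constants (hsgn.pos hc)
  obtain ⟨L, hL0, hL⟩ := exists_onesVec_bound hD.2.2.1
  set M := ((N + C) / c + 1 + 1 / (c * (τ / 2))) * (2 * L) with hM
  have hM0 : 0 ≤ M := by positivity
  obtain ⟨α, hα, hA1, hA2⟩ := exists_deriv_bounds hA M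
  obtain ⟨S, hS, H₁⟩ := exists_holAt_of_pos hγ hν hr hN hM0 hα hM₁ hr₁ hr₁2 hD.1 hch
    (half_pos hτ)
  obtain ⟨B, hB, H₂⟩ := exists_xgammaBound d hγ hν hr hN hM0 hα hS
  refine ⟨B, hB, fun h u hh hhN hu hpde hbc => ?_⟩
  have hsol := hpde.isSol hA hh hu hbc
  obtain ⟨B₀, hB₀⟩ := hu.2
  have hol : ∀ t ≥ (0:ℝ), HolAt γ D (u t) B₀ := fun t ht => hB₀.holAt hγ.1 ht
  have hbdd := hsol.abs_le_of_pos hγ.1 hν hc hC hN hsgn hD.1 hD.2.2.1 hL0 hL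
    (fun t ht => ⟨B₀, hol t ht⟩) (fun t ht x hx => hhN.1 t ht x hx)
    (fun t ht x hx => hB₀.1 t ht x hx) (half_pos hτ)
  have hτ2 := (half_pos hτ).le
  have hbase := (hsol.mono hτ2).baseSol hγ hν hcone hr hr1 hN hM0 hα hτ2 hbdd hhN hA1 hA2
  refine (H₂ A D τ u h (hbase.mono (by linarith)) fun t ht => ?_).shift
  exact H₁ A (τ / 2) u h hbase ⟨B₀, fun t ht => hol t (hτ2.trans ht)⟩ t (by linarith)

end

/-- Corollary 1.5: (i) a bound on the `X^γ` norm of the solution depending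
continuously on `|||h|||_γ` and `‖u₀‖_{C^{2+γ}}`; (ii) for every `τ > 0`, a bound on the `X^γ`
norm of the time-shifted solution depending only on `τ` and `|||h|||_γ`. -/
theorem stmt_5 {d : ℕ} (D : Set (Euc d)) (hD : GoodDomain D)
    (γ ν c C : ℝ) (hγ : γ ∈ Ioo (0:ℝ) 1) (hν : 0 < ν) (hc : 0 < c) (hC : 0 < C)
    (A : ℝ → Fin d → ℝ) (hA : ContDiff ℝ 2 A) (hA0 : A 0 = 0) (hsgn : SignCondition A c C) :
    (∃ K : ℝ → ℝ → ℝ, Continuous (fun p : ℝ × ℝ => K p.1 p.2) ∧ (∀ a b, 0 < K a b) ∧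
      ∀ h : ℝ → Euc d → ℝ, ∀ u₀ : Euc d → ℝ, ∀ u : ℝ → Euc d → ℝ,
        MemParHolder γ (Ici 0) D h → MemC2gamma γ D u₀ → CompatCond ν A D h u₀ →
        MemXgamma γ (Ici 0) D u → SolvesPDE ν A (Ioi 0) D h u → DirichletBC (Ici 0) D u →
        (∀ x ∈ closure D, u 0 x = u₀ x) →
        XgammaNorm γ (Ici 0) D u ≤ K (parHolderNorm γ (Ici 0) D h) (C2gammaNorm γ D u₀)) ∧
    (∀ τ : ℝ, 0 < τ → ∃ Kτ : ℝ → ℝ, (∀ a, 0 < Kτ a) ∧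
      ∀ h : ℝ → Euc d → ℝ, ∀ u₀ : Euc d → ℝ, ∀ u : ℝ → Euc d → ℝ,
        MemParHolder γ (Ici 0) D h → MemC2gamma γ D u₀ → CompatCond ν A D h u₀ →
        MemXgamma γ (Ici 0) D u → SolvesPDE ν A (Ioi 0) D h u → DirichletBC (Ici 0) D u →
        (∀ x ∈ closure D, u 0 x = u₀ x) →
        XgammaNorm γ (Ici 0) D (fun t x => u (τ + t) x) ≤ Kτ (parHolderNorm γ (Ici 0) D h)) := by
  constructor
  · choose B hB H using fun n : ℕ =>
      exists_xgammaBound_of_initial hD hγ hν hc hC hA hsgn (N := n) n.cast_nonneg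
    obtain ⟨G, hG, hGB⟩ := exists_continuous_majorant
      (F := fun p : ℝ × ℝ => B (⌊max p.1 p.2⌋₊ + 1)) fun p => by
        refine ⟨∑ i ∈ Finset.range (⌊max p.1 p.2⌋₊ + 3), B i, ?_⟩
        have hc : ContinuousAt (fun q : ℝ × ℝ => max q.1 q.2) p := by fun_prop
        filter_upwards [hc.eventually_lt_const
          ((Nat.lt_floor_add_one (max p.1 p.2)).trans (lt_add_one _))] with q hq
        refine Finset.single_le_sum (f := B) (fun i _ => (hB i).le) (Finset.mem_range.2 ?_)
        have : ⌊max q.1 q.2⌋₊ < ⌊max p.1 p.2⌋₊ + 1 + 1 := by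
          rw [Nat.floor_lt' (by omega)]
          exact_mod_cast hq
        omega
    refine ⟨fun a b => G (a, b), hG, fun a b => (hGB _).1, ?_⟩
    intro h u₀ u hh hu₀ _ hu hpde hbc hinit
    set p := (parHolderNorm γ (Ici 0) D h, C2gammaNorm γ D u₀) with hp
    have hlt := Nat.lt_floor_add_one (max p.1 p.2)
    refine le_trans (XgammaBound.norm_le (H (⌊max p.1 p.2⌋₊ + 1) h u₀ u hh
      (hh.bound ?_) (hu₀.bound ?_) hu hpde hbc hinit) (hB _).le) (hGB p).2
    · push_cast
      exact (le_max_left _ _).trans_lt hlt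
    · push_cast
      exact (le_max_right _ _).trans_lt hlt
  · intro τ hτ
    choose B hB H using fun n : ℕ =>
      exists_xgammaBound_of_pos hD hγ hν hc hC hA hsgn (N := n) n.cast_nonneg hτ
    refine ⟨fun a => B (⌊a⌋₊ + 1), fun a => hB _, ?_⟩
    intro h u₀ u hh _ _ hu hpde hbc _
    refine XgammaBound.norm_le (H _ h u hh (hh.bound ?_) hu hpde hbc) (hB _).le
    push_cast
    exact Nat.lt_floor_add_one _

end
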